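/- Let (q,r) be an admissible pair with 2 < q < ∞ and let I ⊆ ℝ be an interval with 0 in its closure. Then there is a constant C, independent of I, such that: (i) ‖e^{itΔ}φ‖_{L^{q,2}(ℝ, L^r)} ≤ C ‖φ‖_{L²} for every φ ∈ L²(ℝ^d); and (ii) ‖∫₀^t e^{i(t-τ)Δ} f(τ) dτ‖_{L^{q,2}(I,L^r) ∩ L^∞(I,L²)} ≤ C ‖f‖_{L^{q',2}(I,L^{r'})} for every f ∈ L^{q',2}(I, L^{r'}(ℝ^d)). -/

import Mathlib

/- Common setting: the nonlinear Schrödinger equation `i ∂ₜ u + Δu + λ|u|^α u = 0`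
on `ℝ × ℝ^d`, formalized through its Duhamel (integral) formulation, with the free
Schrödinger group `e^{itΔ}` defined via its explicit kernel. -/

noncomputable section
open MeasureTheory Real Filter Topology Set
open scoped ENNReal NNReal

abbrev Rd (d : ℕ) := EuclideanSpace ℝ (Fin d)

/-- The free Schrödinger propagator `e^{itΔ}` on `ℝ^d`, defined through its explicit
kernel `(4πit)^{-d/2} e^{i|x-y|²/(4t)}` for `t ≠ 0`, and the identity for `t = 0`. -/
def sgroup (d : ℕ) (t : ℝ) (φ : Rd d → ℂ) : Rd d → ℂ :=
  if t = 0 then φ else fun x =>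
    (((4 * π * t : ℝ) : ℂ) * Complex.I) ^ (-(d : ℂ) / 2) *
      ∫ y : Rd d, Complex.exp (Complex.I * ((‖x - y‖ ^ 2 : ℝ) : ℂ) / ((4 * t : ℝ) : ℂ)) * φ y

/-- `L^p` norm (as an extended real) of a function on `ℝ^d`. -/
def LpN (d : ℕ) (p : ℝ) (f : Rd d → ℂ) : ℝ≥0∞ :=
  eLpNorm f (ENNReal.ofReal p) volume

/-- `L^p` norm of the (first-order) derivative. -/
def gradLpN (d : ℕ) (p : ℝ) (f : Rd d → ℂ) : ℝ≥0∞ :=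
  eLpNorm (fun x => fderiv ℝ f x) (ENNReal.ofReal p) volume

/-- `H¹` norm. -/
def H1N (d : ℕ) (f : Rd d → ℂ) : ℝ≥0∞ := LpN d 2 f + gradLpN d 2 f

/-- `H²` norm. -/
def H2N (d : ℕ) (f : Rd d → ℂ) : ℝ≥0∞ :=
  H1N d f + eLpNorm (fun x => fderiv ℝ (fun y => fderiv ℝ f y) x) 2 volume

/-- `W^{1,p}` norm. -/
def W1pN (d : ℕ) (p : ℝ) (f : Rd d → ℂ) : ℝ≥0∞ := LpN d p f + gradLpN d p f

/-- The weighted norm `‖ |x| f ‖_{L²}`. -/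
def weightN (d : ℕ) (f : Rd d → ℂ) : ℝ≥0∞ :=
  eLpNorm (fun x : Rd d => ‖x‖ * ‖f x‖) 2 volume

/-- Norm of `Σ = H¹ ∩ L²(|x|²dx)`. -/
def SigmaN (d : ℕ) (f : Rd d → ℂ) : ℝ≥0∞ := H1N d f + weightN d f

/-- Norm of `H² ∩ F(H²)` (recall `u ∈ F(H²)` iff `u ∈ L²` and `|x|²u ∈ L²`). -/
def H2FH2N (d : ℕ) (f : Rd d → ℂ) : ℝ≥0∞ :=
  H2N d f + eLpNorm (fun x : Rd d => ‖x‖ ^ 2 * ‖f x‖) 2 volume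

/-- Membership in `Σ`. -/
def MemSigma (d : ℕ) (f : Rd d → ℂ) : Prop :=
  AEStronglyMeasurable f volume ∧ SigmaN d f < ⊤

/-- Membership in `H² ∩ F(H²)`. -/
def MemH2FH2 (d : ℕ) (f : Rd d → ℂ) : Prop :=
  AEStronglyMeasurable f volume ∧ H2FH2N d f < ⊤

/-- `u` is a solution of the NLS `i∂ₜu + Δu + λ|u|^α u = 0`, `u(0) = u₀`, on the time
set `I`, in the Duhamel (integral equation) sense. -/
def IsSolution (d : ℕ) (lam α : ℝ) (u₀ : Rd d → ℂ) (u : ℝ → Rd d → ℂ) (I : Set ℝ) : Prop :=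
  u 0 = u₀ ∧ ∀ t ∈ I, ∀ x, u t x =
    sgroup d t u₀ x + Complex.I * (lam : ℂ) *
      ∫ τ in (0:ℝ)..t, sgroup d (t - τ) (fun y => ((‖u τ y‖ ^ α : ℝ) : ℂ) * u τ y) x

/-- `v` is a solution (Duhamel sense) of the nonautonomous equation
`i∂ₛv + Δv + λ(1-s)^{(αd-4)/2}|v|^α v = 0`, `v(s₀) = ψ`, on the time set `I`. -/
def IsNonautoSolution (d : ℕ) (lam α : ℝ) (s₀ : ℝ) (ψ : Rd d → ℂ) (v : ℝ → Rd d → ℂ)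
    (I : Set ℝ) : Prop :=
  v s₀ = ψ ∧ ∀ s ∈ I, ∀ y, v s y =
    sgroup d (s - s₀) ψ y + Complex.I * (lam : ℂ) *
      ∫ τ in s₀..s, sgroup d (s - τ)
        (fun z => (((1 - τ) ^ ((α * d - 4) / 2) * ‖v τ z‖ ^ α : ℝ) : ℂ) * v τ z) y

/-- Continuity with values in `Σ` on the time set `I`. -/
def SigmaContOn (d : ℕ) (u : ℝ → Rd d → ℂ) (I : Set ℝ) : Prop :=
  ∀ t ∈ I, Tendsto (fun s => SigmaN d (fun x => u s x - u t x)) (nhdsWithin t I) (nhds 0)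

/-- `e^{-itΔ}u(t)` converges strongly in `Σ` as `t → +∞`. -/
def ScattersAtPlus (d : ℕ) (u : ℝ → Rd d → ℂ) : Prop :=
  ∃ uplus : Rd d → ℂ, MemSigma d uplus ∧
    Tendsto (fun t => SigmaN d (fun x => sgroup d (-t) (u t) x - uplus x)) atTop (nhds 0)

/-- `e^{-itΔ}u(t)` converges strongly in `Σ` as `t → -∞`. -/
def ScattersAtMinus (d : ℕ) (u : ℝ → Rd d → ℂ) : Prop :=
  ∃ uminus : Rd d → ℂ, MemSigma d uminus ∧
    Tendsto (fun t => SigmaN d (fun x => sgroup d (-t) (u t) x - uminus x)) atBot (nhds 0)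

/-- `e^{-itΔ}u(t)` converges strongly in `L²` as `t → +∞`. -/
def ScattersL2AtPlus (d : ℕ) (u : ℝ → Rd d → ℂ) : Prop :=
  ∃ uplus : Rd d → ℂ,
    Tendsto (fun t => LpN d 2 (fun x => sgroup d (-t) (u t) x - uplus x)) atTop (nhds 0)

/-- `e^{-itΔ}u(t)` converges strongly in `L²` as `t → -∞`. -/
def ScattersL2AtMinus (d : ℕ) (u : ℝ → Rd d → ℂ) : Prop :=
  ∃ uminus : Rd d → ℂ,
    Tendsto (fun t => LpN d 2 (fun x => sgroup d (-t) (u t) x - uminus x)) atBot (nhds 0)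

/-- Weak `L^a` (Lorentz `L^{a,∞}`) quasinorm in time of a time-dependent quantity `g`
on the time set `I`. -/
def weakLNorm (a : ℝ) (I : Set ℝ) (g : ℝ → ℝ≥0∞) : ℝ≥0∞ :=
  ⨆ c : NNReal, (c : ℝ≥0∞) * (volume {t ∈ I | (c : ℝ≥0∞) ≤ g t}) ^ (1 / a)

/-- Lorentz `L^{q,2}` quasinorm in time of a time-dependent quantity `g` on the time
set `I`: `q^{1/2} ‖ c · μ{g ≥ c}^{1/q} ‖_{L²((0,∞),dc/c)}`. -/
def lorentz2Norm (q : ℝ) (I : Set ℝ) (g : ℝ → ℝ≥0∞) : ℝ≥0∞ :=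
  ENNReal.ofReal q ^ ((1:ℝ)/2) *
    (∫⁻ c in Ioi (0:ℝ),
      (ENNReal.ofReal c * volume {t ∈ I | ENNReal.ofReal c ≤ g t} ^ (1/q)) ^ (2:ℝ)
        / ENNReal.ofReal c) ^ ((1:ℝ)/2)

/-- The Galilean operator `P_t = x + 2it∇` (componentwise). -/
def Pop (d : ℕ) (t : ℝ) (f : Rd d → ℂ) : Rd d → Fin d → ℂ :=
  fun x j => ((x j : ℝ) : ℂ) * f x +
    2 * Complex.I * (t : ℂ) * fderiv ℝ f x (EuclideanSpace.single j 1)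

/-- `L^p` norm of `P_t f = (x + 2it∇)f`. -/
def PopLpN (d : ℕ) (p t : ℝ) (f : Rd d → ℂ) : ℝ≥0∞ :=
  eLpNorm (fun x => Real.sqrt (∑ j, ‖Pop d t f x j‖ ^ 2)) (ENNReal.ofReal p) volume

/-- The Laplacian, defined through iterated directional derivatives. -/
def lapl (d : ℕ) (f : Rd d → ℂ) : Rd d → ℂ :=
  fun x => ∑ j, fderiv ℝ (fun y => fderiv ℝ f y (EuclideanSpace.single j 1)) x
    (EuclideanSpace.single j 1)

/-- `Q` is a ground state of `-ΔQ + Q = |Q|^α Q`: a nontrivial positive solution in `Σ`. -/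
def IsGroundState (d : ℕ) (α : ℝ) (Q : Rd d → ℂ) : Prop :=
  MemSigma d Q ∧ Q ≠ 0 ∧ (∀ x, 0 ≤ (Q x).re ∧ (Q x).im = 0) ∧
    ∀ x, -lapl d Q x + Q x = ((‖Q x‖ ^ α : ℝ) : ℂ) * Q x

/-- Mass `M[f] = ∫ |f|²`. -/
def massI (d : ℕ) (f : Rd d → ℂ) : ℝ := ∫ x : Rd d, ‖f x‖ ^ 2

/-- Energy `E[f] = ½∫|∇f|² - λ/(α+2) ∫ |f|^{α+2}`. -/
def energyI (d : ℕ) (lam α : ℝ) (f : Rd d → ℂ) : ℝ :=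
  (1/2) * (∫ x : Rd d, ‖fderiv ℝ f x‖ ^ 2) - lam / (α + 2) * ∫ x : Rd d, ‖f x‖ ^ (α + 2)

/-- The `L²` norm, as a real number. -/
def l2norm (d : ℕ) (f : Rd d → ℂ) : ℝ := (∫ x : Rd d, ‖f x‖ ^ 2) ^ ((1:ℝ)/2)

/-- The `L²` norm of the gradient, as a real number. -/
def gradL2norm (d : ℕ) (f : Rd d → ℂ) : ℝ := (∫ x : Rd d, ‖fderiv ℝ f x‖ ^ 2) ^ ((1:ℝ)/2)

/-- A pair `(q,r)` is admissible: `2/q = d(1/2 - 1/r)`, `2 ≤ r` (with `r ≤ 2d/(d-2)`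
when `d ≥ 3`). -/
def IsAdmissible (d : ℕ) (q r : ℝ) : Prop :=
  2 / q = d * (1/2 - 1/r) ∧ 2 ≤ q ∧ 2 ≤ r ∧ (3 ≤ d → r ≤ 2 * d / (d - 2))

/-- `α_d = (-d + √(d²+16d))/(2d)`, the positive root of `dx² + dx - 4`. -/
def alphaRoot (d : ℕ) : ℝ := (-(d:ℝ) + Real.sqrt ((d:ℝ)^2 + 16*d)) / (2*d)

/-- `α(d) = (2 - d + √(d²+12d+4))/(2d)`, the positive root of `dx² + (d-2)x - 4`. -/
def alphaStar (d : ℕ) : ℝ := (2 - (d:ℝ) + Real.sqrt ((d:ℝ)^2 + 12*d + 4)) / (2*d)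

/-- A bound parametrized by the exponent `θ` of Lemma 4.1: `θ = (d+2)/4 - 1/α` if `d ≥ 3`,
`θ` any positive number less than `1 - 1/α` if `d = 2`, and `θ = 1 - 2/α` if `d = 1`. -/
def thetaBound (d : ℕ) (α : ℝ) (P : ℝ → Prop) : Prop :=
  (3 ≤ d → P (((d:ℝ)+2)/4 - 1/α)) ∧
  (d = 2 → ∀ θ : ℝ, 0 < θ → θ < 1 - 1/α → P θ) ∧
  (d = 1 → P (1 - 2/α))

/-- The set `R₊` of initial data in `Σ` whose solution is positively global and has a
scattering state at `+∞` in `Σ`. -/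
def Rplus (d : ℕ) (lam α : ℝ) : Set (Rd d → ℂ) :=
  {φ | MemSigma d φ ∧ ∃ u, IsSolution d lam α φ u (Ici 0) ∧ SigmaContOn d u (Ici 0) ∧
    ScattersAtPlus d u}

/-- The set `R₋` of initial data in `Σ` whose solution is negatively global and has a
scattering state at `-∞` in `Σ`. -/
def Rminus (d : ℕ) (lam α : ℝ) : Set (Rd d → ℂ) :=
  {φ | MemSigma d φ ∧ ∃ u, IsSolution d lam α φ u (Iic 0) ∧ SigmaContOn d u (Iic 0) ∧
    ScattersAtMinus d u}

/-- Rapid decay at `+∞` (at the critical power `α = α(d)`): finite weak-`L^a` norm in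
time of `‖u(t)‖_{L^{α+2}}` on `(0,∞)`, where `a = 2α(α+2)/(4-α(d-2))`. -/
def RapidDecayPlus (d : ℕ) (α : ℝ) (u : ℝ → Rd d → ℂ) : Prop :=
  weakLNorm (2*α*(α+2)/(4 - α*((d:ℝ)-2))) (Ioi 0) (fun t => LpN d (α+2) (u t)) < ⊤

/-- Rapid decay at `-∞`. -/
def RapidDecayMinus (d : ℕ) (α : ℝ) (u : ℝ → Rd d → ℂ) : Prop :=
  weakLNorm (2*α*(α+2)/(4 - α*((d:ℝ)-2))) (Iio 0) (fun t => LpN d (α+2) (u t)) < ⊤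

end

noncomputable section
open MeasureTheory Real Filter Topology Set
open scoped ENNReal NNReal

/-- The fractional integration kernel `|t|^{-a}`. -/
def fker (a t : ℝ) : ℝ≥0∞ := ENNReal.ofReal |t| ^ (-a)

/-- The bilinear form `∬ h(t) |t-s|^{-a} g(s) ds dt`. -/
def Bform (a : ℝ) (h g : ℝ → ℝ≥0∞) : ℝ≥0∞ := ∫⁻ t, ∫⁻ s, h t * (fker a (t - s) * g s)

lemma measurable_fker (a : ℝ) : Measurable (fker a) := by
  unfold fker
  exact (ENNReal.measurable_ofReal.comp measurable_norm).pow_const _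

lemma lint_rpow_zero {b x : ℝ} (hb : -1 < b) (hx : 0 ≤ x) :
    ∫⁻ c in Ioc 0 x, ENNReal.ofReal c ^ b = ENNReal.ofReal (x ^ (b + 1) / (b + 1)) := by
  have h1 := integral_rpow (a := 0) (b := x) (r := b) (Or.inl hb)
  rw [Real.zero_rpow (by linarith), sub_zero] at h1
  rw [← h1, intervalIntegral.integral_of_le hx, ofReal_integral_eq_lintegral_ofReal]
  · refine setLIntegral_congr_fun measurableSet_Ioc fun c hc => ?_
    exact ENNReal.ofReal_rpow_of_pos hc.1
  · exact ((intervalIntegrable_iff_integrableOn_Ioc_of_le hx).1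
      (intervalIntegral.intervalIntegrable_rpow' hb))
  · filter_upwards [ae_restrict_mem measurableSet_Ioc] with c hc
    exact Real.rpow_nonneg hc.1.le _

lemma lint_rpow_top {b x : ℝ} (hb : b < -1) (hx : 0 < x) :
    ∫⁻ c in Ioi x, ENNReal.ofReal c ^ b = ENNReal.ofReal (x ^ (b + 1) / (-(b + 1))) := by
  have h1 := integral_Ioi_rpow_of_lt hb hx
  have h2 : x ^ (b + 1) / (-(b + 1)) = -x ^ (b+1) / (b+1) := by
    rw [div_neg, neg_div]
  rw [h2, ← h1, ofReal_integral_eq_lintegral_ofReal]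
  · refine setLIntegral_congr_fun measurableSet_Ioi fun c hc => ?_
    exact ENNReal.ofReal_rpow_of_pos (hx.trans hc)
  · exact integrableOn_Ioi_rpow_of_lt hb hx
  · filter_upwards [ae_restrict_mem measurableSet_Ioi] with c hc
    exact Real.rpow_nonneg (hx.trans hc).le _

lemma lint_fker_ball {a x : ℝ} (ha1 : a < 1) (hx : 0 ≤ x) :
    ∫⁻ u in Icc (-x) x, fker a u ≤ ENNReal.ofReal (2 * (x ^ (1 - a) / (1 - a))) := by
  have hsub : Icc (-x) x ⊆ Icc (-x) 0 ∪ Icc 0 x := by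
    intro u hu
    rcases le_total u 0 with h | h
    · exact Or.inl ⟨hu.1, h⟩
    · exact Or.inr ⟨h, hu.2⟩
  have e1 : ∫⁻ u in Icc 0 x, fker a u = ENNReal.ofReal (x ^ (1 - a) / (1 - a)) := by
    rw [← setLIntegral_congr (Ioc_ae_eq_Icc)]
    have := lint_rpow_zero (b := -a) (x := x) (by linarith) hx
    rw [show -a + 1 = 1 - a by ring] at this
    rw [← this]
    refine setLIntegral_congr_fun measurableSet_Ioc fun c hc => ?_
    simp only [fker, abs_of_pos hc.1]
  have e2 : ∫⁻ u in Icc (-x) 0, fker a u = ∫⁻ u in Icc 0 x, fker a u := by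
    rw [← lintegral_indicator measurableSet_Icc, ← lintegral_indicator measurableSet_Icc,
      ← lintegral_neg_eq_self]
    congr 1; ext u
    simp only [indicator, mem_Icc, fker, abs_neg]
    congr 1
    apply propext
    constructor <;> rintro ⟨h1, h2⟩ <;> constructor <;> linarith
  have h1a : 0 < 1 - a := by linarith
  calc _ ≤ ∫⁻ u in Icc (-x) 0 ∪ Icc 0 x, fker a u := lintegral_mono_set hsub
    _ ≤ _ := lintegral_union_le _ _ _
    _ = _ := by
      rw [e2, e1, ← ENNReal.ofReal_add (by positivity) (by positivity)]
      congr 1; ring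

/-- The constant in the kernel bound. -/
def Cker (a : ℝ) : ℝ≥0∞ := ENNReal.ofReal (2 / (1 - a)) + 1

lemma Cker_ne_top (a : ℝ) : Cker a ≠ ⊤ := by simp [Cker]

lemma lint_fker_set {a : ℝ} (ha0 : 0 < a) (ha1 : a < 1) (t : ℝ) {A : Set ℝ}
    (hA : MeasurableSet A) :
    ∫⁻ s in A, fker a (t - s) ≤ Cker a * volume A ^ (1 - a) := by
  have h1a : 0 < 1 - a := by linarith
  by_cases h0 : volume A = 0
  · rw [setLIntegral_measure_zero _ _ h0]; exact zero_le
  by_cases hT : volume A = ⊤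
  · rw [hT, ENNReal.top_rpow_of_pos h1a, ENNReal.mul_top]
    · exact le_top
    · simp [Cker]
  set x := (volume A).toReal with hx
  have hx0 : 0 < x := ENNReal.toReal_pos h0 hT
  have hvx : volume A = ENNReal.ofReal x := (ENNReal.ofReal_toReal hT).symm
  have hpt : ∀ s, A.indicator (fun s => fker a (t - s)) s ≤
      (Icc (-x) x).indicator (fker a) (t - s) +
        A.indicator (fun _ => ENNReal.ofReal x ^ (-a)) s := by
    intro s
    by_cases hs : s ∈ A
    · simp only [indicator_of_mem hs]
      by_cases hts : t - s ∈ Icc (-x) x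
      · rw [indicator_of_mem hts]; exact le_self_add
      · rw [indicator_of_notMem hts, zero_add, fker, ENNReal.rpow_neg, ENNReal.rpow_neg]
        have : x ≤ |t - s| := by
          by_contra hc
          push Not at hc
          exact hts ⟨(abs_lt.1 hc).1.le, (abs_lt.1 hc).2.le⟩
        gcongr
    · simp [indicator_of_notMem hs]
  rw [← lintegral_indicator hA]
  calc _ ≤ ∫⁻ s, ((Icc (-x) x).indicator (fker a) (t - s) +
        A.indicator (fun _ => ENNReal.ofReal x ^ (-a)) s) := lintegral_mono hpt
    _ = (∫⁻ s in Icc (-x) x, fker a s) + ENNReal.ofReal x ^ (-a) * volume A := by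
      rw [lintegral_add_right _ (measurable_const.indicator hA),
        lintegral_sub_left_eq_self (fun s => (Icc (-x) x).indicator (fker a) s) t,
        lintegral_indicator measurableSet_Icc, lintegral_indicator hA, setLIntegral_const]
    _ ≤ ENNReal.ofReal (2 * (x ^ (1 - a) / (1 - a))) + ENNReal.ofReal (x ^ (1 - a)) := by
      refine add_le_add (lint_fker_ball ha1 hx0.le) (le_of_eq ?_)
      rw [hvx, ENNReal.ofReal_rpow_of_pos hx0, ← ENNReal.ofReal_mul (by positivity)]
      congr 1
      rw [← Real.rpow_add_one hx0.ne']
      congr 1; ring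
    _ = _ := by
      rw [hvx, ENNReal.ofReal_rpow_of_pos hx0, Cker, add_mul, one_mul,
        ← ENNReal.ofReal_mul (by positivity)]
      congr 2; ring

/-- Layered bound for the bilinear form. -/
lemma Bform_level {a : ℝ} (ha0 : 0 < a) (ha1 : a < 1) {S : Set (ℝ × ℝ)} (hS : MeasurableSet S)
    {w : ℝ → ℝ≥0∞} (hw : Measurable w) (h : ℝ → ℝ≥0∞)
    (hh : ∀ t, h t = ∫⁻ c in Ioi 0, S.indicator (fun p => w p.1) (c, t)) :
    Bform a h h ≤ 2 * Cker a * ∫⁻ c' in Ioi 0, ∫⁻ c in Ioc 0 c',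
      (w c' * volume (Prod.mk c' ⁻¹' S)) * (w c * volume (Prod.mk c ⁻¹' S) ^ (1 - a)) := by
  set P : ℝ → ℝ≥0∞ := fun c => volume (Prod.mk c ⁻¹' S) with hP
  have hPm : Measurable P := measurable_measure_prodMk_left hS
  have hf : Measurable (fun p : ℝ × ℝ => S.indicator (fun p => w p.1) p) :=
    (hw.comp measurable_fst).indicator hS
  set f : ℝ → ℝ → ℝ≥0∞ := fun c t => S.indicator (fun p => w p.1) (c, t) with hfdef
  have hkm := measurable_fker a
  have hsl : ∀ c, MeasurableSet (Prod.mk c ⁻¹' S) := fun c => measurable_prodMk_left hS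
  have hfind : ∀ c t, f c t = (Prod.mk c ⁻¹' S).indicator (fun _ => w c) t := fun c t => rfl
  -- key two-level estimate
  have hk : ∀ c c', ∫⁻ t, ∫⁻ s, f c t * (fker a (t - s) * f c' s) ≤
      Cker a * ((w c * P c) * (w c' * P c' ^ (1 - a))) := by
    intro c c'
    have h1 : ∀ t, ∫⁻ s, f c t * (fker a (t - s) * f c' s) ≤
        f c t * (w c' * (Cker a * P c' ^ (1 - a))) := by
      intro t
      rw [lintegral_const_mul]
      · gcongr
        have : ∀ s, fker a (t - s) * f c' s =
          w c' * (Prod.mk c' ⁻¹' S).indicator (fun s => fker a (t - s)) s := by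
          intro s
          rw [hfind]
          by_cases hs : s ∈ Prod.mk c' ⁻¹' S
          · rw [indicator_of_mem hs, indicator_of_mem hs, mul_comm]
          · rw [indicator_of_notMem hs, indicator_of_notMem hs]; simp
        simp_rw [this]
        have hm : Measurable fun s => fker a (t - s) := hkm.comp (measurable_const.sub measurable_id)
        rw [lintegral_const_mul _ (hm.indicator (hsl c')), lintegral_indicator (hsl c')]
        gcongr
        exact lint_fker_set ha0 ha1 t (hsl c')
      · exact (hkm.comp (measurable_const.sub measurable_id)).mul
          (hf.comp (measurable_const.prodMk measurable_id))
    calc _ ≤ ∫⁻ t, f c t * (w c' * (Cker a * P c' ^ (1 - a))) := lintegral_mono h1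
      _ = (∫⁻ t, f c t) * (w c' * (Cker a * P c' ^ (1 - a))) :=
          lintegral_mul_const _ (hf.comp (measurable_const.prodMk measurable_id))
      _ = (w c * P c) * (w c' * (Cker a * P c' ^ (1 - a))) := by
          simp_rw [hfind]
          rw [lintegral_indicator (hsl c), setLIntegral_const]
      _ = _ := by ring
  have hsymm : ∀ c c', ∫⁻ t, ∫⁻ s, f c t * (fker a (t - s) * f c' s) =
      ∫⁻ t, ∫⁻ s, f c' t * (fker a (t - s) * f c s) := by
    intro c c'
    rw [lintegral_lintegral_swap]
    · refine lintegral_congr fun t => lintegral_congr fun s => ?_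
      have : fker a (s - t) = fker a (t - s) := by simp [fker, abs_sub_comm]
      rw [this]; ring
    · apply Measurable.aemeasurable
      exact (hf.comp (measurable_const.prodMk measurable_fst)).mul
        ((hkm.comp (measurable_fst.sub measurable_snd)).mul
          (hf.comp (measurable_const.prodMk measurable_snd)))
  -- expansion
  have hexp : Bform a h h = ∫⁻ c in Ioi 0, ∫⁻ c' in Ioi 0,
      ∫⁻ t, ∫⁻ s, f c t * (fker a (t - s) * f c' s) := by
    have e1 : ∀ t, ∫⁻ s, h t * (fker a (t - s) * h s) =
        ∫⁻ c in Ioi 0, ∫⁻ c' in Ioi 0, ∫⁻ s, f c t * (fker a (t - s) * f c' s) := by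
      intro t
      have e2 : ∀ s, h t * (fker a (t - s) * h s) = ∫⁻ c in Ioi 0, ∫⁻ c' in Ioi 0,
          f c t * (fker a (t - s) * f c' s) := by
        intro s
        have hm : ∀ t, Measurable fun c => S.indicator (fun p => w p.1) (c, t) := fun t =>
          hf.comp (measurable_id.prodMk measurable_const)
        rw [hh t, hh s, ← lintegral_mul_const _ (hm t)]
        refine lintegral_congr fun c => ?_
        rw [← lintegral_const_mul _ (hm s), ← lintegral_const_mul]
        exact (measurable_const).mul (hm s)
      simp_rw [e2]
      rw [lintegral_lintegral_swap]
      · refine lintegral_congr fun c => ?_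
        rw [lintegral_lintegral_swap]
        apply Measurable.aemeasurable
        exact (hf.comp (measurable_const.prodMk measurable_const)).mul
          ((hkm.comp (measurable_const.sub measurable_fst)).mul
          (hf.comp (measurable_snd.prodMk measurable_fst)))
      · apply Measurable.aemeasurable
        apply Measurable.lintegral_prod_right' (f := fun p : (ℝ × ℝ) × ℝ =>
          f p.1.2 t * (fker a (t - p.1.1) * f p.2 p.1.1))
        exact (hf.comp ((measurable_snd.comp measurable_fst).prodMk measurable_const)).mul
          ((hkm.comp (measurable_const.sub (measurable_fst.comp measurable_fst))).mul
          (hf.comp (measurable_snd.prodMk (measurable_fst.comp measurable_fst))))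
    unfold Bform
    simp_rw [e1]
    rw [lintegral_lintegral_swap]
    · refine lintegral_congr fun c => ?_
      rw [lintegral_lintegral_swap]
      apply Measurable.aemeasurable
      apply Measurable.lintegral_prod_right' (f := fun p : (ℝ × ℝ) × ℝ =>
          f c p.1.1 * (fker a (p.1.1 - p.2) * f p.1.2 p.2))
      exact (hf.comp (measurable_const.prodMk (measurable_fst.comp measurable_fst))).mul
          ((hkm.comp ((measurable_fst.comp measurable_fst).sub measurable_snd)).mul
          (hf.comp ((measurable_snd.comp measurable_fst).prodMk measurable_snd)))
    · apply Measurable.aemeasurable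
      apply Measurable.lintegral_prod_right' (f := fun p : (ℝ × ℝ) × ℝ =>
          ∫⁻ s, f p.1.2 p.1.1 * (fker a (p.1.1 - s) * f p.2 s))
      apply Measurable.lintegral_prod_right' (f := fun p : ((ℝ × ℝ) × ℝ) × ℝ =>
          f p.1.1.2 p.1.1.1 * (fker a (p.1.1.1 - p.2) * f p.1.2 p.2))
      exact (hf.comp ((measurable_snd.comp (measurable_fst.comp measurable_fst)).prodMk
          (measurable_fst.comp (measurable_fst.comp measurable_fst)))).mul
          ((hkm.comp ((measurable_fst.comp (measurable_fst.comp measurable_fst)).sub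
            measurable_snd)).mul
          (hf.comp ((measurable_snd.comp measurable_fst).prodMk measurable_snd)))
  set D : ℝ → ℝ → ℝ≥0∞ := fun c' c => (w c' * P c') * (w c * P c ^ (1 - a)) with hD
  have hDm : Measurable (Function.uncurry D) := by
    simp only [hD, Function.uncurry_def]
    exact ((hw.comp measurable_fst).mul (hPm.comp measurable_fst)).mul
      ((hw.comp measurable_snd).mul ((hPm.comp measurable_snd).pow_const _))
  set T : Set (ℝ × ℝ) := {p | p.2 ≤ p.1} with hT
  have hTm : MeasurableSet T := measurableSet_le measurable_snd measurable_fst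
  have hGm : Measurable (fun p : ℝ × ℝ => T.indicator (Function.uncurry D) p) := hDm.indicator hTm
  have hbd : ∀ c c', ∫⁻ t, ∫⁻ s, f c t * (fker a (t - s) * f c' s) ≤
      Cker a * T.indicator (Function.uncurry D) (c, c') +
        Cker a * T.indicator (Function.uncurry D) (c', c) := by
    intro c c'
    rcases le_total c' c with hle | hle
    · rw [indicator_of_mem (show (c, c') ∈ T from hle)]
      exact (hk c c').trans le_self_add
    · rw [indicator_of_mem (show (c', c) ∈ T from hle), hsymm]
      exact (hk c' c).trans le_add_self
  have hin : ∀ c' : ℝ, ∫⁻ c in Ioi 0, T.indicator (Function.uncurry D) (c', c) =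
      ∫⁻ c in Ioc 0 c', D c' c := by
    intro c'
    rw [← lintegral_indicator measurableSet_Ioi, ← lintegral_indicator measurableSet_Ioc]
    refine lintegral_congr fun c => ?_
    by_cases h1 : 0 < c
    · by_cases h2 : c ≤ c'
      · rw [indicator_of_mem (show c ∈ Ioi 0 from h1), indicator_of_mem (show (c', c) ∈ T from h2),
          indicator_of_mem (show c ∈ Ioc 0 c' from ⟨h1, h2⟩)]; rfl
      · rw [indicator_of_mem (show c ∈ Ioi 0 from h1),
          indicator_of_notMem (show (c', c) ∉ T from h2),
          indicator_of_notMem (show c ∉ Ioc 0 c' from fun h => h2 h.2)]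
    · rw [indicator_of_notMem (show c ∉ Ioi 0 from h1),
          indicator_of_notMem (show c ∉ Ioc 0 c' from fun h => h1 h.1)]
  calc Bform a h h = _ := hexp
    _ ≤ ∫⁻ c in Ioi 0, ∫⁻ c' in Ioi 0, (Cker a * T.indicator (Function.uncurry D) (c, c') +
        Cker a * T.indicator (Function.uncurry D) (c', c)) :=
        lintegral_mono fun c => lintegral_mono fun c' => hbd c c'
    _ = (∫⁻ c in Ioi 0, ∫⁻ c' in Ioi 0, Cker a * T.indicator (Function.uncurry D) (c, c')) +
        ∫⁻ c in Ioi 0, ∫⁻ c' in Ioi 0, Cker a * T.indicator (Function.uncurry D) (c', c) := by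
        rw [← lintegral_add_left]
        · refine lintegral_congr fun c => ?_
          rw [lintegral_add_left]
          exact measurable_const.mul (hGm.comp (measurable_const.prodMk measurable_id))
        · exact Measurable.lintegral_prod_right' (measurable_const.mul hGm)
    _ = (∫⁻ c in Ioi 0, ∫⁻ c' in Ioi 0, Cker a * T.indicator (Function.uncurry D) (c, c')) +
        ∫⁻ c in Ioi 0, ∫⁻ c' in Ioi 0, Cker a * T.indicator (Function.uncurry D) (c, c') := by
        congr 1
        rw [lintegral_lintegral_swap]
        exact (measurable_const.mul (hGm.comp
          (measurable_snd.prodMk measurable_fst))).aemeasurable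
    _ = _ := by
        rw [← two_mul, mul_assoc]
        congr 1
        have e3 : ∫⁻ c' in Ioi 0, ∫⁻ c in Ioc 0 c', D c' c =
            ∫⁻ c' in Ioi 0, ∫⁻ c in Ioi 0, T.indicator (Function.uncurry D) (c', c) :=
          lintegral_congr fun c' => (hin c').symm
        refine Eq.trans ?_ (congrArg _ e3.symm)
        rw [← lintegral_const_mul]
        · refine lintegral_congr fun c' => ?_
          rw [lintegral_const_mul]
          exact hGm.comp (measurable_const.prodMk measurable_id)
        · exact Measurable.lintegral_prod_right' hGm
end

noncomputable section
open MeasureTheory Real Filter Topology Set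
open scoped ENNReal NNReal

lemma lorentz2Norm_eq (q : ℝ) (I : Set ℝ) (g : ℝ → ℝ≥0∞) :
    lorentz2Norm q I g = ENNReal.ofReal q ^ ((1:ℝ)/2) *
      (∫⁻ c in Ioi (0:ℝ), ENNReal.ofReal c * volume {t ∈ I | ENNReal.ofReal c ≤ g t} ^ (2/q))
        ^ ((1:ℝ)/2) := by
  unfold lorentz2Norm
  congr 2
  refine setLIntegral_congr_fun measurableSet_Ioi fun c hc => ?_
  have hc' : ENNReal.ofReal c ≠ 0 := by simpa using hc
  rw [ENNReal.mul_rpow_of_nonneg _ _ (by norm_num), ← ENNReal.rpow_mul,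
    show (1/q*2 : ℝ) = 2/q by ring, ENNReal.rpow_two, sq, mul_assoc, mul_div_assoc,
    ENNReal.div_eq_inv_mul]
  rw [← mul_assoc (_⁻¹), ENNReal.inv_mul_cancel hc' ENNReal.ofReal_ne_top, one_mul]

lemma swap_tri {U : ℝ → ℝ → ℝ≥0∞} (hU : Measurable (Function.uncurry U)) :
    ∫⁻ c' in Ioi 0, ∫⁻ c in Ioc 0 c', U c c' = ∫⁻ c in Ioi 0, ∫⁻ c' in Ici c, U c c' := by
  have h1 : ∀ c' : ℝ, (Ioi 0).indicator (fun c' => ∫⁻ c in Ioc 0 c', U c c') c' =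
      ∫⁻ c, {p : ℝ × ℝ | 0 < p.1 ∧ p.1 ≤ p.2}.indicator (Function.uncurry U) (c, c') := by
    intro c'
    by_cases h : 0 < c'
    · rw [indicator_of_mem (show c' ∈ Ioi 0 from h), ← lintegral_indicator measurableSet_Ioc]
      rfl
    · rw [indicator_of_notMem (show c' ∉ Ioi 0 from h)]
      symm
      rw [lintegral_eq_zero_iff']
      · refine Eventually.of_forall fun c => ?_
        refine indicator_of_notMem (s := {p : ℝ × ℝ | 0 < p.1 ∧ p.1 ≤ p.2}) ?_ _
        rintro ⟨h1, h2⟩; exact h (h1.trans_le h2)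
      · apply Measurable.aemeasurable
        exact (hU.indicator ((measurableSet_lt measurable_const measurable_fst).inter
          (measurableSet_le measurable_fst measurable_snd))).comp
            (measurable_id.prodMk measurable_const)
  have h2 : ∀ c : ℝ, (Ioi 0).indicator (fun c => ∫⁻ c' in Ici c, U c c') c =
      ∫⁻ c', {p : ℝ × ℝ | 0 < p.1 ∧ p.1 ≤ p.2}.indicator (Function.uncurry U) (c, c') := by
    intro c
    by_cases h : 0 < c
    · rw [indicator_of_mem (show c ∈ Ioi 0 from h), ← lintegral_indicator measurableSet_Ici]
      refine lintegral_congr fun c' => ?_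
      by_cases h3 : c ≤ c'
      · rw [indicator_of_mem (show c' ∈ Ici c from h3), indicator_of_mem (s := {p : ℝ × ℝ | 0 < p.1 ∧ p.1 ≤ p.2}) ⟨h, h3⟩]; rfl
      · rw [indicator_of_notMem (show c' ∉ Ici c from h3), indicator_of_notMem]
        exact fun h4 => h3 h4.2
    · rw [indicator_of_notMem (show c ∉ Ioi 0 from h)]
      symm
      rw [lintegral_eq_zero_iff']
      · refine Eventually.of_forall fun c' => ?_
        refine indicator_of_notMem (s := {p : ℝ × ℝ | 0 < p.1 ∧ p.1 ≤ p.2}) ?_ _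
        rintro ⟨h1, h2⟩; exact h h1
      · apply Measurable.aemeasurable
        exact (hU.indicator ((measurableSet_lt measurable_const measurable_fst).inter
          (measurableSet_le measurable_fst measurable_snd))).comp
            (measurable_const.prodMk measurable_id)
  rw [← lintegral_indicator measurableSet_Ioi, ← lintegral_indicator measurableSet_Ioi]
  simp_rw [h1, h2]
  rw [lintegral_lintegral_swap]
  apply Measurable.aemeasurable
  exact (hU.indicator ((measurableSet_lt measurable_const measurable_fst).inter
          (measurableSet_le measurable_fst measurable_snd))).comp
            (measurable_snd.prodMk measurable_fst)

/-- constant -/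
def CG (a : ℝ) : ℝ≥0∞ := 2 * Cker a * (ENNReal.ofReal (1 / (1 - (2 - a) / 2)) +
  ENNReal.ofReal (1 / ((2 - a) / (1 - a) / 2 - 1)))

lemma CG_ne_top (a : ℝ) : CG a ≠ ⊤ := by
  unfold CG
  refine ENNReal.mul_ne_top (ENNReal.mul_ne_top (by simp) (Cker_ne_top a)) (by simp)

set_option maxHeartbeats 800000 in
lemma Bform_le {a : ℝ} (ha0 : 0 < a) (ha1 : a < 1) {g : ℝ → ℝ≥0∞} (hg : Measurable g)
    {m : ℝ → ℝ≥0∞} (hm : ∀ c, 0 < c → volume {t | ENNReal.ofReal c < g t} ≤ m c) :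
    Bform a g g ≤ CG a * ∫⁻ c in Ioi (0:ℝ), ENNReal.ofReal c * m c ^ (2 - a) := by
  set S : Set (ℝ × ℝ) := {p | ENNReal.ofReal p.1 < g p.2} with hSdef
  have hS : MeasurableSet S := measurableSet_lt (ENNReal.measurable_ofReal.comp measurable_fst)
    (hg.comp measurable_snd)
  have hgt : ∀ t, g t = ∫⁻ c in Ioi 0, S.indicator (fun _ => (1 : ℝ≥0∞)) (c, t) := by
    intro t
    have : ∀ c, S.indicator (fun _ => (1 : ℝ≥0∞)) (c, t) =
        {c | ENNReal.ofReal c < g t}.indicator (fun _ => (1 : ℝ≥0∞)) c := fun c => rfl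
    simp_rw [this]
    have hms : MeasurableSet {c | ENNReal.ofReal c < g t} :=
      measurableSet_lt ENNReal.measurable_ofReal measurable_const
    rw [lintegral_indicator hms, setLIntegral_one, Measure.restrict_apply hms]
    by_cases h : g t = ⊤
    · rw [h]; simp
    · have : {c | ENNReal.ofReal c < g t} ∩ Ioi 0 = Ioo 0 (g t).toReal := by
        ext c
        constructor
        · rintro ⟨h1, h2⟩
          exact ⟨h2, (ENNReal.ofReal_lt_iff_lt_toReal (le_of_lt h2) h).1 h1⟩
        · rintro ⟨h1, h2⟩
          exact ⟨(ENNReal.ofReal_lt_iff_lt_toReal h1.le h).2 h2, h1⟩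
      rw [this, Real.volume_Ioo, sub_zero, ENNReal.ofReal_toReal h]
  refine (Bform_level ha0 ha1 hS measurable_const g hgt).trans ?_
  set P : ℝ → ℝ≥0∞ := fun c => volume (Prod.mk c ⁻¹' S) with hP
  have hPm : Measurable P := measurable_measure_prodMk_left hS
  have hPle : ∀ c, 0 < c → P c ≤ m c := hm
  rw [CG, mul_assoc (2 * Cker a)]
  refine mul_le_mul_right ?_ _
  set p := 2 - a with hp
  set p' := p / (1 - a) with hp'
  have h1a : 0 < 1 - a := by linarith
  have hp'1 : 1 < p' / 2 := by rw [hp', hp, div_div, lt_div_iff₀ (by positivity)]; linarith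
  have hpp : p.HolderConjugate p' := by
    rw [Real.holderConjugate_iff]
    refine ⟨by linarith, ?_⟩
    rw [hp', inv_div, ← one_div, ← add_div, hp, div_eq_one_iff_eq (by linarith)]; ring
  set o := ENNReal.ofReal with ho
  have hom : Measurable o := ENNReal.measurable_ofReal
  have young : ∀ c' c, 0 < c → 0 < c' → (1 * P c') * (1 * P c ^ (1 - a)) ≤
      P c' ^ p * o c' ^ (p/2) * o c ^ (-p/2) + P c ^ p * o c ^ (p'/2) * o c' ^ (-p'/2) := by
    intro c' c hc hc'
    have hcn : o c ≠ 0 := by simpa [ho] using hc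
    have hcn' : o c' ≠ 0 := by simpa [ho] using hc'
    have hct : o c ≠ ⊤ := ENNReal.ofReal_ne_top
    have hct' : o c' ≠ ⊤ := ENNReal.ofReal_ne_top
    have e : (1 * P c') * (1 * P c ^ (1 - a)) =
        (P c' * (o c' ^ (1/2:ℝ) * o c ^ (-1/2:ℝ))) *
          (P c ^ (1-a) * (o c ^ (1/2:ℝ) * o c' ^ (-1/2:ℝ))) := by
      have h1 : o c ^ (1/2:ℝ) * o c ^ (-1/2:ℝ) = 1 := by
        rw [← ENNReal.rpow_add _ _ hcn hct]; norm_num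
      have h2 : o c' ^ (1/2:ℝ) * o c' ^ (-1/2:ℝ) = 1 := by
        rw [← ENNReal.rpow_add _ _ hcn' hct']; norm_num
      calc _ = P c' * P c ^ (1 - a) * (o c ^ (1/2:ℝ) * o c ^ (-1/2:ℝ)) *
          (o c' ^ (1/2:ℝ) * o c' ^ (-1/2:ℝ)) := by rw [h1, h2]; ring
        _ = _ := by ring
    rw [e]
    refine (ENNReal.young_inequality _ _ hpp).trans (add_le_add ?_ ?_)
    · refine (ENNReal.div_le_div_left (a := 1) ?_ _).trans ?_
      · rw [← ENNReal.ofReal_one]; exact ENNReal.ofReal_le_ofReal hpp.lt.le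
      · rw [div_one, ENNReal.mul_rpow_of_nonneg _ _ hpp.nonneg,
          ENNReal.mul_rpow_of_nonneg _ _ hpp.nonneg, ← ENNReal.rpow_mul, ← ENNReal.rpow_mul,
          mul_assoc]
        apply le_of_eq; congr 3 <;> ring
    · refine (ENNReal.div_le_div_left (a := 1) ?_ _).trans ?_
      · rw [← ENNReal.ofReal_one]; exact ENNReal.ofReal_le_ofReal hpp.symm.lt.le
      · rw [div_one, ENNReal.mul_rpow_of_nonneg _ _ hpp.symm.nonneg,
          ENNReal.mul_rpow_of_nonneg _ _ hpp.symm.nonneg, ← ENNReal.rpow_mul, ← ENNReal.rpow_mul,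
          ← ENNReal.rpow_mul, mul_assoc]
        have : (1 - a) * p' = p := by rw [hp']; field_simp
        rw [this]
        apply le_of_eq; congr 3 <;> ring
  have meas2 : Measurable (Function.uncurry fun c c' : ℝ =>
      P c ^ p * o c ^ (p'/2) * o c' ^ (-p'/2)) := by
    exact (((hPm.comp measurable_fst).pow_const _).mul ((hom.comp measurable_fst).pow_const _)).mul
      ((hom.comp measurable_snd).pow_const _)
  have hmonoP : ∀ c, 0 < c → P c ^ p ≤ m c ^ p := fun c hc =>
    ENNReal.rpow_le_rpow (hPle c hc) hpp.nonneg
  have I1 : ∫⁻ c' in Ioi (0:ℝ), ∫⁻ c in Ioc 0 c', P c' ^ p * o c' ^ (p/2) * o c ^ (-p/2) ≤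
      o (1 / (1 - p / 2)) * ∫⁻ c in Ioi (0:ℝ), o c * m c ^ p := by
    rw [← lintegral_const_mul' _ _ ENNReal.ofReal_ne_top]
    refine setLIntegral_mono' measurableSet_Ioi fun c' hc' => ?_
    have hc'' : 0 < c' := hc'
    rw [lintegral_const_mul _ (hom.pow_const _), lint_rpow_zero (by linarith) hc''.le]
    have e1 : o c' ^ (p/2) * ENNReal.ofReal (c' ^ (-p/2+1) / (-p/2+1)) = o (1/(1-p/2)) * o c' := by
      rw [ho, ENNReal.ofReal_rpow_of_pos hc'', ← ENNReal.ofReal_mul (by positivity),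
        ← ENNReal.ofReal_mul (by apply div_nonneg <;> linarith)]
      congr 1
      rw [mul_div_assoc', ← Real.rpow_add hc'']
      rw [show p/2 + (-p/2+1) = 1 by ring, Real.rpow_one]
      rw [show -p/2+1 = 1-p/2 by ring]; ring
    calc _ = o (1/(1-p/2)) * o c' * P c' ^ p := by rw [mul_assoc, e1]; ring
      _ ≤ _ := by rw [mul_assoc]; exact mul_le_mul_right (mul_le_mul_right (hmonoP c' hc'') _) _
  have I2 : ∫⁻ c' in Ioi (0:ℝ), ∫⁻ c in Ioc 0 c', P c ^ p * o c ^ (p'/2) * o c' ^ (-p'/2) ≤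
      o (1 / (p' / 2 - 1)) * ∫⁻ c in Ioi (0:ℝ), o c * m c ^ p := by
    rw [swap_tri meas2, ← lintegral_const_mul' _ _ ENNReal.ofReal_ne_top]
    refine setLIntegral_mono' measurableSet_Ioi fun c hc => ?_
    have hc'' : 0 < c := hc
    rw [lintegral_const_mul _ (hom.pow_const _), setLIntegral_congr Ioi_ae_eq_Ici.symm,
      lint_rpow_top (by linarith) hc'']
    have e1 : o c ^ (p'/2) * ENNReal.ofReal (c ^ (-p'/2+1) / (-(-p'/2+1))) =
        o (1/(p'/2-1)) * o c := by
      rw [ho, ENNReal.ofReal_rpow_of_pos hc'', ← ENNReal.ofReal_mul (by positivity),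
        ← ENNReal.ofReal_mul (by apply div_nonneg <;> linarith)]
      congr 1
      rw [mul_div_assoc', ← Real.rpow_add hc'']
      rw [show p'/2 + (-p'/2+1) = 1 by ring, Real.rpow_one]
      rw [show -(-p'/2+1) = p'/2-1 by ring]; ring
    calc _ = o (1/(p'/2-1)) * o c * P c ^ p := by rw [mul_assoc, e1]; ring
      _ ≤ _ := by rw [mul_assoc]; exact mul_le_mul_right (mul_le_mul_right (hmonoP c hc'') _) _
  rw [add_mul]
  refine le_trans ?_ (add_le_add I1 I2)
  rw [← lintegral_add_left]
  · refine setLIntegral_mono' measurableSet_Ioi fun c' hc' => ?_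
    rw [← lintegral_add_left]
    · exact setLIntegral_mono' measurableSet_Ioc fun c hc => young c' c hc.1 hc'
    · exact measurable_const.mul (hom.pow_const _)
  · have : Measurable fun c' => P c' ^ p * o c' ^ (p/2) := (hPm.pow_const _).mul (hom.pow_const _)
    have h2 : ∀ c', ∫⁻ c in Ioc 0 c', P c' ^ p * o c' ^ (p/2) * o c ^ (-p/2) =
      ∫⁻ c, {p : ℝ × ℝ | 0 < p.2 ∧ p.2 ≤ p.1}.indicator
        (fun q => P q.1 ^ p * o q.1 ^ (p/2) * o q.2 ^ (-p/2)) (c', c) := by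
      intro c'
      rw [← lintegral_indicator measurableSet_Ioc]; rfl
    simp_rw [h2]
    apply Measurable.lintegral_prod_right'
    refine Measurable.indicator ?_ ((measurableSet_lt measurable_const measurable_snd).inter
          (measurableSet_le measurable_snd measurable_fst))
    exact (this.comp measurable_fst).mul ((hom.comp measurable_snd).pow_const _)
end

noncomputable section
open MeasureTheory Real Filter Topology Set
open scoped ENNReal NNReal

lemma dual_lorentz_bdd {a : ℝ} (ha0 : 0 < a) (ha1 : a < 1) {N : ℝ → ℝ≥0∞} (hN : Measurable N)
    {M : ℝ → ℝ≥0∞} (hMN : ∀ t, N t ≤ M t) (b : ℝ) (hNb : ∀ t, N t ≤ ENNReal.ofReal b)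
    (hfin : ∀ c, 0 < c → volume {t | ENNReal.ofReal c ≤ N t} ≤ ENNReal.ofReal b)
    {K : ℝ≥0∞} (hK : ∀ h : ℝ → ℝ≥0∞, Measurable h →
      ∫⁻ t, h t * M t ≤ K * Bform a h h ^ ((1:ℝ)/2)) :
    ∫⁻ c in Ioi (0:ℝ), ENNReal.ofReal c * volume {t | ENNReal.ofReal c ≤ N t} ^ a ≤
      2 * Cker a * K ^ 2 := by
  set S : Set (ℝ × ℝ) := {p | ENNReal.ofReal p.1 ≤ N p.2} with hSdef
  have hS : MeasurableSet S := measurableSet_le (ENNReal.measurable_ofReal.comp measurable_fst)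
    (hN.comp measurable_snd)
  set P : ℝ → ℝ≥0∞ := fun c => volume (Prod.mk c ⁻¹' S) with hP
  have hPm : Measurable P := measurable_measure_prodMk_left hS
  have hPt : ∀ c, 0 < c → P c ≠ ⊤ := fun c hc => ((hfin c hc).trans_lt ENNReal.ofReal_lt_top).ne
  set X := ∫⁻ c in Ioi (0:ℝ), ENNReal.ofReal c * P c ^ a with hX
  change X ≤ _
  set w : ℝ → ℝ≥0∞ := fun c => if P c = 0 then 0 else P c ^ (-(1 - a)) with hw
  have hwm : Measurable w :=
    Measurable.ite (hPm (measurableSet_singleton 0)) measurable_const (hPm.pow_const _)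
  have hwP : ∀ c, 0 < c → w c * P c = P c ^ a := by
    intro c hc
    simp only [hw]
    split_ifs with h0
    · rw [h0, ENNReal.zero_rpow_of_pos ha0, mul_zero]
    · nth_rewrite 2 [← ENNReal.rpow_one (P c)]
      rw [← ENNReal.rpow_add _ _ h0 (hPt c hc)]; congr 1; ring
  have hwP1 : ∀ c, 0 < c → w c * P c ^ (1 - a) ≤ 1 := by
    intro c hc
    simp only [hw]
    split_ifs with h0
    · simp
    · rw [← ENNReal.rpow_add _ _ h0 (hPt c hc)]; simp
  set h : ℝ → ℝ≥0∞ := fun t => ∫⁻ c in Ioi 0, S.indicator (fun p => w p.1) (c, t) with hh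
  have hfm : Measurable (fun p : ℝ × ℝ => S.indicator (fun p => w p.1) p) :=
    (hwm.comp measurable_fst).indicator hS
  have hhm : Measurable h :=
    Measurable.lintegral_prod_right' (f := fun p : ℝ × ℝ => S.indicator (fun p => w p.1)
      (p.2, p.1)) (hfm.comp (measurable_snd.prodMk measurable_fst))
  have hB : Bform a h h ≤ 2 * Cker a * X := by
    refine (Bform_level ha0 ha1 hS hwm h fun t => rfl).trans ?_
    refine mul_le_mul_right ?_ _
    refine setLIntegral_mono' measurableSet_Ioi fun c' hc' => ?_
    have hc'' : 0 < c' := hc'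
    calc _ ≤ ∫⁻ c in Ioc 0 c', P c' ^ a := by
          refine setLIntegral_mono' measurableSet_Ioc fun c hc => ?_
          rw [← hwP c' hc'']
          exact mul_le_of_le_one_right' (hwP1 c hc.1)
      _ = _ := by rw [setLIntegral_const, Real.volume_Ioc, sub_zero, mul_comm]
  have hXl : X ≤ ∫⁻ t, h t * M t := by
    have e1 : ∫⁻ t, h t * N t =
        ∫⁻ c in Ioi 0, ∫⁻ t, S.indicator (fun p => w p.1) (c, t) * N t := by
      rw [lintegral_lintegral_swap]
      · refine lintegral_congr fun t => ?_
        rw [lintegral_mul_const]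
        exact hfm.comp (measurable_id.prodMk measurable_const)
      · exact ((hfm.comp (measurable_fst.prodMk measurable_snd)).mul
          (hN.comp measurable_snd)).aemeasurable
    calc X ≤ ∫⁻ c in Ioi 0, ∫⁻ t, S.indicator (fun p => w p.1) (c, t) * N t := by
          refine setLIntegral_mono' measurableSet_Ioi fun c hc => ?_
          have hc'' : 0 < c := hc
          have hsl : MeasurableSet (Prod.mk c ⁻¹' S) := measurable_prodMk_left hS
          calc _ = ∫⁻ t in Prod.mk c ⁻¹' S, ENNReal.ofReal c * w c := by
                rw [setLIntegral_const, ← hwP c hc'', mul_assoc]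
            _ = ∫⁻ t, (Prod.mk c ⁻¹' S).indicator (fun _ => ENNReal.ofReal c * w c) t := by
                rw [lintegral_indicator hsl]
            _ ≤ _ := by
                refine lintegral_mono fun t => ?_
                by_cases ht : t ∈ Prod.mk c ⁻¹' S
                · rw [indicator_of_mem ht, indicator_of_mem (show (c, t) ∈ S from ht), mul_comm]
                  exact mul_le_mul_right ht _
                · rw [indicator_of_notMem ht]; exact zero_le
      _ = ∫⁻ t, h t * N t := e1.symm
      _ ≤ _ := lintegral_mono fun t => mul_le_mul_right (hMN t) _
  have hXt : X ≠ ⊤ := by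
    apply ne_of_lt
    calc X ≤ ∫⁻ c in Ioi (0:ℝ), (Ioc 0 (max b 0)).indicator
          (fun _ => ENNReal.ofReal b * ENNReal.ofReal b ^ a) c := by
          refine setLIntegral_mono' measurableSet_Ioi fun c hc => ?_
          have hc'' : 0 < c := hc
          by_cases hcb : c ≤ b
          · rw [indicator_of_mem (show c ∈ Ioc 0 (max b 0) from ⟨hc'', hcb.trans (le_max_left _ _)⟩)]
            exact mul_le_mul' (ENNReal.ofReal_le_ofReal hcb)
              (ENNReal.rpow_le_rpow (hfin c hc'') ha0.le)
          · have : P c = 0 := by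
              have : Prod.mk c ⁻¹' S = ∅ := by
                ext t
                simp only [mem_preimage, hSdef, mem_setOf_eq, mem_empty_iff_false, iff_false, not_le]
                refine (hNb t).trans_lt ?_
                exact (ENNReal.ofReal_lt_ofReal_iff hc'').2 (not_le.1 hcb)
              simp [hP, this]
            rw [this, ENNReal.zero_rpow_of_pos ha0, mul_zero]; exact zero_le
      _ ≤ ∫⁻ c, (Ioc 0 (max b 0)).indicator
          (fun _ => ENNReal.ofReal b * ENNReal.ofReal b ^ a) c := setLIntegral_le_lintegral _ _
      _ < ⊤ := by
          rw [lintegral_indicator measurableSet_Ioc, setLIntegral_const, Real.volume_Ioc]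
          refine ENNReal.mul_lt_top (ENNReal.mul_lt_top ENNReal.ofReal_lt_top ?_)
            ENNReal.ofReal_lt_top
          exact ENNReal.rpow_lt_top_of_nonneg ha0.le ENNReal.ofReal_ne_top
  have hXK : X ≤ K * (2 * Cker a * X) ^ ((1:ℝ)/2) :=
    hXl.trans ((hK h hhm).trans (mul_le_mul_right (ENNReal.rpow_le_rpow hB (by norm_num)) _))
  by_cases hX0 : X = 0
  · rw [hX0]; exact zero_le
  have h2 : X * X ≤ X * (2 * Cker a * K ^ 2) := by
    calc X * X ≤ (K * (2 * Cker a * X) ^ ((1:ℝ)/2)) * (K * (2 * Cker a * X) ^ ((1:ℝ)/2)) :=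
          mul_le_mul' hXK hXK
      _ = K ^ 2 * ((2 * Cker a * X) ^ ((1:ℝ)/2) * (2 * Cker a * X) ^ ((1:ℝ)/2)) := by ring
      _ = K ^ 2 * (2 * Cker a * X) := by
          rw [← ENNReal.rpow_add_of_nonneg _ _ (by norm_num) (by norm_num)]
          norm_num
      _ = _ := by ring
  exact (ENNReal.mul_le_mul_iff_right hX0 hXt).1 h2

lemma dual_lorentz {a : ℝ} (ha0 : 0 < a) (ha1 : a < 1) {N : ℝ → ℝ≥0∞} (hN : Measurable N)
    {K : ℝ≥0∞} (hK : ∀ h : ℝ → ℝ≥0∞, Measurable h →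
      ∫⁻ t, h t * N t ≤ K * Bform a h h ^ ((1:ℝ)/2)) :
    ∫⁻ c in Ioi (0:ℝ), ENNReal.ofReal c * volume {t | ENNReal.ofReal c ≤ N t} ^ a ≤
      2 * Cker a * K ^ 2 := by
  set Nn : ℕ → ℝ → ℝ≥0∞ := fun n => (Icc (-(n:ℝ)) n).indicator (fun t => min (N t) n) with hNn
  have hNnm : ∀ n, Measurable (Nn n) := fun n =>
    (hN.min measurable_const).indicator measurableSet_Icc
  have hNle : ∀ n t, Nn n t ≤ N t := fun n t =>
    (indicator_le_self' (fun _ _ => zero_le) t).trans (min_le_left _ _)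
  have hNle' : ∀ n t, Nn n t ≤ n := fun n t =>
    (indicator_le_self' (fun _ _ => zero_le) t).trans (min_le_right _ _)
  have hmono : ∀ t, Monotone fun n => Nn n t := by
    intro t n m hnm
    have hnm' : (n:ℝ) ≤ m := by exact_mod_cast hnm
    by_cases ht : t ∈ Icc (-(n:ℝ)) n
    · have ht' : t ∈ Icc (-(m:ℝ)) m := ⟨by linarith [ht.1], by linarith [ht.2]⟩
      simp only [hNn, indicator_of_mem ht, indicator_of_mem ht']
      exact min_le_min_left _ (by exact_mod_cast hnm)
    · simp only [hNn, indicator_of_notMem ht]; exact zero_le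
  have key : ∀ n : ℕ, ∫⁻ c in Ioi (0:ℝ),
      ENNReal.ofReal c * volume {t | ENNReal.ofReal c ≤ Nn n t} ^ a ≤ 2 * Cker a * K ^ 2 := by
    intro n
    refine dual_lorentz_bdd ha0 ha1 (hNnm n) (hNle n) (2 * n) ?_ ?_ hK
    · intro t
      refine (hNle' n t).trans ?_
      rw [← ENNReal.ofReal_natCast]
      exact ENNReal.ofReal_le_ofReal (by linarith [n.cast_nonneg (α := ℝ)])
    · intro c hc
      calc _ ≤ volume (Icc (-(n:ℝ)) n) := by
            refine measure_mono fun t ht => ?_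
            by_contra h
            have ht' : ENNReal.ofReal c ≤ Nn n t := ht
            simp only [hNn, indicator_of_notMem h] at ht'
            have : 0 < ENNReal.ofReal c := by simpa using hc
            exact absurd ht' (not_le.2 this)
        _ = _ := by rw [Real.volume_Icc]; congr 1; ring
  have hsup : ∀ c ∈ Ioi (0:ℝ), ENNReal.ofReal c * volume {t | ENNReal.ofReal c ≤ N t} ^ a =
      ⨆ n : ℕ, ENNReal.ofReal c * volume {t | ENNReal.ofReal c ≤ Nn n t} ^ a := by
    intro c hc
    have hc' : 0 < c := hc
    have hU : {t | ENNReal.ofReal c ≤ N t} = ⋃ n : ℕ, {t | ENNReal.ofReal c ≤ Nn n t} := by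
      ext t
      simp only [mem_setOf_eq, mem_iUnion]
      constructor
      · intro h
        obtain ⟨n, hn⟩ := exists_nat_ge (max c |t|)
        refine ⟨n, ?_⟩
        have ht : t ∈ Icc (-(n:ℝ)) n := abs_le.1 ((le_max_right _ _).trans hn)
        simp only [hNn, indicator_of_mem ht]
        refine le_min h ?_
        rw [← ENNReal.ofReal_natCast]
        exact ENNReal.ofReal_le_ofReal ((le_max_left _ _).trans hn)
      · rintro ⟨n, hn⟩; exact hn.trans (hNle n t)
    have hmo : Monotone fun n : ℕ => {t | ENNReal.ofReal c ≤ Nn n t} := by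
      intro n m hnm t ht
      exact le_trans (show ENNReal.ofReal c ≤ Nn n t from ht) (hmono t hnm)
    rw [hU, hmo.measure_iUnion]
    rw [(ENNReal.monotone_rpow_of_nonneg ha0.le).map_iSup_of_continuousAt
      ENNReal.continuous_rpow_const.continuousAt (by simp [ha0]), ENNReal.mul_iSup]
  rw [setLIntegral_congr_fun measurableSet_Ioi hsup, lintegral_iSup]
  · exact iSup_le key
  · intro n
    refine ENNReal.measurable_ofReal.mul (Measurable.pow_const ?_ _)
    refine Antitone.measurable fun c c' hcc => measure_mono fun t ht => ?_
    exact (ENNReal.ofReal_le_ofReal hcc).trans ht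
  · intro n m hnm c
    refine mul_le_mul_right (ENNReal.rpow_le_rpow (measure_mono fun t ht => ?_) ha0.le) _
    exact le_trans (show ENNReal.ofReal c ≤ Nn n t from ht) (hmono t hnm)

lemma ker_rep_one {a δ : ℝ} (ha0 : 0 < a) (hδ : 0 < δ) :
    ∫⁻ ρ in Ioi (0:ℝ), ENNReal.ofReal ρ ^ (-a-2) * ENNReal.ofReal (ρ - δ) =
      ENNReal.ofReal (1 / (a * (a+1))) * ENNReal.ofReal δ ^ (-a) := by
  have h1 : IntegrableOn (fun ρ : ℝ => ρ ^ (-a-1) - δ * ρ ^ (-a-2)) (Ioi δ) :=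
    (integrableOn_Ioi_rpow_of_lt (by linarith) hδ).sub
      ((integrableOn_Ioi_rpow_of_lt (by linarith) hδ).const_mul δ)
  have h2 : ∫ ρ in Ioi δ, (ρ ^ (-a-1) - δ * ρ ^ (-a-2)) = 1 / (a * (a+1)) * δ ^ (-a) := by
    rw [integral_sub (integrableOn_Ioi_rpow_of_lt (by linarith) hδ)
      ((integrableOn_Ioi_rpow_of_lt (by linarith) hδ).const_mul δ), integral_const_mul,
      integral_Ioi_rpow_of_lt (by linarith) hδ, integral_Ioi_rpow_of_lt (by linarith) hδ]
    have e1 : δ ^ (-a) = δ * δ ^ (-a-2+1) := by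
      rw [mul_comm, ← Real.rpow_add_one hδ.ne']; congr 1; ring
    have e2 : -a - 1 + 1 = -a := by ring
    rw [e2, e1]
    have e3 : (-a - 2 + 1 : ℝ) = -(a+1) := by ring
    rw [e3]
    field_simp
    ring
  rw [ENNReal.ofReal_rpow_of_pos hδ, ← ENNReal.ofReal_mul (by positivity), ← h2,
    ofReal_integral_eq_lintegral_ofReal h1]
  · rw [← lintegral_indicator measurableSet_Ioi, ← lintegral_indicator measurableSet_Ioi]
    refine lintegral_congr fun ρ => ?_
    by_cases h : δ < ρ
    · have hρ : 0 < ρ := hδ.trans h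
      rw [indicator_of_mem (show ρ ∈ Ioi 0 from hρ), indicator_of_mem (show ρ ∈ Ioi δ from h),
        ENNReal.ofReal_rpow_of_pos hρ, ← ENNReal.ofReal_mul (by positivity)]
      congr 1
      rw [mul_sub, ← Real.rpow_add_one hρ.ne', mul_comm δ]
      congr 2; ring
    · rw [indicator_of_notMem (show ρ ∉ Ioi δ from h)]
      by_cases hρ : 0 < ρ
      · rw [indicator_of_mem (show ρ ∈ Ioi 0 from hρ),
          ENNReal.ofReal_eq_zero.2 (by linarith : ρ - δ ≤ 0), mul_zero]
      · rw [indicator_of_notMem (show ρ ∉ Ioi 0 from hρ)]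
  · filter_upwards [ae_restrict_mem measurableSet_Ioi] with ρ hρ
    have hρ' : δ < ρ := hρ
    have hρ0 : 0 < ρ := hδ.trans hρ'
    have : ρ ^ (-a-1) = ρ * ρ ^ (-a-2) := by
      rw [mul_comm, ← Real.rpow_add_one hρ0.ne']; congr 1; ring
    simp only [Pi.zero_apply]
    rw [this, ← sub_mul]
    have := Real.rpow_nonneg hρ0.le (-a-2)
    exact mul_nonneg (by linarith) this
end

noncomputable section
open MeasureTheory Real Filter Topology Set
open scoped ENNReal NNReal

/-- indicator weight of the window `(u,u+ρ)` -/
def win (ρ u t : ℝ) : ℝ≥0∞ := ({z : ℝ | u < z ∧ z < u + ρ} : Set ℝ).indicator 1 t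

lemma measurable_win : Measurable fun z : (ℝ × ℝ) × ℝ => win z.1.1 z.1.2 z.2 := by
  have : (fun z : (ℝ × ℝ) × ℝ => win z.1.1 z.1.2 z.2) =
      ({z : (ℝ × ℝ) × ℝ | z.1.2 < z.2 ∧ z.2 < z.1.2 + z.1.1}).indicator 1 := by
    ext z; simp [win, indicator]
  rw [this]
  refine measurable_one.indicator ?_
  have h1 : MeasurableSet {z : (ℝ × ℝ) × ℝ | z.1.2 < z.2} :=
    measurableSet_lt (by fun_prop) (by fun_prop)
  have h2 : MeasurableSet {z : (ℝ × ℝ) × ℝ | z.2 < z.1.2 + z.1.1} :=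
    measurableSet_lt (by fun_prop) (by fun_prop)
  exact h1.inter h2

lemma win_pair {ρ t s : ℝ} : ∫⁻ u, win ρ u t * win ρ u s = ENNReal.ofReal (ρ - |t - s|) := by
  have : (fun u => win ρ u t * win ρ u s) = (Ioo (max t s - ρ) (min t s)).indicator 1 := by
    ext u
    simp only [win, indicator, mem_ofPred_eq, mem_Ioo, Pi.one_apply, lt_min_iff, sub_lt_iff_lt_add,
      max_lt_iff]
    by_cases h1 : u < t ∧ t < u + ρ <;> by_cases h2 : u < s ∧ s < u + ρ <;> simp [h1, h2] <;> grind
  rw [this, lintegral_indicator measurableSet_Ioo]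
  simp only [Pi.one_apply, lintegral_one, Measure.restrict_apply_univ, Real.volume_Ioo]
  congr 1
  rw [← max_sub_min_eq_abs, max_comm s, min_comm s]
  ring

/-- the window measure -/
def winM : Measure (ℝ × ℝ) := (volume.restrict (Ioi (0:ℝ))).prod volume

lemma ker_rep {a t s : ℝ} (ha0 : 0 < a) (hts : t ≠ s) :
    fker a (t - s) = ENNReal.ofReal (a * (a+1)) *
      ∫⁻ p, ENNReal.ofReal p.1 ^ (-a-2) * (win p.1 p.2 t * win p.1 p.2 s) ∂winM := by
  have hw : ∀ t, Measurable fun p : ℝ × ℝ => win p.1 p.2 t := fun t =>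
    measurable_win.comp (f := fun p : ℝ × ℝ => (p, t)) (by fun_prop)
  have hm : Measurable fun p : ℝ × ℝ => ENNReal.ofReal p.1 ^ (-a-2) * (win p.1 p.2 t * win p.1 p.2 s) :=
    ((ENNReal.measurable_ofReal.comp measurable_fst).pow_const _).mul ((hw t).mul (hw s))
  rw [winM, lintegral_prod _ hm.aemeasurable]
  have : ∀ ρ : ℝ, ∫⁻ u, ENNReal.ofReal ρ ^ (-a-2) * (win ρ u t * win ρ u s) =
      ENNReal.ofReal ρ ^ (-a-2) * ENNReal.ofReal (ρ - |t - s|) := by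
    intro ρ
    have hm1 : Measurable fun u => win ρ u t * win ρ u s :=
      ((hw t).comp (measurable_prodMk_left (x := ρ))).mul ((hw s).comp (measurable_prodMk_left (x := ρ)))
    rw [lintegral_const_mul _ hm1, win_pair]
  simp only [this]
  rw [ker_rep_one ha0 (abs_pos.2 (sub_ne_zero.2 hts)), ← mul_assoc, ← ENNReal.ofReal_mul (by positivity),
    mul_one_div_cancel (by positivity), ENNReal.ofReal_one, one_mul, fker]

/-- windowed mass -/
def Jw (h : ℝ → ℝ≥0∞) (p : ℝ × ℝ) : ℝ≥0∞ := ∫⁻ t, win p.1 p.2 t * h t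

lemma measurable_Jw {h : ℝ → ℝ≥0∞} (hh : Measurable h) : Measurable (Jw h) :=
  Measurable.lintegral_prod_right' (f := fun z : (ℝ × ℝ) × ℝ => win z.1.1 z.1.2 z.2 * h z.2)
    (measurable_win.mul (hh.comp measurable_snd))

lemma Bform_rep {a : ℝ} (ha0 : 0 < a) {h g : ℝ → ℝ≥0∞} (hh : Measurable h) (hg : Measurable g) :
    Bform a h g = ENNReal.ofReal (a * (a+1)) *
      ∫⁻ p, ENNReal.ofReal p.1 ^ (-a-2) * (Jw h p * Jw g p) ∂winM := by
  have hw : ∀ t, Measurable fun p : ℝ × ℝ => win p.1 p.2 t := fun t =>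
    measurable_win.comp (f := fun p : ℝ × ℝ => (p, t)) (by fun_prop)
  have hw1 : ∀ p : ℝ × ℝ, Measurable fun t : ℝ => win p.1 p.2 t := fun p =>
    measurable_win.comp (f := fun t : ℝ => (p, t)) (by fun_prop)
  have hR : Measurable fun p : ℝ × ℝ => ENNReal.ofReal p.1 ^ (-a-2) :=
    (ENNReal.measurable_ofReal.comp measurable_fst).pow_const _
  have : SFinite winM := by unfold winM; infer_instance
  let Φ : (ℝ × ℝ) → (ℝ × ℝ) → ℝ≥0∞ := fun z p =>
    ENNReal.ofReal (a * (a+1)) * (h z.1 * g z.2) *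
      (ENNReal.ofReal p.1 ^ (-a-2) * (win p.1 p.2 z.1 * win p.1 p.2 z.2))
  have hΦ : Measurable (Function.uncurry Φ) := by
    have w1 : Measurable fun x : (ℝ × ℝ) × (ℝ × ℝ) => win x.2.1 x.2.2 x.1.1 :=
      measurable_win.comp (f := fun x : (ℝ × ℝ) × (ℝ × ℝ) => (x.2, x.1.1)) (by fun_prop)
    have w2 : Measurable fun x : (ℝ × ℝ) × (ℝ × ℝ) => win x.2.1 x.2.2 x.1.2 :=
      measurable_win.comp (f := fun x : (ℝ × ℝ) × (ℝ × ℝ) => (x.2, x.1.2)) (by fun_prop)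
    have h1 : Measurable fun x : (ℝ × ℝ) × (ℝ × ℝ) => h x.1.1 := hh.comp (by fun_prop)
    have h2 : Measurable fun x : (ℝ × ℝ) × (ℝ × ℝ) => g x.1.2 := hg.comp (by fun_prop)
    have h3 : Measurable fun x : (ℝ × ℝ) × (ℝ × ℝ) => ENNReal.ofReal x.2.1 ^ (-a-2) :=
      hR.comp measurable_snd
    exact ((h1.mul h2).const_mul _).mul (h3.mul (w1.mul w2))
  have hBm : Measurable fun z : ℝ × ℝ => h z.1 * (fker a (z.1 - z.2) * g z.2) :=
    (hh.comp measurable_fst).mul (((measurable_fker a).comp (by fun_prop)).mul (hg.comp measurable_snd))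
  have e1 : Bform a h g = ∫⁻ z : ℝ × ℝ, ∫⁻ p, Φ z p ∂winM := by
    rw [Bform, ← lintegral_prod (fun z : ℝ × ℝ => h z.1 * (fker a (z.1 - z.2) * g z.2)) hBm.aemeasurable]
    refine lintegral_congr_ae ?_
    have hd : ∀ᵐ z : ℝ × ℝ, z.1 ≠ z.2 := by
      have : MeasurableSet {z : ℝ × ℝ | z.1 = z.2} := measurableSet_eq_fun measurable_fst measurable_snd
      rw [ae_iff]
      simp only [ne_eq, not_not]
      rw [Measure.volume_eq_prod, Measure.measure_prod_null this]
      refine Eventually.of_forall fun t => ?_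
      have : Prod.mk t ⁻¹' {z : ℝ × ℝ | z.1 = z.2} = {t} := by ext; simp [eq_comm]
      simp [this]
    filter_upwards [hd] with z hz
    have hm : Measurable fun p : ℝ × ℝ => ENNReal.ofReal p.1 ^ (-a-2) * (win p.1 p.2 z.1 * win p.1 p.2 z.2) :=
      hR.mul ((hw _).mul (hw _))
    simp only [Φ]
    rw [lintegral_const_mul _ hm, ker_rep ha0 hz]
    ring
  rw [e1, lintegral_lintegral_swap hΦ.aemeasurable, ← lintegral_const_mul]
  · refine lintegral_congr fun p => ?_
    rw [Measure.volume_eq_prod, lintegral_prod]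
    · have e2 : ∀ t s : ℝ, Φ (t,s) p = (ENNReal.ofReal (a * (a+1)) * ENNReal.ofReal p.1 ^ (-a-2) *
          (win p.1 p.2 t * h t)) * (win p.1 p.2 s * g s) := by
        intro t s; simp only [Φ]; ring
      have m2 : Measurable fun s => win p.1 p.2 s * g s := (hw1 p).mul hg
      have m3 : Measurable fun s => win p.1 p.2 s * h s := (hw1 p).mul hh
      simp only [e2]
      simp_rw [lintegral_const_mul _ m2]
      rw [lintegral_mul_const _ (m3.const_mul _), lintegral_const_mul _ m3]
      simp only [Jw]
      ring
    · exact (hΦ.comp measurable_prodMk_right).aemeasurable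
  · exact hR.mul ((measurable_Jw hh).mul (measurable_Jw hg))

lemma Bform_cs {a : ℝ} (ha0 : 0 < a) {h g : ℝ → ℝ≥0∞} (hh : Measurable h) (hg : Measurable g) :
    Bform a h g ≤ Bform a h h ^ ((1:ℝ)/2) * Bform a g g ^ ((1:ℝ)/2) := by
  rw [Bform_rep ha0 hh hg, Bform_rep ha0 hh hh, Bform_rep ha0 hg hg]
  have hR : Measurable fun p : ℝ × ℝ => ENNReal.ofReal p.1 ^ (-a-2) :=
    (ENNReal.measurable_ofReal.comp measurable_fst).pow_const _
  set W : ℝ × ℝ → ℝ≥0∞ := fun p => ENNReal.ofReal p.1 ^ (-a-2) with hW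
  have key := ENNReal.lintegral_mul_le_Lp_mul_Lq (μ := winM) (p := 2) (q := 2)
    (f := fun p => W p ^ ((1:ℝ)/2) * Jw h p) (g := fun p => W p ^ ((1:ℝ)/2) * Jw g p)
    (by constructor <;> norm_num) ((hR.pow_const _).mul (measurable_Jw hh)).aemeasurable
    ((hR.pow_const _).mul (measurable_Jw hg)).aemeasurable
  have hs : ∀ x : ℝ≥0∞, x ^ ((1:ℝ)/2) * x ^ ((1:ℝ)/2) = x := by
    intro x
    rw [← ENNReal.rpow_add_of_nonneg _ _ (by norm_num) (by norm_num)]; norm_num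
  have e : ∀ h g : ℝ → ℝ≥0∞, ∀ p, (W p ^ ((1:ℝ)/2) * Jw h p) * (W p ^ ((1:ℝ)/2) * Jw g p) =
      W p * (Jw h p * Jw g p) := by
    intro h g p
    calc _ = (W p ^ ((1:ℝ)/2) * W p ^ ((1:ℝ)/2)) * (Jw h p * Jw g p) := by ring
      _ = _ := by rw [hs]
  have e' : ∀ h : ℝ → ℝ≥0∞, ∀ p, (W p ^ ((1:ℝ)/2) * Jw h p) ^ (2:ℝ) = W p * (Jw h p * Jw h p) := by
    intro h p
    rw [ENNReal.rpow_two, sq, e]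
  simp only [Pi.mul_apply, e, e'] at key
  rw [ENNReal.mul_rpow_of_nonneg _ _ (by norm_num), ENNReal.mul_rpow_of_nonneg _ _ (by norm_num)]
  calc _ ≤ ENNReal.ofReal (a * (a+1)) * _ := mul_le_mul_right key _
    _ = (ENNReal.ofReal (a * (a+1)) ^ ((1:ℝ)/2) * ENNReal.ofReal (a * (a+1)) ^ ((1:ℝ)/2)) * _ := by rw [hs]
    _ = _ := by ring
end

noncomputable section
open MeasureTheory Real Filter Topology Set
open scoped ENNReal NNReal ComplexConjugate

/-- Fourier transform -/
def FT (d : ℕ) (φ : Rd d → ℂ) (ξ : Rd d) : ℂ :=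
  ∫ y : Rd d, Complex.exp (-((2 * π * inner ℝ y ξ : ℝ) : ℂ) * Complex.I) * φ y

/-- Gaussian kernel -/
def kz (d : ℕ) (z : ℂ) (w : Rd d) : ℂ :=
  (1 / (4 * π * z)) ^ ((d : ℂ) / 2) * Complex.exp (-((‖w‖ ^ 2 : ℝ) : ℂ) / (4 * z))

lemma gauss_int {d : ℕ} {z : ℂ} (hz : 0 < z.re) (w : Rd d) :
    ∫ ξ : Rd d, Complex.exp (-(4 * π ^ 2 * z) * ((‖ξ‖ ^ 2 : ℝ) : ℂ)) *
      Complex.exp (((2 * π * inner ℝ w ξ : ℝ) : ℂ) * Complex.I) = kz d z w := by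
  have hb : 0 < (4 * π ^ 2 * z : ℂ).re := by
    have : (4 * π ^ 2 * z : ℂ) = ((4 * π ^ 2 : ℝ) : ℂ) * z := by push_cast; ring
    rw [this, Complex.re_ofReal_mul]; positivity
  have h := GaussianFourier.integral_cexp_neg_mul_sq_norm_add (V := Rd d) hb (2 * π * Complex.I) w
  have hz0 : z ≠ 0 := by rintro rfl; simp at hz
  have hpi : (π : ℂ) ≠ 0 := by exact_mod_cast Real.pi_ne_zero
  rw [kz]
  have e1 : (1 / (4 * π * z) : ℂ) = π / (4 * π ^ 2 * z) := by field_simp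
  have e2 : -((‖w‖ ^ 2 : ℝ) : ℂ) / (4 * z) = (2 * π * Complex.I) ^ 2 * ‖w‖ ^ 2 / (4 * (4 * π ^ 2 * z)) := by
    rw [mul_pow, Complex.I_sq]; push_cast; field_simp; ring
  rw [e1, e2]
  rw [finrank_euclideanSpace_fin] at h
  rw [← h]
  refine integral_congr_ae (Eventually.of_forall fun ξ => ?_)
  simp only
  rw [← Complex.exp_add]
  congr 1
  push_cast
  ring

lemma gauss_integrable {d : ℕ} {z : ℂ} (hz : 0 < z.re) :
    Integrable fun ξ : Rd d => Complex.exp (-(4 * π ^ 2 * z) * ((‖ξ‖ ^ 2 : ℝ) : ℂ)) := by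
  have hb : 0 < (4 * π ^ 2 * z : ℂ).re := by
    have : (4 * π ^ 2 * z : ℂ) = ((4 * π ^ 2 : ℝ) : ℂ) * z := by push_cast; ring
    rw [this, Complex.re_ofReal_mul]; positivity
  have h := GaussianFourier.integrable_cexp_neg_mul_sq_norm_add (V := Rd d) hb 0 0
  refine h.congr (Eventually.of_forall fun ξ => ?_)
  simp

lemma norm_exp_ofReal_I (x : ℝ) : ‖Complex.exp ((x : ℂ) * Complex.I)‖ = 1 :=
  Complex.norm_exp_ofReal_mul_I x

lemma gauss_fubini {d : ℕ} {z : ℂ} (hz : 0 < z.re) {ψ φ : Rd d → ℂ} (hψ : Integrable ψ)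
    (hφ : Integrable φ) :
    ∫ ξ : Rd d, Complex.exp (-(4 * π ^ 2 * z) * ((‖ξ‖ ^ 2 : ℝ) : ℂ)) * (FT d ψ (-ξ) * FT d φ ξ) =
      ∫ p : Rd d × Rd d, ψ p.1 * φ p.2 * kz d z (p.1 - p.2) := by
  let E : Rd d → ℂ := fun ξ => Complex.exp (-(4 * π ^ 2 * z) * ((‖ξ‖ ^ 2 : ℝ) : ℂ))
  let Φ : Rd d → Rd d × Rd d → ℂ := fun ξ p => Complex.exp (((2 * π * inner ℝ (p.1 - p.2) ξ : ℝ) : ℂ) * Complex.I) *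
    (E ξ * (ψ p.1 * φ p.2))
  have hIntg : Integrable (Function.uncurry Φ) (volume.prod volume) := by
    have h1 : Integrable (fun x : Rd d × (Rd d × Rd d) => E x.1 * (ψ x.2.1 * φ x.2.2)) (volume.prod volume) :=
      (gauss_integrable hz).mul_prod (hψ.mul_prod hφ)
    refine h1.bdd_mul (c := 1) ?_ ?_
    · refine Continuous.aestronglyMeasurable ?_
      fun_prop
    · exact Eventually.of_forall fun x => (norm_exp_ofReal_I _).le
  calc _ = ∫ ξ, ∫ p, Φ ξ p := by
        refine integral_congr_ae (Eventually.of_forall fun ξ => ?_)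
        simp only [FT]
        rw [← integral_prod_mul, ← integral_const_mul]
        refine integral_congr_ae (Eventually.of_forall fun p => ?_)
        simp only [Φ, E]
        have : Complex.exp (((2 * π * inner ℝ (p.1 - p.2) ξ : ℝ) : ℂ) * Complex.I) =
          Complex.exp (-((2 * π * inner ℝ p.1 (-ξ) : ℝ) : ℂ) * Complex.I) *
            Complex.exp (-((2 * π * inner ℝ p.2 ξ : ℝ) : ℂ) * Complex.I) := by
          rw [← Complex.exp_add]; congr 1
          rw [inner_sub_left, inner_neg_right]; push_cast; ring
        rw [this]; ring
    _ = ∫ p, ∫ ξ, Φ ξ p := integral_integral_swap hIntg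
    _ = _ := by
        refine integral_congr_ae (Eventually.of_forall fun p => ?_)
        simp only [Φ]
        rw [← gauss_int hz, ← integral_const_mul]
        refine integral_congr_ae (Eventually.of_forall fun ξ => ?_)
        simp only [E]; ring

lemma FT_conj {d : ℕ} (φ : Rd d → ℂ) (ξ : Rd d) :
    FT d (fun x => conj (φ x)) (-ξ) = conj (FT d φ ξ) := by
  rw [FT, FT, ← integral_conj]
  refine integral_congr_ae (Eventually.of_forall fun y => ?_)
  simp only [map_mul, ← Complex.exp_conj, map_neg, Complex.conj_ofReal, Complex.conj_I, inner_neg_right]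
  congr 2; push_cast; ring

lemma FT_aesm {d : ℕ} {φ : Rd d → ℂ} (hφ : Integrable φ) : StronglyMeasurable (FT d φ) := by
  refine Continuous.stronglyMeasurable ?_
  refine continuous_of_dominated (bound := fun y => ‖φ y‖) ?_ ?_ hφ.norm ?_
  · intro ξ
    exact (Continuous.aestronglyMeasurable (by fun_prop)).mul hφ.1
  · intro ξ
    refine Eventually.of_forall fun y => ?_
    rw [norm_mul, ← Complex.ofReal_neg, norm_exp_ofReal_I, one_mul]
  · refine Eventually.of_forall fun y => ?_
    fun_prop

lemma kz_real_int {d : ℕ} {ε : ℝ} (hε : 0 < ε) :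
    ∫⁻ w : Rd d, ‖kz d ε w‖ₑ = 1 := by
  have hpos : ∀ w : Rd d, ‖kz d ε w‖ = (1 / (4 * π * ε)) ^ ((d:ℝ)/2) * Real.exp (-(1/(4*ε)) * ‖w‖^2) := by
    intro w
    rw [kz, norm_mul]
    congr 1
    · have : (1 / (4 * π * (ε:ℂ))) = ((1 / (4 * π * ε) : ℝ) : ℂ) := by push_cast; ring
      rw [this, Complex.norm_cpow_eq_rpow_re_of_pos (by positivity)]
      congr 1
      rw [show ((d:ℂ)/2) = (((d:ℝ)/2 : ℝ) : ℂ) by push_cast; ring, Complex.ofReal_re]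
    · rw [Complex.norm_exp]
      congr 1
      rw [show -((‖w‖ ^ 2 : ℝ) : ℂ) / (4 * ε) = ((-(1/(4*ε)) * ‖w‖^2 : ℝ) : ℂ) by push_cast; ring,
        Complex.ofReal_re]
  have hI : ∫ w : Rd d, Real.exp (-(1/(4*ε)) * ‖w‖^2) = (π / (1/(4*ε))) ^ ((d:ℝ)/2) := by
    have := GaussianFourier.integral_rexp_neg_mul_sq_norm (V := Rd d) (b := 1/(4*ε)) (by positivity)
    rw [finrank_euclideanSpace_fin] at this
    exact this
  have hIntg : Integrable fun w : Rd d => Real.exp (-(1/(4*ε)) * ‖w‖^2) := by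
    by_contra h
    rw [integral_undef h] at hI
    have : 0 < (π / (1/(4*ε))) ^ ((d:ℝ)/2) := by positivity
    linarith
  have : ∫⁻ w : Rd d, ‖kz d ε w‖ₑ = ENNReal.ofReal (∫ w : Rd d, ‖kz d ε w‖) := by
    rw [ofReal_integral_norm_eq_lintegral_enorm]
    have hc : Continuous (kz d ε) := by unfold kz; fun_prop
    refine (integrable_norm_iff hc.aestronglyMeasurable).1 ?_
    simp only [hpos]
    exact hIntg.const_mul _
  rw [this]
  simp only [hpos]
  rw [integral_const_mul, hI, ← Real.mul_rpow (by positivity) (by positivity)]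
  have : 1 / (4 * π * ε) * (π / (1 / (4 * ε))) = 1 := by field_simp
  rw [this, Real.one_rpow, ENNReal.ofReal_one]
end

noncomputable section
open MeasureTheory Real Filter Topology Set
open scoped ENNReal NNReal ComplexConjugate

lemma enn_young (x y : ℝ≥0∞) : x * y ≤ (x ^ 2 + y ^ 2) / 2 := by
  have := ENNReal.young_inequality x y (p := 2) (q := 2) (by constructor <;> norm_num)
  simp only [ENNReal.rpow_two] at this
  refine this.trans (le_of_eq ?_)
  rw [ENNReal.add_div]; norm_num

lemma kz_cont {d : ℕ} (z : ℂ) : Continuous (kz d z) := by unfold kz; fun_prop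

lemma FT_bound {d : ℕ} (φ : Rd d → ℂ) (ξ : Rd d) : ‖FT d φ ξ‖ ≤ ∫ y, ‖φ y‖ := by
  refine (norm_integral_le_integral_norm _).trans (le_of_eq ?_)
  refine integral_congr_ae (Eventually.of_forall fun y => ?_)
  simp only
  rw [norm_mul, ← Complex.ofReal_neg, norm_exp_ofReal_I, one_mul]

lemma plancherel_le {d : ℕ} {φ : Rd d → ℂ} (hφ : Integrable φ) :
    ∫⁻ ξ, ‖FT d φ ξ‖ₑ ^ 2 ≤ ∫⁻ x, ‖φ x‖ₑ ^ 2 := by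
  -- regularised bound
  have key : ∀ ε : ℝ, 0 < ε → ∫⁻ ξ : Rd d, ENNReal.ofReal (Real.exp (-(4 * π ^ 2 * ε) * ‖ξ‖ ^ 2)) * ‖FT d φ ξ‖ₑ ^ 2 ≤
      ∫⁻ x, ‖φ x‖ₑ ^ 2 := by
    intro ε hε
    have hz : 0 < (ε : ℂ).re := by simpa using hε
    have hF := gauss_fubini (d := d) hz (ψ := fun x => conj (φ x)) (φ := φ)
      ((LinearIsometryEquiv.integrable_comp_iff Complex.conjLIE).2 hφ) hφ
    have hreal : ∀ ξ : Rd d, Complex.exp (-(4 * π ^ 2 * ε) * ((‖ξ‖ ^ 2 : ℝ) : ℂ)) *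
        (FT d (fun x => conj (φ x)) (-ξ) * FT d φ ξ) =
        ((Real.exp (-(4 * π ^ 2 * ε) * ‖ξ‖ ^ 2) * ‖FT d φ ξ‖ ^ 2 : ℝ) : ℂ) := by
      intro ξ
      rw [FT_conj, mul_comm (conj _), Complex.mul_conj, Complex.normSq_eq_norm_sq]
      push_cast; rfl
    simp only [hreal] at hF
    rw [integral_complex_ofReal] at hF
    have hIntg : Integrable fun ξ : Rd d => Real.exp (-(4 * π ^ 2 * ε) * ‖ξ‖ ^ 2) * ‖FT d φ ξ‖ ^ 2 := by
      have h1 := (gauss_integrable (d := d) hz).norm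
      have : ∀ ξ : Rd d, ‖Complex.exp (-(4 * π ^ 2 * ε) * ((‖ξ‖ ^ 2 : ℝ) : ℂ))‖ = Real.exp (-(4 * π ^ 2 * ε) * ‖ξ‖ ^ 2) := by
        intro ξ
        rw [Complex.norm_exp]
        congr 1
        rw [show (-(4 * π ^ 2 * ε) * ((‖ξ‖ ^ 2 : ℝ) : ℂ)) = ((-(4 * π ^ 2 * ε) * ‖ξ‖ ^ 2 : ℝ) : ℂ) by push_cast; ring,
          Complex.ofReal_re]
      simp only [this] at h1
      refine h1.mul_bdd (c := (∫ y, ‖φ y‖)^2) ((FT_aesm hφ).norm.pow 2).aestronglyMeasurable ?_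
      refine Eventually.of_forall fun ξ => ?_
      rw [norm_pow, norm_norm]
      exact pow_le_pow_left₀ (norm_nonneg _) (FT_bound φ ξ) 2
    have hL : ∫⁻ ξ : Rd d, ENNReal.ofReal (Real.exp (-(4 * π ^ 2 * ε) * ‖ξ‖ ^ 2)) * ‖FT d φ ξ‖ₑ ^ 2 =
        ENNReal.ofReal (∫ ξ : Rd d, Real.exp (-(4 * π ^ 2 * ε) * ‖ξ‖ ^ 2) * ‖FT d φ ξ‖ ^ 2) := by
      rw [ofReal_integral_eq_lintegral_ofReal hIntg (Eventually.of_forall fun ξ => by positivity)]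
      refine lintegral_congr fun ξ => ?_
      rw [ENNReal.ofReal_mul (by positivity), ENNReal.ofReal_pow (norm_nonneg _), ofReal_norm]
    rw [hL]
    have hK : Measurable fun w : Rd d => ‖kz d ε w‖ₑ := (kz_cont _).measurable.enorm
    have hφm : AEMeasurable (fun x => ‖φ x‖ₑ ^ 2) := (hφ.1.enorm.pow_const 2)
    calc ENNReal.ofReal (∫ ξ : Rd d, Real.exp (-(4 * π ^ 2 * ε) * ‖ξ‖ ^ 2) * ‖FT d φ ξ‖ ^ 2)
        ≤ ‖((∫ ξ : Rd d, Real.exp (-(4 * π ^ 2 * ε) * ‖ξ‖ ^ 2) * ‖FT d φ ξ‖ ^ 2 : ℝ) : ℂ)‖ₑ := by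
          rw [← ofReal_norm, Complex.norm_real]
          exact ENNReal.ofReal_le_ofReal (le_abs_self _)
      _ ≤ ∫⁻ p : Rd d × Rd d, ‖conj (φ p.1) * φ p.2 * kz d ε (p.1 - p.2)‖ₑ := by
          rw [hF]; exact enorm_integral_le_lintegral_enorm _
      _ ≤ ∫⁻ p : Rd d × Rd d, (2⁻¹ * (‖φ p.1‖ₑ ^ 2 * ‖kz d ε (p.1 - p.2)‖ₑ) +
            2⁻¹ * (‖φ p.2‖ₑ ^ 2 * ‖kz d ε (p.1 - p.2)‖ₑ)) := by
          refine lintegral_mono fun p => ?_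
          rw [enorm_mul, enorm_mul, RCLike.enorm_conj]
          refine (mul_le_mul_left (enn_young _ _) _).trans (le_of_eq ?_)
          rw [ENNReal.div_eq_inv_mul]; ring
      _ = ∫⁻ x, ‖φ x‖ₑ ^ 2 := by
          have m1 : AEMeasurable (fun p : Rd d × Rd d => ‖φ p.1‖ₑ ^ 2 * ‖kz d ε (p.1 - p.2)‖ₑ) (volume.prod volume) :=
            (hφm.comp_quasiMeasurePreserving Measure.quasiMeasurePreserving_fst).mul
              (hK.comp (by fun_prop)).aemeasurable
          have m2 : AEMeasurable (fun p : Rd d × Rd d => ‖φ p.2‖ₑ ^ 2 * ‖kz d ε (p.1 - p.2)‖ₑ) (volume.prod volume) :=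
            (hφm.comp_quasiMeasurePreserving Measure.quasiMeasurePreserving_snd).mul
              (hK.comp (by fun_prop)).aemeasurable
          rw [Measure.volume_eq_prod, lintegral_add_left' (m1.const_mul _), lintegral_const_mul'' _ m1,
            lintegral_const_mul'' _ m2]
          have i1 : ∫⁻ p : Rd d × Rd d, ‖φ p.1‖ₑ ^ 2 * ‖kz d ε (p.1 - p.2)‖ₑ ∂(volume.prod volume) = ∫⁻ x, ‖φ x‖ₑ ^ 2 := by
            rw [lintegral_prod _ m1]
            refine lintegral_congr fun x => ?_
            have : Measurable fun y : Rd d => ‖kz d ε (x - y)‖ₑ := hK.comp (by fun_prop)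
            simp only
            rw [lintegral_const_mul _ this, lintegral_sub_left_eq_self (fun w => ‖kz d ε w‖ₑ) x, kz_real_int hε, mul_one]
          have i2 : ∫⁻ p : Rd d × Rd d, ‖φ p.2‖ₑ ^ 2 * ‖kz d ε (p.1 - p.2)‖ₑ ∂(volume.prod volume) = ∫⁻ x, ‖φ x‖ₑ ^ 2 := by
            rw [lintegral_prod_symm _ m2]
            refine lintegral_congr fun x => ?_
            have : Measurable fun y : Rd d => ‖kz d ε (y - x)‖ₑ := hK.comp (by fun_prop)
            simp only
            rw [lintegral_const_mul _ this, lintegral_sub_right_eq_self (fun w => ‖kz d ε w‖ₑ) x, kz_real_int hε, mul_one]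
          rw [i1, i2, ← two_mul, ← mul_assoc, ENNReal.mul_inv_cancel (by simp) (by simp), one_mul]
  have hlim : ∀ ξ : Rd d, Tendsto (fun n : ℕ => ENNReal.ofReal (Real.exp (-(4 * π ^ 2 * (1 / ((n:ℝ) + 1))) * ‖ξ‖ ^ 2)) * ‖FT d φ ξ‖ₑ ^ 2)
      atTop (𝓝 (‖FT d φ ξ‖ₑ ^ 2)) := by
    intro ξ
    have h0 := tendsto_one_div_add_atTop_nhds_zero_nat (𝕜 := ℝ)
    have hc : Continuous fun ε : ℝ => ENNReal.ofReal (Real.exp (-(4 * π ^ 2 * ε) * ‖ξ‖ ^ 2)) := by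
      exact ENNReal.continuous_ofReal.comp (by fun_prop)
    have h1 := (hc.tendsto 0).comp h0
    simp only [mul_zero, neg_zero, zero_mul, Real.exp_zero, ENNReal.ofReal_one] at h1
    have h2 := ENNReal.Tendsto.mul_const (b := ‖FT d φ ξ‖ₑ ^ 2) h1 (Or.inl one_ne_zero)
    rw [one_mul] at h2
    exact h2
  calc ∫⁻ ξ, ‖FT d φ ξ‖ₑ ^ 2 = ∫⁻ ξ, liminf (fun n : ℕ => ENNReal.ofReal (Real.exp (-(4 * π ^ 2 * (1 / ((n:ℝ) + 1))) * ‖ξ‖ ^ 2)) * ‖FT d φ ξ‖ₑ ^ 2) atTop := by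
        refine lintegral_congr fun ξ => (hlim ξ).liminf_eq.symm
    _ ≤ liminf (fun n : ℕ => ∫⁻ ξ, ENNReal.ofReal (Real.exp (-(4 * π ^ 2 * (1 / ((n:ℝ) + 1))) * ‖ξ‖ ^ 2)) * ‖FT d φ ξ‖ₑ ^ 2) atTop := by
        refine lintegral_liminf_le fun n => ?_
        refine Measurable.mul (Continuous.measurable (ENNReal.continuous_ofReal.comp (by fun_prop))) ?_
        exact (FT_aesm hφ).measurable.enorm.pow_const 2
    _ ≤ _ := by
        refine liminf_le_of_le (by isBoundedDefault) ?_
        intro b hb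
        obtain ⟨n, hn⟩ := hb.exists
        exact hn.trans (key _ (by positivity))
end

noncomputable section
open MeasureTheory Real Filter Topology Set
open scoped ENNReal NNReal ComplexConjugate

/-- dispersive constant -/
def Adis (d : ℕ) (t : ℝ) : ℝ := (4 * π * |t|) ^ (-(d:ℝ)/2)

lemma kz_bound {d : ℕ} {t : ℝ} (ht : t ≠ 0) {ε : ℝ} (hε : 0 ≤ ε) (w : Rd d) :
    ‖kz d (ε + t * Complex.I) w‖ ≤ Adis d t := by
  have ht' : 0 < |t| := abs_pos.2 ht
  set z : ℂ := ε + t * Complex.I with hz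
  have hre : z.re = ε := by simp [hz]
  have him : z.im = t := by simp [hz]
  have hz0 : z ≠ 0 := by intro h; rw [h] at him; simp at him; exact ht him.symm
  rw [kz, norm_mul]
  have h1 : ‖(1 / (4 * π * z) : ℂ) ^ ((d : ℂ) / 2)‖ ≤ Adis d t := by
    rw [show ((d:ℂ)/2) = (((d:ℝ)/2 : ℝ) : ℂ) by push_cast; ring,
      Complex.norm_cpow_real]
    rw [Adis, neg_div, Real.rpow_neg (by positivity), ← Real.inv_rpow (by positivity)]
    refine Real.rpow_le_rpow (norm_nonneg _) ?_ (by positivity)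
    rw [norm_div, norm_one, one_div, norm_mul, norm_mul, Complex.norm_real, Complex.norm_ofNat,
      Real.norm_of_nonneg Real.pi_pos.le]
    refine inv_anti₀ (by positivity) ?_
    have := Complex.abs_im_le_norm z
    rw [him] at this
    gcongr
  have h2 : ‖Complex.exp (-((‖w‖ ^ 2 : ℝ) : ℂ) / (4 * z))‖ ≤ 1 := by
    rw [Complex.norm_exp]
    refine Real.exp_le_one_iff.2 ?_
    rw [show -((‖w‖ ^ 2 : ℝ) : ℂ) / (4 * z) = ((-(‖w‖^2/4) : ℝ) : ℂ) * z⁻¹ by push_cast; field_simp,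
      Complex.re_ofReal_mul, Complex.inv_re, hre]
    have : 0 ≤ ε / Complex.normSq z := div_nonneg hε (Complex.normSq_nonneg z)
    nlinarith [sq_nonneg ‖w‖]
  calc _ ≤ Adis d t * 1 := mul_le_mul h1 h2 (norm_nonneg _) ((norm_nonneg _).trans h1)
    _ = _ := mul_one _

lemma kz_tendsto {d : ℕ} {t : ℝ} (ht : t ≠ 0) (w : Rd d) :
    Tendsto (fun ε : ℝ => kz d (ε + t * Complex.I) w) (𝓝[>] 0) (𝓝 (kz d (t * Complex.I) w)) := by
  have hz0 : (t * Complex.I : ℂ) ≠ 0 := by simp [ht]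
  have hpi : (π : ℂ) ≠ 0 := by exact_mod_cast Real.pi_ne_zero
  have hc : ContinuousAt (fun z : ℂ => kz d z w) (t * Complex.I) := by
    unfold kz
    have hs : (1 / (4 * π * (t * Complex.I)) : ℂ) ∈ Complex.slitPlane := by
      rw [Complex.mem_slitPlane_iff]
      right
      have : (1 / (4 * π * (t * Complex.I)) : ℂ) = ((-(1 / (4 * π * t)) : ℝ) : ℂ) * Complex.I := by
        have : (t : ℂ) ≠ 0 := by exact_mod_cast ht
        have hI : Complex.I ^ 2 = -1 := Complex.I_sq
        push_cast
        field_simp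
        rw [hI]; ring
      rw [this]
      simp [ht, Real.pi_ne_zero]
    refine ContinuousAt.mul ?_ ?_
    · refine ContinuousAt.cpow ?_ continuousAt_const hs
      refine ContinuousAt.div continuousAt_const (by fun_prop) ?_
      simp [ht, hpi]
    · refine Complex.continuous_exp.continuousAt.comp ?_
      refine ContinuousAt.div continuousAt_const (by fun_prop) ?_
      simp [ht]
  have h2 : Tendsto (fun ε : ℝ => (ε + t * Complex.I : ℂ)) (𝓝[>] 0) (𝓝 (t * Complex.I)) := by
    have : Continuous fun ε : ℝ => (ε + t * Complex.I : ℂ) := by fun_prop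
    have := (this.tendsto 0).mono_left (nhdsWithin_le_nhds (s := Ioi 0))
    simpa using this
  exact hc.tendsto.comp h2

lemma sgroup_eq {d : ℕ} {t : ℝ} (ht : t ≠ 0) (φ : Rd d → ℂ) (x : Rd d) :
    sgroup d t φ x = ∫ y, kz d (t * Complex.I) (x - y) * φ y := by
  have ht' : (t : ℂ) ≠ 0 := by exact_mod_cast ht
  rw [sgroup, if_neg ht, ← integral_const_mul]
  refine integral_congr_ae (Eventually.of_forall fun y => ?_)
  simp only [kz]
  have e1 : ((((4 * π * t : ℝ) : ℂ) * Complex.I) ^ (-(d : ℂ) / 2)) = (1 / (4 * π * (t * Complex.I))) ^ ((d : ℂ) / 2) := by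
    have : (1 / (4 * π * (t * Complex.I)) : ℂ) = (((4 * π * t : ℝ) : ℂ) * Complex.I)⁻¹ := by
      rw [one_div]; congr 1; push_cast; ring
    rw [this, Complex.inv_cpow, neg_div, Complex.cpow_neg]
    intro h
    rw [Complex.arg_eq_pi_iff] at h
    have h2 := h.2
    simp [ht, Real.pi_ne_zero] at h2
  have e2 : Complex.I * ((‖x - y‖ ^ 2 : ℝ) : ℂ) / ((4 * t : ℝ) : ℂ) = -((‖x - y‖ ^ 2 : ℝ) : ℂ) / (4 * (t * Complex.I)) := by
    have hI : Complex.I ^ 2 = -1 := Complex.I_sq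
    push_cast
    field_simp
    rw [hI]; ring
  rw [e1, e2]; ring

lemma kz_bound' {d : ℕ} {t : ℝ} (ht : t ≠ 0) (w : Rd d) : ‖kz d (t * Complex.I) w‖ ≤ Adis d t := by
  have := kz_bound (d := d) ht le_rfl w
  simpa using this

lemma sgroup_bound {d : ℕ} {t : ℝ} (ht : t ≠ 0) (φ : Rd d → ℂ) (x : Rd d) :
    ‖sgroup d t φ x‖ₑ ≤ ENNReal.ofReal (Adis d t) * ∫⁻ y, ‖φ y‖ₑ := by
  rw [sgroup_eq ht]
  refine (enorm_integral_le_lintegral_enorm _).trans ?_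
  rw [← lintegral_const_mul' _ _ (by simp)]
  refine lintegral_mono fun y => ?_
  rw [enorm_mul, ← ofReal_norm]
  exact mul_le_mul_left (ENNReal.ofReal_le_ofReal (kz_bound' ht _)) _

lemma sgroup_cont {d : ℕ} {t : ℝ} (ht : t ≠ 0) {φ : Rd d → ℂ} (hφ : Integrable φ) :
    Continuous (sgroup d t φ) := by
  have : sgroup d t φ = fun x => ∫ y, kz d (t * Complex.I) (x - y) * φ y := by
    ext x; exact sgroup_eq ht φ x
  rw [this]
  refine continuous_of_dominated (bound := fun y => Adis d t * ‖φ y‖) ?_ ?_ (hφ.norm.const_mul _) ?_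
  · intro x
    exact ((kz_cont _).comp (by fun_prop)).aestronglyMeasurable.mul hφ.1
  · intro x
    refine Eventually.of_forall fun y => ?_
    rw [norm_mul]
    exact mul_le_mul_of_nonneg_right (kz_bound' ht _) (norm_nonneg _)
  · refine Eventually.of_forall fun y => ?_
    have := (kz_cont (d := d) (t * Complex.I)).comp (continuous_id.sub (continuous_const (y := y)))
    exact this.mul continuous_const

lemma sgroup_nonint {d : ℕ} {t : ℝ} (ht : t ≠ 0) {φ : Rd d → ℂ} (hφ : ¬ Integrable φ) :
    sgroup d t φ = 0 := by
  ext x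
  rw [sgroup, if_neg ht]
  have : ¬ Integrable fun y : Rd d =>
      Complex.exp (Complex.I * ((‖x - y‖ ^ 2 : ℝ) : ℂ) / ((4 * t : ℝ) : ℂ)) * φ y := by
    intro h
    apply hφ
    have h2 := h.bdd_mul (c := 1) (f := fun y => Complex.exp (-(Complex.I * ((‖x - y‖ ^ 2 : ℝ) : ℂ) / ((4 * t : ℝ) : ℂ))))
      (Continuous.aestronglyMeasurable (by fun_prop)) ?_
    · refine h2.congr (Eventually.of_forall fun y => ?_)
      simp only
      rw [← mul_assoc, ← Complex.exp_add, neg_add_cancel, Complex.exp_zero, one_mul]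
    · refine Eventually.of_forall fun y => ?_
      rw [show -(Complex.I * ((‖x - y‖ ^ 2 : ℝ) : ℂ) / ((4 * t : ℝ) : ℂ)) = ((-(‖x-y‖^2/(4*t)) : ℝ) : ℂ) * Complex.I by
        push_cast; ring, norm_exp_ofReal_I]
  rw [integral_undef this, mul_zero]; rfl

lemma FT_memLp {d : ℕ} {φ : Rd d → ℂ} (hφ : Integrable φ) (hφ2 : ∫⁻ x, ‖φ x‖ₑ ^ 2 < ⊤) :
    MemLp (FT d φ) 2 := by
  refine ⟨(FT_aesm hφ).aestronglyMeasurable, ?_⟩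
  rw [eLpNorm_lt_top_iff_lintegral_rpow_enorm_lt_top (by simp) (by simp)]
  simpa using (plancherel_le hφ).trans_lt hφ2

/-- Fourier representation of the Schrödinger group pairing -/
lemma star {d : ℕ} {t : ℝ} (ht : t ≠ 0) {ψ φ : Rd d → ℂ} (hψ : Integrable ψ) (hφ : Integrable φ)
    (hψ2 : ∫⁻ x, ‖ψ x‖ₑ ^ 2 < ⊤) (hφ2 : ∫⁻ x, ‖φ x‖ₑ ^ 2 < ⊤) :
    ∫ x, ψ x * sgroup d t φ x =
      ∫ ξ : Rd d, Complex.exp (((-(4 * π ^ 2 * t * ‖ξ‖ ^ 2) : ℝ) : ℂ) * Complex.I) * (FT d ψ (-ξ) * FT d φ ξ) := by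
  have hFF : Integrable fun ξ => FT d ψ (-ξ) * FT d φ ξ := by
    have h1 : MemLp (fun ξ => FT d ψ (-ξ)) 2 :=
      (FT_memLp hψ hψ2).comp_measurePreserving (Measure.measurePreserving_neg (volume : Measure (Rd d)))
    exact MemLp.integrable_mul h1 (FT_memLp hφ hφ2)
  have hL : Tendsto (fun ε : ℝ => ∫ ξ : Rd d, Complex.exp (-(4 * π ^ 2 * (ε + t * Complex.I)) * ((‖ξ‖ ^ 2 : ℝ) : ℂ)) * (FT d ψ (-ξ) * FT d φ ξ))
      (𝓝[>] 0) (𝓝 (∫ ξ : Rd d, Complex.exp (((-(4 * π ^ 2 * t * ‖ξ‖ ^ 2) : ℝ) : ℂ) * Complex.I) * (FT d ψ (-ξ) * FT d φ ξ))) := by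
    refine tendsto_integral_filter_of_dominated_convergence (fun ξ => ‖FT d ψ (-ξ) * FT d φ ξ‖) ?_ ?_ hFF.norm ?_
    · refine Eventually.of_forall fun ε => ?_
      exact (Continuous.aestronglyMeasurable (by fun_prop)).mul hFF.1
    · filter_upwards [self_mem_nhdsWithin] with ε hε
      refine Eventually.of_forall fun ξ => ?_
      rw [norm_mul]
      refine mul_le_of_le_one_left (norm_nonneg _) ?_
      rw [Complex.norm_exp]
      refine Real.exp_le_one_iff.2 ?_
      rw [show -(4 * π ^ 2 * (ε + t * Complex.I)) * ((‖ξ‖ ^ 2 : ℝ) : ℂ) = ((-(4 * π ^ 2 * ‖ξ‖^2) : ℝ) : ℂ) * (ε + t * Complex.I) by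
        push_cast; ring, Complex.re_ofReal_mul]
      have : (0:ℝ) < ε := hε
      simp
      positivity
    · refine Eventually.of_forall fun ξ => ?_
      refine Tendsto.mul_const _ ?_
      have hc : Continuous fun ε : ℝ => Complex.exp (-(4 * π ^ 2 * (ε + t * Complex.I)) * ((‖ξ‖ ^ 2 : ℝ) : ℂ)) := by fun_prop
      have := (hc.tendsto 0).mono_left (nhdsWithin_le_nhds (s := Ioi 0))
      convert this using 3
      push_cast; ring
  have hψφ : Integrable (fun p : Rd d × Rd d => ψ p.1 * φ p.2) := hψ.mul_prod hφ
  have hR : Tendsto (fun ε : ℝ => ∫ p : Rd d × Rd d, ψ p.1 * φ p.2 * kz d (ε + t * Complex.I) (p.1 - p.2))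
      (𝓝[>] 0) (𝓝 (∫ p : Rd d × Rd d, ψ p.1 * φ p.2 * kz d (t * Complex.I) (p.1 - p.2))) := by
    refine tendsto_integral_filter_of_dominated_convergence (fun p => ‖ψ p.1 * φ p.2‖ * Adis d t) ?_ ?_ (hψφ.norm.mul_const _) ?_
    · refine Eventually.of_forall fun ε => ?_
      exact hψφ.1.mul ((kz_cont _).comp (by fun_prop)).aestronglyMeasurable
    · filter_upwards [self_mem_nhdsWithin] with ε hε
      refine Eventually.of_forall fun p => ?_
      rw [norm_mul]
      exact mul_le_mul_of_nonneg_left (kz_bound ht (le_of_lt hε) _) (norm_nonneg _)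
    · refine Eventually.of_forall fun p => ?_
      exact (kz_tendsto ht _).const_mul _
  have hE : ∀ᶠ ε : ℝ in 𝓝[>] 0, ∫ ξ : Rd d, Complex.exp (-(4 * π ^ 2 * (ε + t * Complex.I)) * ((‖ξ‖ ^ 2 : ℝ) : ℂ)) * (FT d ψ (-ξ) * FT d φ ξ) =
      ∫ p : Rd d × Rd d, ψ p.1 * φ p.2 * kz d (ε + t * Complex.I) (p.1 - p.2) := by
    filter_upwards [self_mem_nhdsWithin] with ε hε
    exact gauss_fubini (by simpa using hε) hψ hφ
  have := tendsto_nhds_unique (hL.congr' hE) hR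
  rw [this]
  have hIntg : Integrable (fun p : Rd d × Rd d => ψ p.1 * φ p.2 * kz d (t * Complex.I) (p.1 - p.2)) (volume.prod volume) :=
    hψφ.mul_bdd (c := Adis d t) ((kz_cont _).comp (by fun_prop)).aestronglyMeasurable
      (Eventually.of_forall fun p => kz_bound' ht _)
  rw [Measure.volume_eq_prod, integral_prod _ hIntg]
  refine integral_congr_ae (Eventually.of_forall fun x => ?_)
  simp only
  rw [sgroup_eq ht, ← integral_const_mul]
  refine integral_congr_ae (Eventually.of_forall fun y => ?_)
  simp only; ring
end

noncomputable section
open MeasureTheory Real Filter Topology Set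
open scoped ENNReal NNReal ComplexConjugate

lemma LpN_eq {d : ℕ} {s : ℝ} (hs : 0 < s) (f : Rd d → ℂ) :
    LpN d s f = (∫⁻ x, ‖f x‖ₑ ^ s) ^ (1/s) := by
  rw [LpN, eLpNorm_eq_lintegral_rpow_enorm_toReal (by simpa using hs) (by simp),
    ENNReal.toReal_ofReal hs.le]

lemma holder_LpN {d : ℕ} {s s' : ℝ} (hs : s.HolderConjugate s') {f g : Rd d → ℂ}
    (hf : AEStronglyMeasurable f) (hg : AEStronglyMeasurable g) :
    ∫⁻ x, ‖f x * g x‖ₑ ≤ LpN d s f * LpN d s' g := by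
  have := ENNReal.lintegral_mul_le_Lp_mul_Lq volume hs hf.enorm hg.enorm
  rw [LpN_eq hs.pos, LpN_eq hs.symm.pos]
  simpa [enorm_mul] using this

lemma selfdual {d : ℕ} {s s' : ℝ} (hs : s.HolderConjugate s') (hs2 : 2 ≤ s) {w : Rd d → ℂ} (hw : Measurable w)
    {E : ℕ → Set (Rd d)} (hE : ∀ n, MeasurableSet (E n)) (hmono : Monotone E)
    (hfin : ∀ n, volume (E n) < ⊤) (hb : ∀ n, ∀ x ∈ E n, ‖w x‖ ≤ n) (h0 : ∀ x ∉ ⋃ n, E n, w x = 0)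
    {K : ℝ≥0∞} (hK : ∀ n, ∀ ψ : Rd d → ℂ, Measurable ψ → (∃ M : ℝ, ∀ x, ‖ψ x‖ ≤ M) → (∀ x ∉ E n, ψ x = 0) →
      ‖∫ x, w x * ψ x‖ₑ ≤ K * LpN d s' ψ) : LpN d s w ≤ K := by
  have key : ∀ n, (∫⁻ x in E n, ‖w x‖ₑ ^ s) ^ (1/s) ≤ K := by
    intro n
    set X := ∫⁻ x in E n, ‖w x‖ₑ ^ s with hX
    have hXfin : X < ⊤ := by
      calc X ≤ ∫⁻ x in E n, ENNReal.ofReal n ^ s := by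
            refine setLIntegral_mono measurable_const fun x hx => ?_
            refine ENNReal.rpow_le_rpow ?_ hs.nonneg
            rw [← ofReal_norm]; exact ENNReal.ofReal_le_ofReal (hb n x hx)
        _ < ⊤ := by
            rw [setLIntegral_const]
            exact ENNReal.mul_lt_top (ENNReal.rpow_lt_top_of_nonneg hs.nonneg (by simp)) (hfin n)
    let ψ : Rd d → ℂ := (E n).indicator fun x => conj (w x) * ((‖w x‖ ^ (s - 2) : ℝ) : ℂ)
    have hψm : Measurable ψ := by
      refine Measurable.indicator ?_ (hE n)
      exact (Complex.continuous_conj.measurable.comp hw).mul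
        (Complex.measurable_ofReal.comp (hw.norm.pow_const _))
    have hψb : ∃ M : ℝ, ∀ x, ‖ψ x‖ ≤ M := by
      refine ⟨n * (n:ℝ) ^ (s-2), fun x => ?_⟩
      by_cases hx : x ∈ E n
      · simp only [ψ, indicator_of_mem hx]
        rw [norm_mul, RCLike.norm_conj, Complex.norm_real, Real.norm_of_nonneg (by positivity)]
        have := hb n x hx
        have := Real.rpow_le_rpow (norm_nonneg _) this (by linarith : 0 ≤ s - 2)
        gcongr
      · simp only [ψ, indicator_of_notMem hx, norm_zero]; positivity
    have hψ0 : ∀ x ∉ E n, ψ x = 0 := fun x hx => indicator_of_notMem hx _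
    have hk := hK n ψ hψm hψb hψ0
    have hpow : ∀ x, ‖w x‖ * (‖w x‖ * ‖w x‖ ^ (s-2)) = ‖w x‖ ^ s := by
      intro x
      by_cases h : ‖w x‖ = 0
      · rw [h, zero_mul, Real.zero_rpow hs.pos.ne']
      · have hp : 0 < ‖w x‖ := lt_of_le_of_ne (norm_nonneg _) (Ne.symm h)
        rw [mul_comm ‖w x‖ (‖w x‖ ^ (s-2)), ← Real.rpow_add_one hp.ne', mul_comm, ← Real.rpow_add_one hp.ne']
        congr 1; ring
    have h1 : ∫ x, w x * ψ x = ((∫ x in E n, ‖w x‖ ^ s : ℝ) : ℂ) := by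
      rw [← integral_complex_ofReal, ← integral_indicator (hE n)]
      refine integral_congr_ae (Eventually.of_forall fun x => ?_)
      by_cases hx : x ∈ E n
      · simp only [ψ, indicator_of_mem hx]
        rw [← mul_assoc, Complex.mul_conj, Complex.normSq_eq_norm_sq, ← hpow]
        push_cast; ring
      · simp only [ψ, indicator_of_notMem hx, mul_zero]
    have h2 : ‖∫ x, w x * ψ x‖ₑ = X := by
      rw [h1, ← ofReal_norm, Complex.norm_real, Real.norm_of_nonneg (integral_nonneg fun x => by positivity),
        integral_eq_lintegral_of_nonneg_ae (Eventually.of_forall fun x => by positivity)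
          (hw.norm.pow_const _).aestronglyMeasurable]
      have : ∫⁻ x in E n, ENNReal.ofReal (‖w x‖ ^ s) = X := by
        refine lintegral_congr fun x => ?_
        rw [← ENNReal.ofReal_rpow_of_nonneg (norm_nonneg _) hs.nonneg, ofReal_norm]
      rw [this, ENNReal.ofReal_toReal hXfin.ne]
    have h3 : LpN d s' ψ = X ^ (1/s') := by
      rw [LpN_eq hs.symm.pos, hX, ← lintegral_indicator (hE n)]
      congr 1
      refine lintegral_congr fun x => ?_
      by_cases hx : x ∈ E n
      · simp only [ψ, indicator_of_mem hx]
        rw [enorm_mul, RCLike.enorm_conj]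
        have : ‖((‖w x‖ ^ (s - 2) : ℝ) : ℂ)‖ₑ = ‖w x‖ₑ ^ (s-2) := by
          rw [← ofReal_norm, Complex.norm_real, Real.norm_of_nonneg (by positivity),
            ← ENNReal.ofReal_rpow_of_nonneg (norm_nonneg _) (by linarith), ofReal_norm]
        rw [this]
        have : ‖w x‖ₑ * ‖w x‖ₑ ^ (s-2) = ‖w x‖ₑ ^ (s-1) := by
          conv_lhs => rw [← ENNReal.rpow_one ‖w x‖ₑ, ← ENNReal.rpow_mul, one_mul]
          rw [← ENNReal.rpow_add_of_nonneg _ _ zero_le_one (by linarith)]; congr 1; ring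
        rw [this, ← ENNReal.rpow_mul, hs.sub_one_mul_conj]
      · simp only [ψ, indicator_of_notMem hx, enorm_zero]
        rw [ENNReal.zero_rpow_of_pos hs.symm.pos]
    rw [h2, h3] at hk
    by_cases hX0 : X = 0
    · rw [hX0, ENNReal.zero_rpow_of_pos (by have := hs.pos; positivity)]; exact zero_le
    have hne : X ^ (1/s') ≠ 0 := by
      intro h
      rw [ENNReal.rpow_eq_zero_iff_of_pos (by have := hs.symm.pos; positivity)] at h
      exact hX0 h
    have hnt : X ^ (1/s') ≠ ⊤ := ENNReal.rpow_ne_top_of_nonneg (by have := hs.symm.pos; positivity) hXfin.ne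
    have : X = X ^ (1/s) * X ^ (1/s') := by
      rw [← ENNReal.rpow_add _ _ hX0 hXfin.ne]
      have := hs.inv_add_inv_eq_one
      rw [one_div, one_div, this, ENNReal.rpow_one]
    have hk : X ^ (1/s) * X ^ (1/s') ≤ K * X ^ (1/s') := this ▸ hk
    exact (ENNReal.mul_le_mul_iff_left hne hnt).1 hk
  rw [LpN_eq hs.pos]
  have : ∫⁻ x, ‖w x‖ₑ ^ s = ⨆ n, ∫⁻ x in E n, ‖w x‖ₑ ^ s := by
    rw [← setLIntegral_iUnion_of_directed _ (hmono.directed_le)]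
    rw [← lintegral_indicator (MeasurableSet.iUnion hE)]
    refine lintegral_congr fun x => ?_
    by_cases hx : x ∈ ⋃ n, E n
    · rw [indicator_of_mem hx]
    · rw [indicator_of_notMem hx, h0 x hx, enorm_zero, ENNReal.zero_rpow_of_pos hs.pos]
  rw [this]
  have hpos : 0 ≤ 1/s := by have := hs.pos; positivity
  rw [one_div, ← ENNReal.le_rpow_inv_iff (by have := hs.pos; positivity), inv_inv]
  refine iSup_le fun n => ?_
  rw [← ENNReal.rpow_inv_le_iff hs.pos, ← one_div]
  exact key n

lemma lint_bdd {d : ℕ} {E : Set (Rd d)} (hE : MeasurableSet E) (hfin : volume E < ⊤) {ψ : Rd d → ℂ} (hm : Measurable ψ)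
    {M : ℝ} (hM : ∀ x, ‖ψ x‖ ≤ M) (h0 : ∀ x ∉ E, ψ x = 0) : Integrable ψ ∧ ∫⁻ x, ‖ψ x‖ₑ ^ 2 < ⊤ := by
  have hI : Integrable ψ := by
    have h := (Measure.integrableOn_of_bounded (s := E) (M := M) hfin.ne hm.aestronglyMeasurable
      (Eventually.of_forall fun x => hM x))
    refine (integrableOn_iff_integrable_of_support_subset ?_).1 h
    intro x hx; by_contra hc; exact hx (h0 x hc)
  refine ⟨hI, ?_⟩
  calc ∫⁻ x, ‖ψ x‖ₑ ^ 2 ≤ ∫⁻ x, ENNReal.ofReal M * ‖ψ x‖ₑ := by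
        refine lintegral_mono fun x => ?_
        rw [sq]; refine mul_le_mul_left ?_ _
        rw [← ofReal_norm]; exact ENNReal.ofReal_le_ofReal (hM x)
    _ < ⊤ := by
        rw [lintegral_const_mul' _ _ (by simp)]
        exact ENNReal.mul_lt_top (by simp) hI.2

lemma LpN_two_sq {d : ℕ} (f : Rd d → ℂ) : LpN d 2 f = (∫⁻ x, ‖f x‖ₑ ^ 2) ^ ((1:ℝ)/2) := by
  rw [LpN_eq two_pos]; simp

lemma plancherel_LpN {d : ℕ} {φ : Rd d → ℂ} (hφ : Integrable φ) : LpN d 2 (FT d φ) ≤ LpN d 2 φ := by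
  rw [LpN_two_sq, LpN_two_sq]
  exact ENNReal.rpow_le_rpow (plancherel_le hφ) (by norm_num)

lemma sgroup_L2 {d : ℕ} {t : ℝ} (ht : t ≠ 0) {φ : Rd d → ℂ} (hφ : Integrable φ) :
    LpN d 2 (sgroup d t φ) ≤ LpN d 2 φ := by
  by_cases hφ2 : ∫⁻ x, ‖φ x‖ₑ ^ 2 < ⊤
  swap
  · rw [LpN_two_sq φ]
    simp only [not_lt, top_le_iff] at hφ2
    rw [hφ2, ENNReal.top_rpow_of_pos (by norm_num)]; exact le_top
  have hc := sgroup_cont ht hφ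
  have h22 : (2:ℝ).HolderConjugate 2 := by constructor <;> norm_num
  have hEm : ∀ n : ℕ, MeasurableSet (Metric.closedBall (0 : Rd d) n ∩ {x | ‖sgroup d t φ x‖ ≤ n}) := fun n =>
    measurableSet_closedBall.inter (measurableSet_le hc.measurable.norm measurable_const)
  have hEf : ∀ n : ℕ, volume (Metric.closedBall (0 : Rd d) n ∩ {x | ‖sgroup d t φ x‖ ≤ n}) < ⊤ := fun n =>
    (measure_mono inter_subset_left).trans_lt (isCompact_closedBall _ _).measure_lt_top
  refine selfdual h22 le_rfl hc.measurable (E := fun n : ℕ => Metric.closedBall 0 n ∩ {x | ‖sgroup d t φ x‖ ≤ n})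
    hEm ?_ hEf ?_ ?_ ?_
  · intro n m hnm x hx
    have : (n:ℝ) ≤ m := by exact_mod_cast hnm
    exact ⟨Metric.closedBall_subset_closedBall this hx.1, le_trans (show _ ≤ _ from hx.2) this⟩
  · intro n x hx; exact hx.2
  · intro x hx
    exfalso; apply hx
    obtain ⟨n, hn⟩ := exists_nat_ge (max ‖x‖ ‖sgroup d t φ x‖)
    refine mem_iUnion.2 ⟨n, ?_, (le_max_right _ _).trans hn⟩
    simpa using (le_max_left _ _).trans hn
  · rintro n ψ hψm ⟨M, hM⟩ hψ0
    obtain ⟨hψI, hψ2⟩ := lint_bdd (hEm n) (hEf n) hψm hM hψ0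
    have : ∫ x, sgroup d t φ x * ψ x = ∫ x, ψ x * sgroup d t φ x := by simp only [mul_comm]
    rw [this, star ht hψI hφ hψ2 hφ2]
    refine (enorm_integral_le_lintegral_enorm _).trans ?_
    have e : ∀ ξ : Rd d, ‖Complex.exp (((-(4 * π ^ 2 * t * ‖ξ‖ ^ 2) : ℝ) : ℂ) * Complex.I) * (FT d ψ (-ξ) * FT d φ ξ)‖ₑ =
        ‖FT d ψ (-ξ) * FT d φ ξ‖ₑ := by
      intro ξ
      rw [enorm_mul, ← ofReal_norm, norm_exp_ofReal_I, ENNReal.ofReal_one, one_mul]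
    simp only [e]
    have hneg : LpN d 2 (fun ξ => FT d ψ (-ξ)) = LpN d 2 (FT d ψ) := by
      rw [LpN_two_sq, LpN_two_sq, lintegral_neg_eq_self (fun ξ => ‖FT d ψ ξ‖ₑ ^ 2)]
    refine (holder_LpN h22 ((FT_aesm hψI).comp_measurable measurable_neg).aestronglyMeasurable (FT_aesm hφ).aestronglyMeasurable).trans ?_
    change LpN d 2 (fun ξ => FT d ψ (-ξ)) * _ ≤ _
    rw [hneg, mul_comm]
    exact mul_le_mul' (plancherel_LpN hφ) (plancherel_LpN hψI)
end

noncomputable section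
open MeasureTheory Real Filter Topology Set
open scoped ENNReal NNReal ComplexConjugate

lemma sgroup_congr {d : ℕ} {t : ℝ} (ht : t ≠ 0) {φ ψ : Rd d → ℂ} (h : φ =ᵐ[volume] ψ) :
    sgroup d t φ = sgroup d t ψ := by
  ext x
  rw [sgroup_eq ht, sgroup_eq ht]
  refine integral_congr_ae ?_
  filter_upwards [h] with y hy
  rw [hy]

lemma sgroup_add {d : ℕ} {t : ℝ} (ht : t ≠ 0) {φ ψ : Rd d → ℂ} (hφ : Integrable φ) (hψ : Integrable ψ) (x : Rd d) :
    sgroup d t (fun y => φ y + ψ y) x = sgroup d t φ x + sgroup d t ψ x := by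
  rw [sgroup_eq ht, sgroup_eq ht, sgroup_eq ht]
  have hb : ∀ φ : Rd d → ℂ, Integrable φ → Integrable fun y => kz d (t * Complex.I) (x - y) * φ y := by
    intro φ hφ
    exact hφ.bdd_mul (c := Adis d t) ((kz_cont _).comp (by fun_prop)).aestronglyMeasurable
      (Eventually.of_forall fun y => kz_bound' ht _)
  rw [← integral_add (hb φ hφ) (hb ψ hψ)]
  simp only [mul_add]

lemma Adis_pos {d : ℕ} {t : ℝ} (ht : t ≠ 0) : 0 < Adis d t := by
  have := abs_pos.2 ht
  unfold Adis; positivity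

/-- distributional estimate -/
lemma disp_level {d : ℕ} {t : ℝ} (ht : t ≠ 0) {r : ℝ} (hr : 2 < r) {F : Rd d → ℂ} (hF : Integrable F)
    (hFm : Measurable F) {m : ℝ} (hm0 : 0 < m) (hm : ∫⁻ x, ‖F x‖ₑ ^ (r/(r-1)) = ENNReal.ofReal m) {s : ℝ} (hs : 0 < s) :
    volume {x | s < ‖sgroup d t F x‖} ≤ ENNReal.ofReal (4 / s^2) *
      ∫⁻ x, ({y : ℝ | y ≤ (2 * Adis d t * m / s) ^ (r-1)}).indicator (fun y => ENNReal.ofReal y ^ 2) ‖F x‖ := by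
  have hA := Adis_pos (d := d) ht
  set A := Adis d t with hAd
  set γ : ℝ := (2 * A * m / s) ^ (r-1) with hγ
  have hγ0 : 0 < γ := by positivity
  have hS : MeasurableSet {x | ‖F x‖ ≤ γ} := measurableSet_le hFm.norm measurable_const
  let F1 : Rd d → ℂ := ({x | ‖F x‖ ≤ γ}ᶜ).indicator F
  let F2 : Rd d → ℂ := ({x | ‖F x‖ ≤ γ}).indicator F
  have h1 : Integrable F1 := hF.indicator hS.compl
  have h2 : Integrable F2 := hF.indicator hS
  have hsum : F = fun x => F1 x + F2 x := by
    ext x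
    have := congrFun (indicator_compl_add_self {x | ‖F x‖ ≤ γ} F) x
    exact this.symm
  have hr1 : 0 < r - 1 := by linarith
  have hb1 : ∀ x, ‖sgroup d t F1 x‖ ≤ s / 2 := by
    intro x
    have hl : ∫⁻ y, ‖F1 y‖ₑ ≤ ENNReal.ofReal (γ ^ (1 - r/(r-1))) * ENNReal.ofReal m := by
      rw [← hm, ← lintegral_const_mul _ (hFm.enorm.pow_const _)]
      refine lintegral_mono fun y => ?_
      by_cases hy : ‖F y‖ ≤ γ
      · have : F1 y = 0 := indicator_of_notMem (by simpa using hy) _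
        rw [this, enorm_zero]; exact zero_le
      · have : F1 y = F y := indicator_of_mem (by simpa using hy) _
        rw [this]
        push Not at hy
        have hy0 : 0 < ‖F y‖ := hγ0.trans hy
        rw [← ofReal_norm, ENNReal.ofReal_rpow_of_pos hy0, ← ENNReal.ofReal_mul (by positivity)]
        refine ENNReal.ofReal_le_ofReal ?_
        have hle : ‖F y‖ ^ (1 - r/(r-1)) ≤ γ ^ (1 - r/(r-1)) := by
          refine Real.rpow_le_rpow_of_nonpos hγ0 hy.le ?_
          rw [sub_nonpos, le_div_iff₀ hr1]; linarith
        calc ‖F y‖ = ‖F y‖ ^ (1 - r/(r-1)) * ‖F y‖ ^ (r/(r-1)) := by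
              rw [← Real.rpow_add hy0]; simp
          _ ≤ _ := by gcongr
    have := (sgroup_bound ht F1 x).trans (mul_le_mul_right hl _)
    rw [← ENNReal.ofReal_mul (by positivity), ← ENNReal.ofReal_mul hA.le, ← ofReal_norm,
      ENNReal.ofReal_le_ofReal_iff (by positivity)] at this
    refine this.trans (le_of_eq ?_)
    have e : γ ^ (1 - r/(r-1)) = s / (2 * A * m) := by
      rw [hγ, ← Real.rpow_mul (by positivity)]
      have : (r-1) * (1 - r/(r-1)) = -1 := by field_simp; ring
      rw [this, Real.rpow_neg_one, inv_div]
    change A * (γ ^ (1 - r/(r-1)) * m) = _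
    rw [e]; field_simp
  have hsub : {x | s < ‖sgroup d t F x‖} ⊆ {x | ENNReal.ofReal (s^2/4) ≤ ‖sgroup d t F2 x‖ₑ ^ 2} := by
    intro x hx
    have hx' : s < ‖sgroup d t F x‖ := hx
    have hadd : sgroup d t F x = sgroup d t F1 x + sgroup d t F2 x := by
      conv_lhs => rw [hsum]
      exact sgroup_add ht h1 h2 x
    rw [hadd] at hx'
    have h3 := norm_add_le (sgroup d t F1 x) (sgroup d t F2 x)
    have h4 := hb1 x
    change ENNReal.ofReal (s^2/4) ≤ ‖sgroup d t F2 x‖ₑ ^ 2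
    rw [← ofReal_norm, ← ENNReal.ofReal_pow (norm_nonneg _)]
    refine ENNReal.ofReal_le_ofReal ?_
    have : s / 2 ≤ ‖sgroup d t F2 x‖ := by linarith
    nlinarith
  have hmark := mul_meas_ge_le_lintegral (μ := volume) ((sgroup_cont ht h2).measurable.enorm.pow_const 2) (ENNReal.ofReal (s^2/4))
  have hL2 : ∫⁻ x, ‖sgroup d t F2 x‖ₑ ^ 2 ≤ ∫⁻ x, ‖F2 x‖ₑ ^ 2 := by
    have := sgroup_L2 ht h2
    rw [LpN_two_sq, LpN_two_sq] at this
    exact (ENNReal.rpow_le_rpow_iff (by norm_num)).1 this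
  have hF2 : ∫⁻ x, ‖F2 x‖ₑ ^ 2 = ∫⁻ x, ({y : ℝ | y ≤ γ}).indicator (fun y => ENNReal.ofReal y ^ 2) ‖F x‖ := by
    refine lintegral_congr fun x => ?_
    by_cases hx : ‖F x‖ ≤ γ
    · have : F2 x = F x := indicator_of_mem (by simpa using hx) _
      rw [this, indicator_of_mem (show ‖F x‖ ∈ {y : ℝ | y ≤ γ} from hx), ofReal_norm]
    · have : F2 x = 0 := indicator_of_notMem (by simpa using hx) _
      rw [this, indicator_of_notMem (show ‖F x‖ ∉ {y : ℝ | y ≤ γ} from hx)]; simp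
  rw [← hF2]
  have hpos : ENNReal.ofReal (s^2/4) ≠ 0 := by simp; positivity
  calc volume {x | s < ‖sgroup d t F x‖} ≤ volume {x | ENNReal.ofReal (s^2/4) ≤ ‖sgroup d t F2 x‖ₑ ^ 2} := measure_mono hsub
    _ = ENNReal.ofReal (4/s^2) * (ENNReal.ofReal (s^2/4) * volume {x | ENNReal.ofReal (s^2/4) ≤ ‖sgroup d t F2 x‖ₑ ^ 2}) := by
        rw [← mul_assoc, ← ENNReal.ofReal_mul (by positivity)]
        have : 4 / s^2 * (s^2/4) = 1 := by field_simp
        rw [this, ENNReal.ofReal_one, one_mul]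
    _ ≤ _ := mul_le_mul_right (hmark.trans hL2) _

/-- constant of the interpolated dispersive bound (r-th power) -/
def Cr (r : ℝ) : ℝ := 4 * r / (r - 2) * 2 ^ (r-2)

lemma disp_pow {d : ℕ} {t : ℝ} (ht : t ≠ 0) {r : ℝ} (hr : 2 < r) {F : Rd d → ℂ} (hF : Integrable F)
    (hFm : Measurable F) {m : ℝ} (hm0 : 0 < m) (hm : ∫⁻ x, ‖F x‖ₑ ^ (r/(r-1)) = ENNReal.ofReal m) :
    ∫⁻ x, ‖sgroup d t F x‖ₑ ^ r ≤ ENNReal.ofReal (Cr r * Adis d t ^ (r-2) * m ^ (r-1)) := by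
  have hA := Adis_pos (d := d) ht
  set A := Adis d t with hAd
  have hr0 : 0 < r := by linarith
  have hr1 : 0 < r - 1 := by linarith
  have hr2 : 0 < r - 2 := by linarith
  have hlc := lintegral_rpow_eq_lintegral_meas_lt_mul volume (f := fun x => ‖sgroup d t F x‖)
    (Eventually.of_forall fun x => norm_nonneg _) (sgroup_cont ht hF).measurable.norm.aemeasurable hr0
  have e0 : ∫⁻ x, ‖sgroup d t F x‖ₑ ^ r = ∫⁻ x, ENNReal.ofReal (‖sgroup d t F x‖ ^ r) := by
    refine lintegral_congr fun x => ?_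
    rw [← ofReal_norm, ENNReal.ofReal_rpow_of_nonneg (norm_nonneg _) hr0.le]
  rw [e0, hlc]
  let S : Set (ℝ × Rd d) := {z | ‖F z.2‖ ≤ (2 * A * m / z.1) ^ (r-1)}
  have hS : MeasurableSet S := by
    refine measurableSet_le (hFm.norm.comp measurable_snd) ?_
    exact (measurable_const.div measurable_fst).pow_const _
  let U : ℝ → Rd d → ℝ≥0∞ := fun s x => S.indicator (fun z => ENNReal.ofReal 4 * (ENNReal.ofReal ‖F z.2‖ ^ 2 * ENNReal.ofReal z.1 ^ (r-3))) (s, x)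
  have hU : Measurable (Function.uncurry U) := by
    refine Measurable.indicator ?_ hS
    refine Measurable.const_mul ?_ _
    exact ((ENNReal.measurable_ofReal.comp (hFm.norm.comp measurable_snd)).pow_const 2).mul
      ((ENNReal.measurable_ofReal.comp measurable_fst).pow_const _)
  have hstep : ∫⁻ s in Ioi (0:ℝ), volume {x | s < ‖sgroup d t F x‖} * ENNReal.ofReal (s ^ (r-1)) ≤
      ∫⁻ s in Ioi (0:ℝ), ∫⁻ x, U s x := by
    refine setLIntegral_mono' measurableSet_Ioi fun s hs => ?_
    have hs0 : 0 < s := hs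
    refine (mul_le_mul_left (disp_level ht hr hF hFm hm0 hm hs0) _).trans (le_of_eq ?_)
    rw [mul_comm, ← mul_assoc, ← lintegral_const_mul]
    · refine lintegral_congr fun x => ?_
      by_cases hx : ‖F x‖ ≤ (2 * A * m / s) ^ (r-1)
      · rw [indicator_of_mem (show ‖F x‖ ∈ {y : ℝ | y ≤ (2 * A * m / s) ^ (r-1)} from hx)]
        simp only [U]
        rw [indicator_of_mem (show (s, x) ∈ S from hx)]
        simp only
        rw [mul_comm (ENNReal.ofReal ‖F x‖ ^ 2), ← mul_assoc, ENNReal.ofReal_rpow_of_pos hs0,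
          ← ENNReal.ofReal_mul (by positivity), ← ENNReal.ofReal_mul (by positivity)]
        congr 2
        have : s ^ (r-1) = s ^ (r-3) * s^2 := by
          rw [← Real.rpow_natCast s 2, ← Real.rpow_add hs0]; congr 1; push_cast; ring
        rw [this]; field_simp
      · rw [indicator_of_notMem (show ‖F x‖ ∉ {y : ℝ | y ≤ (2 * A * m / s) ^ (r-1)} from hx)]
        simp only [U]
        rw [indicator_of_notMem (show (s, x) ∉ S from hx), mul_zero]
    · refine Measurable.comp (g := ({y : ℝ | y ≤ (2 * A * m / s) ^ (r-1)}).indicator (fun y => ENNReal.ofReal y ^ 2)) ?_ hFm.norm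
      exact (ENNReal.measurable_ofReal.pow_const 2).indicator (measurableSet_le measurable_id measurable_const)
  have hinner : ∀ x, ∫⁻ s in Ioi (0:ℝ), U s x ≤ ENNReal.ofReal (4 * (2 * A * m) ^ (r-2) / (r-2)) * ‖F x‖ₑ ^ (r/(r-1)) := by
    intro x
    by_cases hx : ‖F x‖ = 0
    · have : ∀ s, U s x = 0 := by
        intro s
        refine indicator_apply_eq_zero.2 fun _ => ?_
        simp only
        rw [hx]; simp
      simp [this]
    have hx0 : 0 < ‖F x‖ := lt_of_le_of_ne (norm_nonneg _) (Ne.symm hx)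
    set L : ℝ := 2 * A * m * ‖F x‖ ^ (-(1/(r-1))) with hL
    have hL0 : 0 < L := by positivity
    calc ∫⁻ s in Ioi (0:ℝ), U s x ≤ ∫⁻ s in Ioi (0:ℝ), (Ioc 0 L).indicator (fun s => (ENNReal.ofReal 4 * ENNReal.ofReal ‖F x‖ ^ 2) * ENNReal.ofReal s ^ (r-3)) s := by
          refine setLIntegral_mono' measurableSet_Ioi fun s hs => ?_
          have hs0 : 0 < s := hs
          by_cases hsx : ‖F x‖ ≤ (2 * A * m / s) ^ (r-1)
          · have hsL : s ≤ L := by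
              have h1 : ‖F x‖ ^ (1/(r-1)) ≤ 2 * A * m / s := by
                have := Real.rpow_le_rpow (norm_nonneg _) hsx (by positivity : 0 ≤ 1/(r-1))
                rwa [← Real.rpow_mul (by positivity), mul_one_div_cancel hr1.ne', Real.rpow_one] at this
              rw [hL, Real.rpow_neg (norm_nonneg _), ← div_eq_mul_inv, le_div_iff₀ (by positivity)]
              rw [le_div_iff₀ hs0] at h1
              linarith
            simp only [U]
            rw [indicator_of_mem (show (s, x) ∈ S from hsx), indicator_of_mem (show s ∈ Ioc 0 L from ⟨hs0, hsL⟩), mul_assoc]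
          · simp only [U]
            rw [indicator_of_notMem (show (s, x) ∉ S from hsx)]; exact zero_le
      _ ≤ ∫⁻ s, (Ioc 0 L).indicator (fun s => (ENNReal.ofReal 4 * ENNReal.ofReal ‖F x‖ ^ 2) * ENNReal.ofReal s ^ (r-3)) s :=
          setLIntegral_le_lintegral _ _
      _ = (ENNReal.ofReal 4 * ENNReal.ofReal ‖F x‖ ^ 2) * ENNReal.ofReal (L ^ (r-3+1) / (r-3+1)) := by
          rw [lintegral_indicator measurableSet_Ioc, lintegral_const_mul _ (ENNReal.measurable_ofReal.pow_const _),
            lint_rpow_zero (by linarith) hL0.le]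
      _ = ENNReal.ofReal (4 * (2 * A * m) ^ (r-2) / (r-2)) * ‖F x‖ₑ ^ (r/(r-1)) := by
          have e3 : r - 3 + 1 = r - 2 := by ring
          rw [e3, ← ofReal_norm, ENNReal.ofReal_rpow_of_pos hx0, ← ENNReal.ofReal_pow (norm_nonneg _),
            ← ENNReal.ofReal_mul (by positivity), ← ENNReal.ofReal_mul (by positivity), ← ENNReal.ofReal_mul (by positivity)]
          congr 1
          rw [hL, Real.mul_rpow (by positivity) (by positivity), ← Real.rpow_mul (norm_nonneg _)]
          have : ‖F x‖ ^ (r/(r-1)) = ‖F x‖ ^ 2 * ‖F x‖ ^ (-(1/(r-1)) * (r-2)) := by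
            rw [← Real.rpow_natCast ‖F x‖ 2, ← Real.rpow_add hx0]
            congr 1; push_cast; field_simp; ring
          rw [this]; ring
  calc ENNReal.ofReal r * _ ≤ ENNReal.ofReal r * ∫⁻ s in Ioi (0:ℝ), ∫⁻ x, U s x := mul_le_mul_right hstep _
    _ = ENNReal.ofReal r * ∫⁻ x, ∫⁻ s in Ioi (0:ℝ), U s x := by
        rw [lintegral_lintegral_swap hU.aemeasurable]
    _ ≤ ENNReal.ofReal r * ∫⁻ x, ENNReal.ofReal (4 * (2 * A * m) ^ (r-2) / (r-2)) * ‖F x‖ₑ ^ (r/(r-1)) :=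
        mul_le_mul_right (lintegral_mono hinner) _
    _ = _ := by
        rw [lintegral_const_mul _ (hFm.enorm.pow_const _), hm, ← ENNReal.ofReal_mul (by positivity), ← ENNReal.ofReal_mul (by positivity)]
        congr 1
        rw [Cr, Real.mul_rpow (by positivity) (by positivity), Real.mul_rpow (by positivity) (by positivity)]
        have : m ^ (r-1) = m ^ (r-2) * m := by
          rw [← Real.rpow_add_one hm0.ne']; congr 1; ring
        rw [this]; field_simp

/-- constant of the interpolated dispersive bound -/
def Cdis (r : ℝ) : ℝ≥0∞ := ENNReal.ofReal (Cr r) ^ (1/r)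

lemma Cr_pos {r : ℝ} (hr : 2 < r) : 0 < Cr r := by
  have : 0 < r - 2 := by linarith
  have : 0 < r := by linarith
  unfold Cr; positivity

lemma Cdis_ne_top {r : ℝ} (hr : 2 < r) : Cdis r ≠ ⊤ :=
  ENNReal.rpow_ne_top_of_nonneg (by have : 0 < r := by linarith
                                    positivity) (by simp)

lemma disp {d : ℕ} {t : ℝ} (ht : t ≠ 0) {r a : ℝ} (hr : 2 < r) (ha : a = d * (1/2 - 1/r)) (ha0 : 0 ≤ a) {F : Rd d → ℂ} (hF : Integrable F) :
    LpN d r (sgroup d t F) ≤ Cdis r * fker a t * LpN d (r/(r-1)) F := by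
  have hr0 : 0 < r := by linarith
  have hr1 : 0 < r - 1 := by linarith
  have hr2 : 0 < r - 2 := by linarith
  have hC := Cr_pos hr
  have hA := Adis_pos (d := d) ht
  have htp := abs_pos.2 ht
  -- replace by measurable version
  obtain ⟨G, hGm, hFG⟩ := hF.1
  have hG : Integrable G := hF.congr hFG
  rw [sgroup_congr ht hFG]
  have hLp : LpN d (r/(r-1)) F = LpN d (r/(r-1)) G := eLpNorm_congr_ae hFG
  rw [hLp, LpN_eq hr0, LpN_eq (by positivity)]
  set M := ∫⁻ x, ‖G x‖ₑ ^ (r/(r-1)) with hM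
  have hf0 : fker a t ≠ 0 := by
    rw [fker, ENNReal.ofReal_rpow_of_pos htp]; simp; positivity
  have hC0 : Cdis r ≠ 0 := by
    rw [Cdis, ENNReal.ofReal_rpow_of_pos hC]; simp; positivity
  by_cases hMt : M = ⊤
  · rw [hMt, ENNReal.top_rpow_of_pos (by positivity), ENNReal.mul_top (mul_ne_zero hC0 hf0)]; exact le_top
  by_cases hM0 : M = 0
  · have : G =ᵐ[volume] 0 := by
      rw [hM, lintegral_eq_zero_iff (hGm.measurable.enorm.pow_const _)] at hM0
      filter_upwards [hM0] with x hx
      have : ‖G x‖ₑ ^ (r/(r-1)) = 0 := hx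
      rw [ENNReal.rpow_eq_zero_iff_of_pos (by positivity)] at this
      simpa using this
    rw [sgroup_congr ht this]
    have hz : ∀ x, sgroup d t (0 : Rd d → ℂ) x = 0 := by
      intro x; rw [sgroup_eq ht]; simp
    simp only [hz, enorm_zero, ENNReal.zero_rpow_of_pos hr0, lintegral_zero]
    rw [ENNReal.zero_rpow_of_pos (by positivity)]; exact zero_le
  have hm0 : 0 < M.toReal := ENNReal.toReal_pos hM0 hMt
  have key := disp_pow ht hr hG hGm.measurable hm0 (ENNReal.ofReal_toReal hMt).symm
  have k2 := ENNReal.rpow_le_rpow key (by positivity : 0 ≤ 1/r)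
  refine k2.trans ?_
  rw [ENNReal.ofReal_rpow_of_nonneg (by positivity) (by positivity), Cdis, fker, ENNReal.ofReal_rpow_of_pos hC,
    ENNReal.ofReal_rpow_of_pos htp]
  conv_rhs => rw [← ENNReal.ofReal_toReal hMt]
  rw [ENNReal.ofReal_rpow_of_pos hm0, ← ENNReal.ofReal_mul (by positivity), ← ENNReal.ofReal_mul (by positivity)]
  refine ENNReal.ofReal_le_ofReal ?_
  rw [Real.mul_rpow (by positivity) (by positivity), Real.mul_rpow (by positivity) (by positivity),
    ← Real.rpow_mul hA.le, ← Real.rpow_mul hm0.le]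
  have e1 : (r-1) * (1/r) = 1/(r/(r-1)) := by field_simp
  rw [e1]
  have e2 : Adis d t ^ ((r-2)*(1/r)) ≤ |t| ^ (-a) := by
    rw [Adis, ← Real.rpow_mul (by positivity)]
    have : (-(d:ℝ)/2) * ((r-2)*(1/r)) = -a := by rw [ha]; field_simp
    rw [this]
    refine Real.rpow_le_rpow_of_nonpos htp ?_ (by linarith)
    have := Real.pi_gt_three
    nlinarith
  gcongr
end

noncomputable section
open MeasureTheory Real Filter Topology Set
open scoped ENNReal NNReal ComplexConjugate

/-- kernel form of the group, for all times -/
def Uk (d : ℕ) (φ : Rd d → ℂ) (z : ℝ × Rd d) : ℂ := ∫ y, kz d (z.1 * Complex.I) (z.2 - y) * φ y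

lemma Uk_eq {d : ℕ} {t : ℝ} (ht : t ≠ 0) (φ : Rd d → ℂ) (x : Rd d) : Uk d φ (t, x) = sgroup d t φ x :=
  (sgroup_eq ht φ x).symm

lemma kz_meas {d : ℕ} : Measurable fun z : ℂ × Rd d => kz d z.1 z.2 := by
  unfold kz
  refine Measurable.mul ?_ ?_
  · exact ((measurable_const.div (measurable_const.mul measurable_fst))).pow_const _
  · refine Complex.continuous_exp.measurable.comp ?_
    refine Measurable.div ?_ (by fun_prop)
    exact (Complex.measurable_ofReal.comp (by fun_prop)).neg

lemma Uk_meas {d : ℕ} {φ : Rd d → ℂ} (hφ : Measurable φ) : Measurable (Uk d φ) := by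
  have h : Measurable fun w : (ℝ × Rd d) × Rd d => kz d (w.1.1 * Complex.I) (w.1.2 - w.2) * φ w.2 := by
    refine Measurable.mul ?_ (hφ.comp measurable_snd)
    refine kz_meas.comp (f := fun w : (ℝ × Rd d) × Rd d => ((w.1.1 * Complex.I : ℂ), w.1.2 - w.2)) ?_
    refine Measurable.prodMk ?_ (by fun_prop)
    exact (Complex.measurable_ofReal.comp (by fun_prop)).mul_const _
  exact (h.stronglyMeasurable.integral_prod_right').measurable

/-- modulated space-time Fourier transform -/
def Vf (d : ℕ) (F : ℝ × Rd d → ℂ) (z : ℝ × Rd d) : ℂ :=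
  Complex.exp (((-(4 * π ^ 2 * z.1 * ‖z.2‖ ^ 2) : ℝ) : ℂ) * Complex.I) * FT d (fun x => F (z.1, x)) (-z.2)

lemma Vf_meas {d : ℕ} {F : ℝ × Rd d → ℂ} (hF : Measurable F) : Measurable (Vf d F) := by
  unfold Vf
  refine Measurable.mul (Continuous.measurable (by fun_prop)) ?_
  have h : Measurable fun w : (ℝ × Rd d) × Rd d => Complex.exp (-((2 * π * inner ℝ w.2 (-w.1.2) : ℝ) : ℂ) * Complex.I) * F (w.1.1, w.2) := by
    refine Measurable.mul (Continuous.measurable (by fun_prop)) (hF.comp (by fun_prop))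
  exact (h.stronglyMeasurable.integral_prod_right').measurable

lemma Vf_enorm {d : ℕ} (F : ℝ × Rd d → ℂ) (z : ℝ × Rd d) : ‖Vf d F z‖ₑ = ‖FT d (fun x => F (z.1, x)) (-z.2)‖ₑ := by
  rw [Vf, enorm_mul, ← ofReal_norm, norm_exp_ofReal_I, ENNReal.ofReal_one, one_mul]

lemma memLp_two_of_lint {α : Type*} [MeasurableSpace α] {μ : Measure α} {f : α → ℂ} (hf : AEStronglyMeasurable f μ)
    (h : ∫⁻ x, ‖f x‖ₑ ^ 2 ∂μ < ⊤) : MemLp f 2 μ := by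
  refine ⟨hf, ?_⟩
  rw [eLpNorm_lt_top_iff_lintegral_rpow_enorm_lt_top (by simp) (by simp)]
  simpa using h

lemma lint_bdd_le {d : ℕ} {B : Set (Rd d)} (hB : MeasurableSet B) {ψ : Rd d → ℂ}
    {M : ℝ} (hM : ∀ x, ‖ψ x‖ ≤ M) (h0 : ∀ x ∉ B, ψ x = 0) : ∫⁻ x, ‖ψ x‖ₑ ^ 2 ≤ ENNReal.ofReal M ^ 2 * volume B := by
  calc ∫⁻ x, ‖ψ x‖ₑ ^ 2 ≤ ∫⁻ x, B.indicator (fun _ => ENNReal.ofReal M ^ 2) x := by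
        refine lintegral_mono fun x => ?_
        by_cases hx : x ∈ B
        · rw [indicator_of_mem hx, ← ofReal_norm]
          exact pow_le_pow_left' (ENNReal.ofReal_le_ofReal (hM x)) 2
        · rw [indicator_of_notMem hx, h0 x hx]; simp
    _ = _ := by rw [lintegral_indicator hB, setLIntegral_const]

lemma lint_FT_neg {d : ℕ} (f : Rd d → ℂ) : ∫⁻ ξ, ‖FT d f (-ξ)‖ₑ ^ 2 = ∫⁻ ξ, ‖FT d f ξ‖ₑ ^ 2 :=
  lintegral_neg_eq_self (fun ξ => ‖FT d f ξ‖ₑ ^ 2)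

lemma ttstar {d : ℕ} {r a : ℝ} (hr : 2 < r) (ha : a = d * (1/2 - 1/r)) (ha0 : 0 ≤ a) {φ : Rd d → ℂ} (hφ : Integrable φ)
    (hφ2 : ∫⁻ x, ‖φ x‖ₑ ^ 2 < ⊤) {F : ℝ × Rd d → ℂ} (hF : Measurable F) {B : Set (Rd d)} (hB : MeasurableSet B)
    (hBf : volume B < ⊤) {M : ℝ} (hM : ∀ z, ‖F z‖ ≤ M) (h0 : ∀ t, ∀ x ∉ B, F (t, x) = 0) {T : Set ℝ} (hTf : volume T < ⊤) :
    ‖∫ t in T, ∫ x, F (t, x) * Uk d φ (t, x)‖ₑ ≤ LpN d 2 φ * (Cdis r *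
      ∫⁻ t in T, ∫⁻ s in T, fker a (t - s) * (LpN d (r/(r-1)) (fun x => F (t, x)) * LpN d (r/(r-1)) (fun x => F (s, x)))) ^ ((1:ℝ)/2) := by
  set ν : Measure ℝ := volume.restrict T with hν
  have hνf : IsFiniteMeasure ν := ⟨by rw [hν, Measure.restrict_apply_univ]; exact hTf⟩
  have hFt : ∀ t, Measurable fun x => F (t, x) := fun t => hF.comp (by fun_prop)
  have hFI : ∀ t, Integrable fun x => F (t, x) := fun t => (lint_bdd hB hBf (hFt t) (fun x => hM _) (h0 t)).1
  have hF2 : ∀ t, ∫⁻ x, ‖F (t, x)‖ₑ ^ 2 < ⊤ := fun t => (lint_bdd hB hBf (hFt t) (fun x => hM _) (h0 t)).2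
  have hF2' : ∀ t, ∫⁻ x, ‖F (t, x)‖ₑ ^ 2 ≤ ENNReal.ofReal M ^ 2 * volume B := fun t => lint_bdd_le hB (fun x => hM _) (h0 t)
  have hCF : ENNReal.ofReal M ^ 2 * volume B < ⊤ := ENNReal.mul_lt_top (by simp) hBf
  have hV := Vf_meas hF
  have hVξ : ∀ t, ∫⁻ ξ, ‖Vf d F (t, ξ)‖ₑ ^ 2 ≤ ENNReal.ofReal M ^ 2 * volume B := by
    intro t
    simp only [Vf_enorm]
    rw [lint_FT_neg]
    exact (plancherel_le (hFI t)).trans (hF2' t)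
  have hV2 : ∫⁻ z, ‖Vf d F z‖ₑ ^ 2 ∂(ν.prod volume) < ⊤ := by
    rw [lintegral_prod _ (hV.enorm.pow_const 2).aemeasurable]
    calc _ ≤ ∫⁻ t, ENNReal.ofReal M ^ 2 * volume B ∂ν := lintegral_mono hVξ
      _ < ⊤ := by rw [lintegral_const]; exact ENNReal.mul_lt_top hCF (measure_lt_top _ _)
  have hVL : MemLp (Vf d F) 2 (ν.prod volume) := memLp_two_of_lint hV.aestronglyMeasurable hV2
  set H : Rd d → ℂ := fun ξ => ∫ t, Vf d F (t, ξ) ∂ν with hH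
  have hHm : StronglyMeasurable H := hV.stronglyMeasurable.integral_prod_left'
  -- Step A
  have hνae : ∀ᵐ t ∂ν, t ≠ 0 := by
    rw [hν]
    refine ae_restrict_of_ae ?_
    exact Measure.ae_ne volume 0
  have stepA : ∫ t, (∫ x, F (t, x) * Uk d φ (t, x)) ∂ν = ∫ ξ, H ξ * FT d φ ξ := by
    have h1 : ∫ t, (∫ x, F (t, x) * Uk d φ (t, x)) ∂ν = ∫ t, (∫ ξ, Vf d F (t, ξ) * FT d φ ξ) ∂ν := by
      refine integral_congr_ae ?_
      filter_upwards [hνae] with t ht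
      simp only [Uk_eq ht, Vf]
      rw [star ht (hFI t) hφ (hF2 t) hφ2]
      simp only [mul_assoc]
    have hφL : MemLp (fun z : ℝ × Rd d => FT d φ z.2) 2 (ν.prod volume) := by
      refine memLp_two_of_lint ((FT_aesm hφ).comp_measurable measurable_snd).aestronglyMeasurable ?_
      have hm : Measurable fun z : ℝ × Rd d => ‖FT d φ z.2‖ₑ ^ 2 :=
        (((FT_aesm hφ).measurable.comp measurable_snd).enorm.pow_const 2)
      rw [lintegral_prod _ hm.aemeasurable]
      simp only [lintegral_const]
      exact ENNReal.mul_lt_top ((plancherel_le hφ).trans_lt hφ2) (measure_lt_top _ _)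
    have hIntg : Integrable (Function.uncurry fun t ξ => Vf d F (t, ξ) * FT d φ ξ) (ν.prod volume) :=
      MemLp.integrable_mul hVL hφL
    rw [h1, integral_integral_swap hIntg]
    simp only [hH, integral_mul_const]
  -- Step B
  have stepB : ∫⁻ ξ, ‖H ξ‖ₑ ^ 2 ≤ Cdis r * ∫⁻ t, ∫⁻ s, fker a (t - s) *
      (LpN d (r/(r-1)) (fun x => F (t, x)) * LpN d (r/(r-1)) (fun x => F (s, x))) ∂ν ∂ν := by
    let Ψ : Rd d → ℝ × ℝ → ℂ := fun ξ p => Vf d F (p.1, ξ) * conj (Vf d F (p.2, ξ))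
    have hmes : ∀ pr : ℝ × ℝ → ℝ, Measurable pr → Measurable fun w : Rd d × (ℝ × ℝ) => Vf d F (pr w.2, w.1) := by
      intro pr hpr
      exact hV.comp (by fun_prop)
    have hL1 : MemLp (fun w : Rd d × (ℝ × ℝ) => Vf d F (w.2.1, w.1)) 2 (volume.prod (ν.prod ν)) := by
      refine memLp_two_of_lint (hmes Prod.fst measurable_fst).aestronglyMeasurable ?_
      rw [lintegral_prod_symm _ ((hmes Prod.fst measurable_fst).enorm.pow_const 2).aemeasurable]
      calc _ ≤ ∫⁻ p, ENNReal.ofReal M ^ 2 * volume B ∂(ν.prod ν) := lintegral_mono fun p => hVξ _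
        _ < ⊤ := by rw [lintegral_const]; exact ENNReal.mul_lt_top hCF (measure_lt_top _ _)
    have hL2 : MemLp (fun w : Rd d × (ℝ × ℝ) => conj (Vf d F (w.2.2, w.1))) 2 (volume.prod (ν.prod ν)) := by
      refine memLp_two_of_lint (Complex.continuous_conj.measurable.comp (hmes Prod.snd measurable_snd)).aestronglyMeasurable ?_
      simp only [RCLike.enorm_conj]
      rw [lintegral_prod_symm _ ((hmes Prod.snd measurable_snd).enorm.pow_const 2).aemeasurable]
      calc _ ≤ ∫⁻ p, ENNReal.ofReal M ^ 2 * volume B ∂(ν.prod ν) := lintegral_mono fun p => hVξ _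
        _ < ⊤ := by rw [lintegral_const]; exact ENNReal.mul_lt_top hCF (measure_lt_top _ _)
    have hIntg : Integrable (Function.uncurry Ψ) (volume.prod (ν.prod ν)) := MemLp.integrable_mul hL1 hL2
    have hΨH : ∀ ξ, ∫ p, Ψ ξ p ∂(ν.prod ν) = ((‖H ξ‖ ^ 2 : ℝ) : ℂ) := by
      intro ξ
      simp only [Ψ]
      rw [integral_prod_mul (fun t => Vf d F (t, ξ)) (fun s => conj (Vf d F (s, ξ))), integral_conj, Complex.mul_conj,
        Complex.normSq_eq_norm_sq]
    have hHint : Integrable fun ξ => ‖H ξ‖ ^ 2 := by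
      have := hIntg.integral_prod_left
      simp only [Function.uncurry_apply_pair, hΨH] at this
      have h2 := this.norm
      refine h2.congr (Eventually.of_forall fun ξ => ?_)
      simp only [Complex.norm_real]
      rw [Real.norm_of_nonneg (by positivity)]
    have e1 : ∫⁻ ξ, ‖H ξ‖ₑ ^ 2 = ‖∫ ξ, ∫ p, Ψ ξ p ∂(ν.prod ν)‖ₑ := by
      simp only [hΨH]
      rw [integral_complex_ofReal, ← ofReal_norm, Complex.norm_real,
        Real.norm_of_nonneg (integral_nonneg fun ξ => by positivity),
        ofReal_integral_eq_lintegral_ofReal hHint (Eventually.of_forall fun ξ => by positivity)]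
      refine lintegral_congr fun ξ => ?_
      rw [ENNReal.ofReal_pow (norm_nonneg _), ofReal_norm]
    rw [e1, integral_integral_swap hIntg]
    refine (enorm_integral_le_lintegral_enorm _).trans ?_
    have hm1 : AEMeasurable (fun p : ℝ × ℝ => ‖∫ ξ, Ψ ξ p‖ₑ) (ν.prod ν) :=
      hIntg.swap.aestronglyMeasurable.integral_prod_right'.enorm
    refine (lintegral_prod _ hm1).trans_le ?_
    rw [← lintegral_const_mul' _ _ (Cdis_ne_top hr)]
    refine lintegral_mono fun t => ?_
    rw [← lintegral_const_mul' _ _ (Cdis_ne_top hr)]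
    have hts : ∀ᵐ s ∂ν, s ≠ t := by
      rw [hν]
      exact ae_restrict_of_ae (Measure.ae_ne volume t)
    refine lintegral_mono_ae ?_
    filter_upwards [hts] with s hs
    have hts0 : t - s ≠ 0 := sub_ne_zero.2 (Ne.symm hs)
    have hcI : Integrable fun x => conj (F (s, x)) := (LinearIsometryEquiv.integrable_comp_iff Complex.conjLIE).2 (hFI s)
    have hc2 : ∫⁻ x, ‖conj (F (s, x))‖ₑ ^ 2 < ⊤ := by simpa only [RCLike.enorm_conj] using hF2 s
    have hc : LpN d (r/(r-1)) (fun x => conj (F (s, x))) = LpN d (r/(r-1)) (fun x => F (s, x)) :=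
      eLpNorm_congr_norm_ae (Eventually.of_forall fun x => RCLike.norm_conj _)
    have e2 : ∫ ξ, Ψ ξ (t, s) = ∫ x, F (t, x) * sgroup d (t - s) (fun x => conj (F (s, x))) x := by
      rw [star hts0 (hFI t) hcI (hF2 t) hc2]
      refine integral_congr_ae (Eventually.of_forall fun ξ => ?_)
      have hcj := FT_conj (fun x => F (s, x)) (-ξ)
      rw [neg_neg] at hcj
      simp only [Ψ, Vf, map_mul, hcj, ← Complex.exp_conj, Complex.conj_ofReal, Complex.conj_I]
      have : Complex.exp (((-(4 * π ^ 2 * (t - s) * ‖ξ‖ ^ 2) : ℝ) : ℂ) * Complex.I) =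
        Complex.exp (((-(4 * π ^ 2 * t * ‖ξ‖ ^ 2) : ℝ) : ℂ) * Complex.I) * Complex.exp (((-(4 * π ^ 2 * s * ‖ξ‖ ^ 2) : ℝ) : ℂ) * -Complex.I) := by
        rw [← Complex.exp_add]; congr 1; push_cast; ring
      rw [this]; ring
    rw [e2]
    have hconj : (r/(r-1)).HolderConjugate r := (Real.HolderConjugate.conjExponent (by linarith)).symm
    refine (enorm_integral_le_lintegral_enorm _).trans ?_
    refine (holder_LpN hconj (hFt t).aestronglyMeasurable (sgroup_cont hts0 hcI).aestronglyMeasurable).trans ?_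
    have hd := disp hts0 hr ha ha0 hcI
    rw [hc] at hd
    refine (mul_le_mul_right hd _).trans (le_of_eq ?_)
    ring
  rw [stepA]
  have h22 : (2:ℝ).HolderConjugate 2 := by constructor <;> norm_num
  refine (enorm_integral_le_lintegral_enorm _).trans ?_
  refine (holder_LpN h22 hHm.aestronglyMeasurable (FT_aesm hφ).aestronglyMeasurable).trans ?_
  rw [mul_comm]
  refine mul_le_mul' (plancherel_LpN hφ) ?_
  rw [LpN_two_sq]
  exact ENNReal.rpow_le_rpow stepB (by norm_num)
end

noncomputable section
open MeasureTheory Real Filter Topology Set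
open scoped ENNReal NNReal ComplexConjugate

lemma core_n {d : ℕ} {r a : ℝ} (hr : 2 < r) (ha : a = d * (1/2 - 1/r)) (ha0 : 0 ≤ a) {φ : Rd d → ℂ} (hφ : Integrable φ)
    (hφm : Measurable φ)
    (hφ2 : ∫⁻ x, ‖φ x‖ₑ ^ 2 < ⊤) {W : ℝ × Rd d → ℂ} (hW : Measurable W) {B : Set (Rd d)} (hB : MeasurableSet B)
    (hBf : volume B < ⊤) {n : ℝ} (hn : 0 < n) (hM : ∀ z, ‖W z‖ ≤ n) (h0 : ∀ t, ∀ x ∉ B, W (t, x) = 0)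
    (hWU : ∀ z, conj (W z) * Uk d φ z = conj (W z) * W z)
    {T : Set ℝ} (hT : MeasurableSet T) (hTf : volume T < ⊤)
    (hTN : ∀ t ∈ T, ENNReal.ofReal (1/n) ≤ LpN d r (fun x => W (t, x)))
    {h : ℝ → ℝ} (hh : Measurable h) (hh0 : ∀ t, 0 ≤ h t) (hhn : ∀ t, h t ≤ n) :
    ∫⁻ t in T, ENNReal.ofReal (h t) * LpN d r (fun x => W (t, x)) ≤ LpN d 2 φ * (Cdis r *
      Bform a (fun t => ENNReal.ofReal (h t)) (fun t => ENNReal.ofReal (h t))) ^ ((1:ℝ)/2) := by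
  have hr0 : 0 < r := by linarith
  have hr1 : 0 < r - 1 := by linarith
  have hconj : (r/(r-1)).HolderConjugate r := (Real.HolderConjugate.conjExponent (by linarith)).symm
  -- the r-th power integral
  let J : ℝ → ℝ≥0∞ := fun t => ∫⁻ x, ‖W (t, x)‖ₑ ^ r
  have hJm : Measurable J := (hW.enorm.pow_const r).lintegral_prod_right'
  have hNJ : ∀ t, LpN d r (fun x => W (t, x)) = J t ^ (1/r) := fun t => LpN_eq hr0 _
  have hJb : ∀ t, J t ≤ ENNReal.ofReal n ^ r * volume B := by
    intro t
    calc J t ≤ ∫⁻ x, B.indicator (fun _ => ENNReal.ofReal n ^ r) x := by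
          refine lintegral_mono fun x => ?_
          by_cases hx : x ∈ B
          · rw [indicator_of_mem hx, ← ofReal_norm]
            exact ENNReal.rpow_le_rpow (ENNReal.ofReal_le_ofReal (hM _)) hr0.le
          · simp only [indicator_of_notMem hx, h0 t x hx]; simp [hr0]
      _ = _ := by rw [lintegral_indicator hB, setLIntegral_const]
  have hJtop : ENNReal.ofReal n ^ r * volume B < ⊤ := ENNReal.mul_lt_top (ENNReal.rpow_lt_top_of_nonneg hr0.le (by simp)) hBf
  have hJf : ∀ t, J t ≠ ⊤ := fun t => ((hJb t).trans_lt hJtop).ne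
  let N : ℝ → ℝ := fun t => (J t ^ (1/r)).toReal
  have hNm : Measurable N := (hJm.pow_const _).ennreal_toReal
  have hNtop : ∀ t, J t ^ (1/r) ≠ ⊤ := fun t => ENNReal.rpow_ne_top_of_nonneg (by positivity) (hJf t)
  have hN0 : ∀ t, 0 ≤ N t := fun t => ENNReal.toReal_nonneg
  have hNof : ∀ t, ENNReal.ofReal (N t) = J t ^ (1/r) := fun t => ENNReal.ofReal_toReal (hNtop t)
  have hNr : ∀ t, ENNReal.ofReal (N t) ^ r = J t := by
    intro t
    rw [hNof, ← ENNReal.rpow_mul, one_div_mul_cancel hr0.ne', ENNReal.rpow_one]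
  have hNT : ∀ t ∈ T, 1/n ≤ N t := by
    intro t ht
    have := hTN t ht
    rw [hNJ, ← hNof] at this
    exact (ENNReal.ofReal_le_ofReal_iff (hN0 t)).1 this
  let c : ℝ → ℝ := T.indicator fun t => h t * N t ^ (-(r-1))
  have hcm : Measurable c := (hh.mul (hNm.pow_const _)).indicator hT
  have hc0 : ∀ t, 0 ≤ c t := fun t => indicator_nonneg (fun t _ => mul_nonneg (hh0 t) (Real.rpow_nonneg (hN0 t) _)) t
  have hcb : ∀ t, c t ≤ n * (1/n) ^ (-(r-1)) := by
    intro t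
    by_cases ht : t ∈ T
    · simp only [c, indicator_of_mem ht]
      refine mul_le_mul (hhn t) ?_ (Real.rpow_nonneg (hN0 t) _) hn.le
      exact Real.rpow_le_rpow_of_nonpos (by positivity) (hNT t ht) (by linarith)
    · simp only [c, indicator_of_notMem ht]; positivity
  let F : ℝ × Rd d → ℂ := fun z => ((c z.1 * ‖W z‖ ^ (r - 2) : ℝ) : ℂ) * conj (W z)
  have hF : Measurable F := by
    refine Measurable.mul (Complex.measurable_ofReal.comp ?_) (Complex.continuous_conj.measurable.comp hW)
    exact (hcm.comp measurable_fst).mul (hW.norm.pow_const _)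
  have hFn : ∀ z, ‖F z‖ = c z.1 * ‖W z‖ ^ (r - 1) := by
    intro z
    simp only [F, norm_mul, Complex.norm_real, RCLike.norm_conj]
    rw [Real.norm_of_nonneg (hc0 _), Real.norm_of_nonneg (by positivity), mul_assoc]
    congr 1
    rw [show r - 1 = (r - 2) + 1 by ring, Real.rpow_add_one' (norm_nonneg _) (by linarith)]
  have hFM : ∀ z, ‖F z‖ ≤ (n * (1/n) ^ (-(r-1))) * n ^ (r - 1) := by
    intro z
    rw [hFn]
    refine mul_le_mul (hcb _) (Real.rpow_le_rpow (norm_nonneg _) (hM z) hr1.le) (by positivity) (by positivity)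
  have hF0 : ∀ t, ∀ x ∉ B, F (t, x) = 0 := by
    intro t x hx; simp [F, h0 t x hx]
  have key := ttstar hr ha ha0 hφ hφ2 hF hB hBf hFM hF0 hTf
  -- norms of F
  have hFL : ∀ t ∈ T, LpN d (r/(r-1)) (fun x => F (t, x)) = ENNReal.ofReal (h t) := by
    intro t ht
    have hNpos : 0 < N t := lt_of_lt_of_le (by positivity) (hNT t ht)
    rw [LpN_eq (by positivity)]
    have h1 : ∀ x, ‖F (t, x)‖ₑ ^ (r/(r-1)) = ENNReal.ofReal (c t) ^ (r/(r-1)) * ‖W (t, x)‖ₑ ^ r := by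
      intro x
      rw [← ofReal_norm, hFn, ENNReal.ofReal_mul (hc0 t), ENNReal.mul_rpow_of_nonneg _ _ (by positivity),
        ← ENNReal.ofReal_rpow_of_nonneg (norm_nonneg _) hr1.le, ofReal_norm, ← ENNReal.rpow_mul]
      congr 2; field_simp
    simp only [h1]
    have hm : Measurable fun x => ‖W (t, x)‖ₑ ^ r := (hW.comp (by fun_prop)).enorm.pow_const r
    rw [lintegral_const_mul _ hm]
    change (_ * J t) ^ _ = _
    rw [← hNr, ENNReal.mul_rpow_of_nonneg _ _ (by positivity), ← ENNReal.rpow_mul, ← ENNReal.rpow_mul,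
      show r/(r-1) * (1/(r/(r-1))) = 1 by field_simp, show r * (1/(r/(r-1))) = r - 1 by field_simp, ENNReal.rpow_one,
      ENNReal.ofReal_rpow_of_nonneg (hN0 t) hr1.le, ← ENNReal.ofReal_mul (hc0 t)]
    congr 1
    simp only [c, indicator_of_mem ht]
    rw [mul_assoc, ← Real.rpow_add hNpos]; simp
  have hFU : ∀ t ∈ T, ∫ x, F (t, x) * Uk d φ (t, x) = ((h t * N t : ℝ) : ℂ) := by
    intro t ht
    have hNpos : 0 < N t := lt_of_lt_of_le (by positivity) (hNT t ht)
    have h1 : ∀ x, F (t, x) * Uk d φ (t, x) = ((c t * ‖W (t, x)‖ ^ r : ℝ) : ℂ) := by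
      intro x
      simp only [F]
      rw [mul_assoc, hWU, mul_comm (conj _), Complex.mul_conj, Complex.normSq_eq_norm_sq, ← Complex.ofReal_mul, mul_assoc]
      congr 2
      rw [show r = (r - 2) + (2:ℕ) by norm_num, Real.rpow_add_natCast' (norm_nonneg _) (by norm_num; linarith)]
      norm_num
    simp only [h1]
    have hm : Measurable fun x => ‖W (t, x)‖ ^ r := (hW.comp (by fun_prop)).norm.pow_const r
    rw [integral_complex_ofReal, integral_const_mul, integral_eq_lintegral_of_nonneg_ae
      (Eventually.of_forall fun x => by positivity) hm.aestronglyMeasurable]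
    have h2 : ∀ x, ENNReal.ofReal (‖W (t, x)‖ ^ r) = ‖W (t, x)‖ₑ ^ r := by
      intro x
      rw [← ENNReal.ofReal_rpow_of_nonneg (norm_nonneg _) hr0.le, ofReal_norm]
    simp only [h2]
    change ((c t * (J t).toReal : ℝ) : ℂ) = _
    rw [← hNr, ENNReal.ofReal_rpow_of_nonneg (hN0 t) hr0.le, ENNReal.toReal_ofReal (by positivity)]
    congr 1
    simp only [c, indicator_of_mem ht]
    rw [mul_assoc, ← Real.rpow_add hNpos]; simp
  have e1 : ∫ t in T, ∫ x, F (t, x) * Uk d φ (t, x) = ((∫ t in T, h t * N t : ℝ) : ℂ) := by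
    rw [← integral_complex_ofReal]
    exact setIntegral_congr_fun hT hFU
  have hIntg : IntegrableOn (fun t => h t * N t) T := by
    refine IntegrableOn.of_bound hTf (hh.mul hNm).aestronglyMeasurable (n * ((ENNReal.ofReal n ^ r * volume B) ^ (1/r)).toReal) ?_
    refine Eventually.of_forall fun t => ?_
    rw [Real.norm_of_nonneg (mul_nonneg (hh0 t) (hN0 t))]
    refine mul_le_mul (hhn t) ?_ (hN0 t) hn.le
    exact ENNReal.toReal_mono (ENNReal.rpow_ne_top_of_nonneg (by positivity) hJtop.ne) (ENNReal.rpow_le_rpow (hJb t) (by positivity))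
  have e2 : ‖∫ t in T, ∫ x, F (t, x) * Uk d φ (t, x)‖ₑ = ∫⁻ t in T, ENNReal.ofReal (h t) * LpN d r (fun x => W (t, x)) := by
    rw [e1, ← ofReal_norm, Complex.norm_real,
      Real.norm_of_nonneg (integral_nonneg fun t => mul_nonneg (hh0 t) (hN0 t)),
      ofReal_integral_eq_lintegral_ofReal hIntg (Eventually.of_forall fun t => mul_nonneg (hh0 t) (hN0 t))]
    refine lintegral_congr fun t => ?_
    rw [ENNReal.ofReal_mul (hh0 t), hNof, hNJ]
  rw [← e2]
  refine key.trans (mul_le_mul_right (ENNReal.rpow_le_rpow (mul_le_mul_right ?_ _) (by norm_num)) _)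
  calc _ = ∫⁻ t in T, ∫⁻ s in T, ENNReal.ofReal (h t) * (fker a (t - s) * ENNReal.ofReal (h s)) := by
        refine setLIntegral_congr_fun hT fun t ht => setLIntegral_congr_fun hT fun s hs => ?_
        rw [hFL t ht, hFL s hs]; ring
    _ ≤ _ := (setLIntegral_le_lintegral _ _).trans (lintegral_mono fun t => setLIntegral_le_lintegral _ _)

lemma Bform_mono {a : ℝ} {h h' g g' : ℝ → ℝ≥0∞} (hh : ∀ t, h t ≤ h' t) (hg : ∀ t, g t ≤ g' t) : Bform a h g ≤ Bform a h' g' := by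
  refine lintegral_mono fun t => lintegral_mono fun s => ?_
  exact mul_le_mul' (hh t) (mul_le_mul_right (hg s) _)

lemma core {d : ℕ} {r a : ℝ} (hr : 2 < r) (ha : a = d * (1/2 - 1/r)) (ha0 : 0 ≤ a) {φ : Rd d → ℂ} (hφ : Integrable φ)
    (hφm : Measurable φ)
    (hφ2 : ∫⁻ x, ‖φ x‖ₑ ^ 2 < ⊤) {h : ℝ → ℝ≥0∞} (hh : Measurable h) :
    ∫⁻ t, h t * LpN d r (fun x => Uk d φ (t, x)) ≤ LpN d 2 φ * (Cdis r * Bform a h h) ^ ((1:ℝ)/2) := by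
  have hr0 : 0 < r := by linarith
  have hU := Uk_meas hφm
  let E : ℕ → Set (ℝ × Rd d) := fun n => {z | ‖z.2‖ ≤ n ∧ ‖Uk d φ z‖ ≤ n}
  have hE : ∀ n, MeasurableSet (E n) := by
    intro n
    have h1 : MeasurableSet {z : ℝ × Rd d | ‖z.2‖ ≤ n} := measurableSet_le (by fun_prop) measurable_const
    have h2 : MeasurableSet {z : ℝ × Rd d | ‖Uk d φ z‖ ≤ n} := measurableSet_le hU.norm measurable_const
    exact h1.inter h2
  let W : ℕ → ℝ × Rd d → ℂ := fun n => (E n).indicator (Uk d φ)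
  have hW : ∀ n, Measurable (W n) := fun n => hU.indicator (hE n)
  let N : ℕ → ℝ → ℝ≥0∞ := fun n t => LpN d r (fun x => W n (t, x))
  have hNm : ∀ n, Measurable (N n) := by
    intro n
    have : N n = fun t => (∫⁻ x, ‖W n (t, x)‖ₑ ^ r) ^ (1/r) := funext fun t => LpN_eq hr0 _
    rw [this]
    exact (((hW n).enorm.pow_const r).lintegral_prod_right').pow_const _
  let T : ℕ → Set ℝ := fun n => {t | |t| ≤ n} ∩ {t | ENNReal.ofReal (1/((n:ℝ)+1)) ≤ N n t}
  have hT : ∀ n, MeasurableSet (T n) := fun n =>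
    (measurableSet_le (by fun_prop) measurable_const).inter (measurableSet_le measurable_const (hNm n))
  have hTf : ∀ n, volume (T n) < ⊤ := by
    intro n
    have hs : T n ⊆ Icc (-(n:ℝ)) n := fun t ht => abs_le.1 ht.1
    exact (measure_mono hs).trans_lt measure_Icc_lt_top
  let k : ℕ → ℝ → ℝ≥0∞ := fun n t => (T n).indicator (fun t => min (h t) n * N n t) t
  have hk : ∀ n, ∫⁻ t, k n t ≤ LpN d 2 φ * (Cdis r * Bform a h h) ^ ((1:ℝ)/2) := by
    intro n
    have hfin : ∀ t, min (h t) n ≠ ⊤ := fun t => ((min_le_right _ _).trans_lt (by simp)).ne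
    have := core_n (n := (n:ℝ)+1) (B := Metric.closedBall 0 n) (W := W n) (T := T n) (h := fun t => (min (h t) n).toReal)
      hr ha ha0 hφ hφm hφ2 (hW n) Metric.isClosed_closedBall.measurableSet
      (isCompact_closedBall _ _).measure_lt_top (by positivity) ?_ ?_ ?_ (hT n) (hTf n) ?_ ?_ ?_ ?_
    · simp only [ENNReal.ofReal_toReal (hfin _)] at this
      rw [lintegral_indicator (hT n)]
      refine this.trans (mul_le_mul_right (ENNReal.rpow_le_rpow (mul_le_mul_right ?_ _) (by norm_num)) _)
      exact Bform_mono (fun t => min_le_left _ _) (fun t => min_le_left _ _)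
    · intro z
      by_cases hz : z ∈ E n
      · simp only [W, indicator_of_mem hz]; linarith [hz.2]
      · simp only [W, indicator_of_notMem hz]; simp; positivity
    · intro t x hx
      refine indicator_of_notMem (fun hz => hx ?_) _
      simpa using hz.1
    · intro z
      by_cases hz : z ∈ E n
      · simp only [W, indicator_of_mem hz]
      · simp only [W, indicator_of_notMem hz]; simp
    · intro t ht; exact ht.2
    · exact (hh.min measurable_const).ennreal_toReal
    · intro t; exact ENNReal.toReal_nonneg
    · intro t
      have := ENNReal.toReal_mono (by simp) (min_le_right (h t) (n:ℝ≥0∞))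
      simp only [ENNReal.toReal_natCast] at this
      linarith
  have hkm : ∀ n, Measurable (k n) := fun n => ((hh.min measurable_const).mul (hNm n)).indicator (hT n)
  have hlim : ∀ t, Tendsto (fun n => N n t) atTop (𝓝 (LpN d r (fun x => Uk d φ (t, x)))) := by
    intro t
    have e : ∀ f : Rd d → ℂ, LpN d r f = (∫⁻ x, ‖f x‖ₑ ^ r) ^ (1/r) := fun f => LpN_eq hr0 f
    simp only [N, e]
    refine (ENNReal.continuous_rpow_const.tendsto _).comp ?_
    refine lintegral_tendsto_of_tendsto_of_monotone (fun n => ((hW n).comp (by fun_prop : Measurable fun x : Rd d => (t, x))).enorm.pow_const r |>.aemeasurable) ?_ ?_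
    · refine Eventually.of_forall fun x n m hnm => ?_
      refine ENNReal.rpow_le_rpow ?_ hr0.le
      simp only [W, enorm_indicator_eq_indicator_enorm]
      refine indicator_le_indicator_of_subset (fun z hz => ?_) (fun _ => zero_le) _
      have : (n:ℝ) ≤ m := by exact_mod_cast hnm
      exact ⟨hz.1.trans this, hz.2.trans this⟩
    · refine Eventually.of_forall fun x => ?_
      refine tendsto_const_nhds.congr' ?_
      filter_upwards [eventually_ge_atTop ⌈‖x‖⌉₊, eventually_ge_atTop ⌈‖Uk d φ (t, x)‖⌉₊] with n h1 h2
      have : (t, x) ∈ E n := ⟨Nat.ceil_le.1 h1, Nat.ceil_le.1 h2⟩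
      simp only [W, indicator_of_mem this]
  have hle : ∀ t, h t * LpN d r (fun x => Uk d φ (t, x)) ≤ liminf (fun n => k n t) atTop := by
    intro t
    by_cases h1 : h t = 0
    · simp [h1]
    by_cases h2 : LpN d r (fun x => Uk d φ (t, x)) = 0
    · simp [h2]
    have hmin : Tendsto (fun n : ℕ => min (h t) n) atTop (𝓝 (h t)) := by
      have := (tendsto_const_nhds (x := h t) (f := (atTop : Filter ℕ))).min ENNReal.tendsto_nat_nhds_top
      simpa using this
    have hprod := ENNReal.Tendsto.mul hmin (Or.inl h1) (hlim t) (Or.inl h2)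
    refine le_of_eq (Tendsto.liminf_eq (hprod.congr' ?_)).symm
    have hs : Tendsto (fun n : ℕ => ENNReal.ofReal (1/((n:ℝ)+1))) atTop (𝓝 0) := by
      have := (ENNReal.continuous_ofReal.tendsto 0).comp (tendsto_one_div_add_atTop_nhds_zero_nat (𝕜 := ℝ))
      simpa [Function.comp_def] using this
    filter_upwards [eventually_ge_atTop ⌈|t|⌉₊, hs.eventually_lt (hlim t) (pos_iff_ne_zero.2 h2)] with n h3 h4
    have : t ∈ T n := ⟨Nat.ceil_le.1 h3, h4.le⟩
    simp only [k, indicator_of_mem this]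
  calc _ ≤ ∫⁻ t, liminf (fun n => k n t) atTop := lintegral_mono hle
    _ ≤ liminf (fun n => ∫⁻ t, k n t) atTop := lintegral_liminf_le hkm
    _ ≤ _ := by
      refine liminf_le_of_le (by isBoundedDefault) fun b hb => ?_
      obtain ⟨n, hn⟩ := hb.exists
      exact hn.trans (hk n)

end

noncomputable section
open MeasureTheory Real Filter Topology Set
open scoped ENNReal NNReal ComplexConjugate

lemma core' {d : ℕ} {r a : ℝ} (hr : 2 < r) (ha : a = d * (1/2 - 1/r)) (ha0 : 0 ≤ a) {φ : Rd d → ℂ} (hφ : Integrable φ)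
    (hφ2 : ∫⁻ x, ‖φ x‖ₑ ^ 2 < ⊤) : ∃ N : ℝ → ℝ≥0∞, Measurable N ∧ (∀ t ≠ 0, LpN d r (sgroup d t φ) = N t) ∧
      ∀ h : ℝ → ℝ≥0∞, Measurable h → ∫⁻ t, h t * N t ≤ LpN d 2 φ * (Cdis r * Bform a h h) ^ ((1:ℝ)/2) := by
  have hr0 : 0 < r := by linarith
  let φ' := hφ.1.mk φ
  have hm : Measurable φ' := hφ.1.stronglyMeasurable_mk.measurable
  have he : φ =ᵐ[volume] φ' := hφ.1.ae_eq_mk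
  refine ⟨fun t => LpN d r (fun x => Uk d φ' (t, x)), ?_, ?_, ?_⟩
  · have e : ∀ f : Rd d → ℂ, LpN d r f = (∫⁻ x, ‖f x‖ₑ ^ r) ^ (1/r) := fun f => LpN_eq hr0 f
    simp only [e]
    exact (((Uk_meas hm).enorm.pow_const r).lintegral_prod_right').pow_const _
  · intro t ht
    simp only [Uk_eq ht]
    rw [sgroup_congr ht he]
  · intro h hh
    have h2 : ∫⁻ x, ‖φ' x‖ₑ ^ 2 < ⊤ := by
      have e : ∫⁻ x, ‖φ x‖ₑ ^ 2 = ∫⁻ x, ‖φ' x‖ₑ ^ 2 := by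
        refine lintegral_congr_ae ?_
        filter_upwards [he] with x hx
        rw [hx]
      rwa [← e]
    have := core hr ha ha0 (hφ.congr he) hm h2 hh
    rwa [show LpN d 2 φ = LpN d 2 φ' from eLpNorm_congr_ae he]

lemma majorant (I : Set ℝ) (g0 : ℝ → ℝ≥0∞) : ∃ g : ℝ → ℝ≥0∞, Measurable g ∧ (∀ t ∈ I, g0 t ≤ g t) ∧
    ∀ c : ℝ, 0 < c → volume {t | ENNReal.ofReal c < g t} ≤ volume {t ∈ I | ENNReal.ofReal c ≤ g0 t} := by
  let S : ℚ → Set ℝ := fun c => {t ∈ I | ENNReal.ofReal c ≤ g0 t}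
  refine ⟨fun t => ⨆ c : ℚ, (toMeasurable volume (S c)).indicator (fun _ => ENNReal.ofReal c) t, ?_, ?_, ?_⟩
  · exact Measurable.iSup fun c => measurable_const.indicator (measurableSet_toMeasurable _ _)
  · intro t ht
    by_contra hlt
    push Not at hlt
    obtain ⟨c, hc0, h1, h2⟩ := ENNReal.lt_iff_exists_rat_btwn.1 hlt
    have hmem : t ∈ toMeasurable volume (S c) := subset_toMeasurable _ _ ⟨ht, h2.le⟩
    have h3 := le_iSup (fun c : ℚ => (toMeasurable volume (S c)).indicator (fun _ => ENNReal.ofReal c) t) c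
    simp only [indicator_of_mem hmem] at h3
    exact absurd (lt_of_lt_of_le h1 h3) (lt_irrefl _)
  · intro c hc
    have hsub : {t | ENNReal.ofReal c < ⨆ c : ℚ, (toMeasurable volume (S c)).indicator (fun _ => ENNReal.ofReal c) t} ⊆
        ⋃ e : {e : ℚ // c < e}, toMeasurable volume (S e) := by
      intro t ht
      rw [Set.mem_ofPred_eq] at ht
      obtain ⟨e, he⟩ := lt_iSup_iff.1 ht
      have hmem : t ∈ toMeasurable volume (S e) := by
        by_contra hn
        rw [indicator_of_notMem hn] at he
        exact not_lt_bot he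
      rw [indicator_of_mem hmem] at he
      exact mem_iUnion.2 ⟨⟨e, (ENNReal.ofReal_lt_ofReal_iff').1 he |>.1⟩, hmem⟩
    refine (measure_mono hsub).trans ?_
    rw [measure_iUnion_toMeasurable]
    refine measure_mono (iUnion_subset fun e t ht => ⟨ht.1, le_trans (ENNReal.ofReal_le_ofReal e.2.le) ht.2⟩)

lemma duhamel_dual {d : ℕ} {s s' : ℝ} (hs : s.HolderConjugate s') (hs2 : 2 ≤ s) {μ : Measure ℝ} [SFinite μ]
    {F : ℝ → Rd d → ℂ} (hF : ∀ τ, Continuous (F τ)) {K : ℝ≥0∞}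
    (hK : ∀ ψ : Rd d → ℂ, Measurable ψ → (∃ M, ∀ x, ‖ψ x‖ ≤ M) → (∃ R : ℝ, ∀ x, R < ‖x‖ → ψ x = 0) →
      ∫⁻ τ, ‖∫ x, F τ x * ψ x‖ₑ ∂μ ≤ K * LpN d s' ψ) :
    LpN d s (fun x => ∫ τ, F τ x ∂μ) ≤ K := by
  let A : Set (Rd d) := {x | AEStronglyMeasurable (fun τ => F τ x) μ}
  have hA : IsClosed A := by
    refine IsSeqClosed.isClosed fun u x hu hx => ?_
    exact aestronglyMeasurable_of_tendsto_ae atTop hu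
      (Eventually.of_forall fun τ => ((hF τ).tendsto x).comp hx)
  have hAm := hA.measurableSet
  rcases A.eq_empty_or_nonempty with hAe | hAn
  · have : (fun x => ∫ τ, F τ x ∂μ) = fun _ => 0 := by
      funext x
      refine integral_non_aestronglyMeasurable fun hx => ?_
      have : x ∈ A := hx
      rw [hAe] at this; exact this
    rw [this]; simp [LpN]
  have : Nonempty A := hAn.to_subtype
  let u : ℕ → A := TopologicalSpace.denseSeq A
  have hu : ∀ n, AEStronglyMeasurable (fun τ => F τ (u n)) μ := fun n => (u n).2
  have hZ0 : ∀ᵐ τ ∂μ, ∀ n, F τ (u n) = (hu n).mk _ τ := ae_all_iff.2 fun n => (hu n).ae_eq_mk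
  let Z : Set ℝ := toMeasurable μ {τ | ¬ ∀ n, F τ (u n) = (hu n).mk _ τ}
  have hZm : MeasurableSet Z := measurableSet_toMeasurable _ _
  have hZ : μ Z = 0 := by rw [measure_toMeasurable]; exact hZ0
  have hZae : ∀ᵐ τ ∂μ, τ ∉ Z := measure_eq_zero_iff_ae_notMem.1 hZ
  let P : ℝ → A → ℂ := fun τ x => Zᶜ.indicator (fun τ => F τ x) τ
  have hPc : ∀ τ, Continuous (P τ) := by
    intro τ
    by_cases hτ : τ ∈ Zᶜ
    · simp only [P, indicator_of_mem hτ]; exact (hF τ).comp continuous_subtype_val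
    · simp only [P, indicator_of_notMem hτ]; exact continuous_const
  have hPu : ∀ n, Measurable fun τ => P τ (u n) := by
    intro n
    have : (fun τ => P τ (u n)) = Zᶜ.indicator ((hu n).mk _) := by
      funext τ
      by_cases hτ : τ ∈ Zᶜ
      · simp only [P, indicator_of_mem hτ]
        by_contra hne
        exact hτ (subset_toMeasurable _ _ fun hall => hne (hall n))
      · simp only [P, indicator_of_notMem hτ]
    rw [this]
    exact (hu n).stronglyMeasurable_mk.measurable.indicator hZm.compl
  have hPm : ∀ x, Measurable fun τ => P τ x := by
    intro x
    have hx : x ∈ closure (range u) := (TopologicalSpace.denseRange_denseSeq A) x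
    obtain ⟨v, hv, hvx⟩ := mem_closure_iff_seq_limit.1 hx
    refine measurable_of_tendsto_metrizable (f := fun n τ => P τ (v n)) (fun n => ?_)
      (tendsto_pi_nhds.2 fun τ => ((hPc τ).tendsto x).comp hvx)
    obtain ⟨m, hm⟩ := hv n
    rw [← hm]; exact hPu m
  have hPj : Measurable (Function.uncurry P) := by
    have h1 : StronglyMeasurable (Function.uncurry fun (x : A) (τ : ℝ) => P τ x) :=
      stronglyMeasurable_uncurry_of_continuous_of_stronglyMeasurable (fun τ => hPc τ) (fun x => (hPm x).stronglyMeasurable)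
    exact h1.measurable.comp measurable_swap
  classical
  let G : ℝ × Rd d → ℂ := fun p => if h : p.2 ∈ A then P p.1 ⟨p.2, h⟩ else 0
  have hG : Measurable G := by
    have hs : MeasurableSet {p : ℝ × Rd d | p.2 ∈ A} := measurable_snd hAm
    refine measurable_of_restrict_of_restrict_compl hs ?_ ?_
    · have : ({p : ℝ × Rd d | p.2 ∈ A}.domRestrict G) = fun p => Function.uncurry P (p.1.1, ⟨p.1.2, p.2⟩) := by
        funext p
        have hp : p.1.2 ∈ A := p.2
        simp only [domRestrict_apply, G, dif_pos hp, Function.uncurry_apply_pair]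
      rw [this]
      refine hPj.comp (Measurable.prodMk (measurable_fst.comp measurable_subtype_coe) ?_)
      exact Measurable.subtype_mk (measurable_snd.comp measurable_subtype_coe)
    · have : ({p : ℝ × Rd d | p.2 ∈ A}ᶜ.domRestrict G) = fun p => 0 := by
        funext p
        have hp : p.1.2 ∉ A := p.2
        simp only [domRestrict_apply, G, dif_neg hp]
      rw [this]; exact measurable_const
  have hGF : ∀ τ ∉ Z, ∀ x ∈ A, G (τ, x) = F τ x := by
    intro τ hτ x hx
    have : τ ∈ Zᶜ := hτ
    simp only [G, dif_pos hx, P, indicator_of_mem this]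
  have hw : (fun x => ∫ τ, F τ x ∂μ) = fun x => ∫ τ, G (τ, x) ∂μ := by
    funext x
    by_cases hx : x ∈ A
    · refine integral_congr_ae ?_
      filter_upwards [hZae] with τ hτ
      exact (hGF τ hτ x hx).symm
    · rw [integral_non_aestronglyMeasurable hx]
      simp [G, dif_neg hx]
  rw [hw]
  have hGs : Measurable fun p : Rd d × ℝ => G (p.2, p.1) := hG.comp measurable_swap
  let L : Rd d → ℝ≥0∞ := fun x => ∫⁻ τ, ‖G (τ, x)‖ₑ ∂μ
  have hL : Measurable L := hGs.enorm.lintegral_prod_right'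
  have hwm : Measurable fun x => ∫ τ, G (τ, x) ∂μ := hGs.stronglyMeasurable.integral_prod_right'.measurable
  let E : ℕ → Set (Rd d) := fun n => {x | x ∈ A} ∩ ({x | ‖x‖ ≤ n} ∩ {x | L x ≤ n})
  have hE : ∀ n, MeasurableSet (E n) := fun n => hAm.inter
    ((measurableSet_le (by fun_prop) measurable_const).inter (measurableSet_le hL measurable_const))
  refine selfdual hs hs2 hwm hE ?_ ?_ ?_ ?_ ?_
  · intro n m hnm x hx
    have h1 : (n:ℝ) ≤ m := by exact_mod_cast hnm
    have h2 : (n:ℝ≥0∞) ≤ m := by exact_mod_cast hnm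
    exact ⟨hx.1, le_trans hx.2.1 h1, le_trans hx.2.2 h2⟩
  · intro n
    have hsub : E n ⊆ Metric.closedBall 0 n := fun x hx => by simpa using hx.2.1
    exact (measure_mono hsub).trans_lt (isCompact_closedBall _ _).measure_lt_top
  · intro n x hx
    have h1 := (enorm_integral_le_lintegral_enorm (μ := μ) fun τ => G (τ, x)).trans hx.2.2
    rw [← ofReal_norm, ← ENNReal.ofReal_natCast] at h1
    exact (ENNReal.ofReal_le_ofReal_iff (by positivity)).1 h1
  · intro x hx
    by_cases hxA : x ∈ A
    · by_cases hxL : L x = ⊤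
      · refine integral_undef fun hi => ?_
        exact hi.2.ne hxL
      · exfalso
        obtain ⟨n, hn⟩ := exists_nat_ge (max ‖x‖ (L x).toReal)
        refine hx (mem_iUnion.2 ⟨n, hxA, (le_max_left _ _).trans hn, ?_⟩)
        have := (le_max_right _ _).trans hn
        change L x ≤ n
        rw [← ENNReal.ofReal_toReal hxL, ← ENNReal.ofReal_natCast]
        exact ENNReal.ofReal_le_ofReal this
    · simp [G, dif_neg hxA]
  · intro n ψ hψ hψM hψ0
    have hEf : volume (E n) < ⊤ := by
      have hsub : E n ⊆ Metric.closedBall 0 n := fun x hx => by simpa using hx.2.1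
      exact (measure_mono hsub).trans_lt (isCompact_closedBall _ _).measure_lt_top
    have hψI : Integrable ψ := by
      obtain ⟨M, hM⟩ := hψM
      exact (lint_bdd (hE n) hEf hψ hM hψ0).1
    have hIntg : Integrable (Function.uncurry fun x τ => G (τ, x) * ψ x) (volume.prod μ) := by
      have hm : Measurable (Function.uncurry fun x τ => G (τ, x) * ψ x) := hGs.mul (hψ.comp measurable_fst)
      refine ⟨hm.aestronglyMeasurable, ?_⟩
      rw [HasFiniteIntegral, lintegral_prod _ hm.enorm.aemeasurable]
      calc _ ≤ ∫⁻ x, n * ‖ψ x‖ₑ := by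
            refine lintegral_mono fun x => ?_
            simp only [Function.uncurry_apply_pair, enorm_mul]
            rw [lintegral_mul_const' _ _ enorm_ne_top]
            by_cases hx : x ∈ E n
            · exact mul_le_mul_left hx.2.2 _
            · simp [hψ0 x hx]
        _ < ⊤ := by
            rw [lintegral_const_mul _ hψ.enorm]
            exact ENNReal.mul_lt_top (by simp) hψI.2
    have e1 : ∫ x, (∫ τ, G (τ, x) ∂μ) * ψ x = ∫ τ, (∫ x, G (τ, x) * ψ x) ∂μ := by
      rw [← integral_integral_swap hIntg]
      simp only [integral_mul_const]
    rw [e1]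
    refine (enorm_integral_le_lintegral_enorm _).trans ?_
    have e2 : ∫⁻ τ, ‖∫ x, G (τ, x) * ψ x‖ₑ ∂μ = ∫⁻ τ, ‖∫ x, F τ x * ψ x‖ₑ ∂μ := by
      refine lintegral_congr_ae ?_
      filter_upwards [hZae] with τ hτ
      congr 2
      funext x
      by_cases hx : x ∈ E n
      · rw [hGF τ hτ x hx.1]
      · rw [hψ0 x hx]; simp
    rw [e2]
    refine hK ψ hψ hψM ⟨n, fun x hx => hψ0 x fun hxE => ?_⟩
    exact absurd hxE.2.1 (not_le.2 hx)

end

noncomputable section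
open MeasureTheory Real Filter Topology Set
open scoped ENNReal NNReal ComplexConjugate

lemma sgroup_symm {d : ℕ} {t : ℝ} (ht : t ≠ 0) {f ψ : Rd d → ℂ} (hf : Integrable f) (hψ : Integrable ψ) :
    ∫ x, sgroup d t f x * ψ x = ∫ y, f y * sgroup d t ψ y := by
  have hIntg : Integrable (Function.uncurry fun x y : Rd d => kz d (t * Complex.I) (x - y) * (ψ x * f y))
      ((volume : Measure (Rd d)).prod volume) := by
    refine (hψ.mul_prod hf).bdd_mul (c := Adis d t) ((kz_cont _).comp (by fun_prop)).aestronglyMeasurable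
      (Eventually.of_forall fun y => kz_bound' ht _)
  have e1 : ∀ x, sgroup d t f x * ψ x = ∫ y, kz d (t * Complex.I) (x - y) * (ψ x * f y) := by
    intro x
    rw [sgroup_eq ht, ← integral_mul_const]
    refine integral_congr_ae (Eventually.of_forall fun y => ?_)
    simp only; ring
  have e2 : ∀ y, f y * sgroup d t ψ y = ∫ x, kz d (t * Complex.I) (x - y) * (ψ x * f y) := by
    intro y
    rw [sgroup_eq ht, ← integral_const_mul]
    refine integral_congr_ae (Eventually.of_forall fun x => ?_)
    simp only [kz, norm_sub_rev y x]; ring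
  simp only [e1, e2]
  exact integral_integral_swap hIntg

lemma Bform_reflect {a : ℝ} (t : ℝ) (g : ℝ → ℝ≥0∞) :
    Bform a (fun u => g (t - u)) (fun u => g (t - u)) = Bform a g g := by
  unfold Bform
  rw [← lintegral_sub_left_eq_self (fun u => ∫⁻ s, g u * (fker a (u - s) * g s)) t]
  refine lintegral_congr fun u => ?_
  rw [← lintegral_sub_left_eq_self (fun s => g (t - u) * (fker a (t - u - s) * g s)) t]
  refine lintegral_congr fun s => ?_
  have : fker a (t - u - (t - s)) = fker a (u - s) := by
    simp only [fker]
    rw [show t - u - (t - s) = -(u - s) by ring, abs_neg]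
  rw [this]

lemma LpN_duhamel {d : ℕ} (s t : ℝ) (f : ℝ → Rd d → ℂ) :
    LpN d s (fun x => ∫ τ in (0:ℝ)..t, sgroup d (t - τ) (f τ) x) =
      LpN d s (fun x => ∫ τ in uIoc 0 t, (if τ = t then 0 else sgroup d (t - τ) (f τ) x)) := by
  refine eLpNorm_congr_norm_ae (Eventually.of_forall fun x => ?_)
  rw [intervalIntegral.norm_intervalIntegral_eq]
  congr 1
  refine integral_congr_ae (ae_restrict_of_ae ?_)
  filter_upwards [Measure.ae_ne volume t] with τ hτ
  rw [if_neg hτ]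

lemma mem_of_between {I : Set ℝ} (hI : I.OrdConnected) (h0 : (0:ℝ) ∈ closure I) {t τ : ℝ} (ht : t ∈ I)
    (hτ : τ ∈ uIoc 0 t) (hτ0 : τ ≠ 0) : τ ∈ I := by
  rcases le_total 0 t with h | h
  · rw [uIoc_of_le h] at hτ
    obtain ⟨p, hp1, hp2⟩ := mem_closure_iff.1 h0 (Iio τ) isOpen_Iio hτ.1
    exact hI.out hp2 ht ⟨(show p < τ from hp1).le, hτ.2⟩
  · rw [uIoc_of_ge h] at hτ
    obtain ⟨p, hp1, hp2⟩ := mem_closure_iff.1 h0 (Ioi τ) isOpen_Ioi (lt_of_le_of_ne hτ.2 hτ0)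
    exact hI.out ht hp2 ⟨hτ.1.le, (show τ < p from hp1).le⟩

lemma duhamel_est {d : ℕ} {r a : ℝ} (hr : 2 < r) (ha : a = d * (1/2 - 1/r)) (ha0 : 0 ≤ a) {I : Set ℝ}
    (hI : I.OrdConnected) (h0 : (0:ℝ) ∈ closure I) {f : ℝ → Rd d → ℂ} {g : ℝ → ℝ≥0∞} (hg : Measurable g)
    (hgf : ∀ τ ∈ I, LpN d (r/(r-1)) (f τ) ≤ g τ) {t : ℝ} (ht : t ∈ I) :
    LpN d r (fun x => ∫ τ in (0:ℝ)..t, sgroup d (t - τ) (f τ) x) ≤ Cdis r * ∫⁻ τ, fker a (t - τ) * g τ ∧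
    LpN d 2 (fun x => ∫ τ in (0:ℝ)..t, sgroup d (t - τ) (f τ) x) ≤ (Cdis r * Bform a g g) ^ ((1:ℝ)/2) := by
  rw [LpN_duhamel, LpN_duhamel]
  have hconj : r.HolderConjugate (r/(r-1)) := Real.HolderConjugate.conjExponent (by linarith)
  have h22 : (2:ℝ).HolderConjugate 2 := by constructor <;> norm_num
  have hF : ∀ τ, Continuous fun x => if τ = t then (0:ℂ) else sgroup d (t - τ) (f τ) x := by
    intro τ
    by_cases hτ : τ = t
    · simp only [hτ, if_true]; exact continuous_const
    · simp only [if_neg hτ]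
      have ht0 : t - τ ≠ 0 := sub_ne_zero.2 (Ne.symm hτ)
      by_cases hi : Integrable (f τ)
      · exact sgroup_cont ht0 hi
      · rw [sgroup_nonint ht0 hi]; exact continuous_const
  have hae : ∀ᵐ τ ∂(volume.restrict (uIoc 0 t)), τ ∈ I ∧ τ ≠ t := by
    filter_upwards [ae_restrict_mem measurableSet_uIoc, ae_restrict_of_ae (Measure.ae_ne volume 0),
      ae_restrict_of_ae (Measure.ae_ne volume t)] with τ h1 h2 h3
    exact ⟨mem_of_between hI h0 ht h1 h2, h3⟩
  have hfm : Measurable fun τ => fker a (t - τ) := (measurable_fker a).comp (by fun_prop)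
  constructor
  · refine duhamel_dual hconj hr.le hF fun ψ hψ hψM hψR => ?_
    have hm : Measurable fun τ => fker a (t - τ) * g τ := hfm.mul hg
    calc _ ≤ ∫⁻ τ in uIoc 0 t, Cdis r * (fker a (t - τ) * g τ) * LpN d (r/(r-1)) ψ := by
          refine lintegral_mono_ae ?_
          filter_upwards [hae] with τ hτ
          simp only [if_neg hτ.2]
          have ht0 : t - τ ≠ 0 := sub_ne_zero.2 (Ne.symm hτ.2)
          by_cases hi : Integrable (f τ)
          · refine (enorm_integral_le_lintegral_enorm _).trans ?_
            refine (holder_LpN hconj (sgroup_cont ht0 hi).aestronglyMeasurable hψ.aestronglyMeasurable).trans ?_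
            refine mul_le_mul_left ?_ _
            refine (disp ht0 hr ha ha0 hi).trans ?_
            rw [mul_assoc]
            exact mul_le_mul_right (mul_le_mul_right (hgf τ hτ.1) _) _
          · rw [sgroup_nonint ht0 hi]; simp
      _ ≤ ∫⁻ τ, Cdis r * (fker a (t - τ) * g τ) * LpN d (r/(r-1)) ψ := setLIntegral_le_lintegral _ _
      _ = _ := by
          rw [lintegral_mul_const _ (hm.const_mul _), lintegral_const_mul _ hm]
  · refine duhamel_dual h22 le_rfl hF fun ψ hψ hψM hψR => ?_
    obtain ⟨M, hM⟩ := hψM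
    obtain ⟨R, hR⟩ := hψR
    have hψb := lint_bdd (E := Metric.closedBall 0 R) Metric.isClosed_closedBall.measurableSet
      (isCompact_closedBall _ _).measure_lt_top hψ hM (fun x hx => hR x (by simpa using hx))
    obtain ⟨N, hN, hNe, hNb⟩ := core' hr ha ha0 hψb.1 hψb.2
    calc _ ≤ ∫⁻ τ in uIoc 0 t, g τ * N (t - τ) := by
          refine lintegral_mono_ae ?_
          filter_upwards [hae] with τ hτ
          simp only [if_neg hτ.2]
          have ht0 : t - τ ≠ 0 := sub_ne_zero.2 (Ne.symm hτ.2)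
          by_cases hi : Integrable (f τ)
          · rw [sgroup_symm ht0 hi hψb.1]
            refine (enorm_integral_le_lintegral_enorm _).trans ?_
            refine (holder_LpN hconj.symm hi.aestronglyMeasurable (sgroup_cont ht0 hψb.1).aestronglyMeasurable).trans ?_
            rw [hNe _ ht0]
            exact mul_le_mul_left (hgf τ hτ.1) _
          · rw [sgroup_nonint ht0 hi]; simp
      _ ≤ ∫⁻ τ, g τ * N (t - τ) := setLIntegral_le_lintegral _ _
      _ = ∫⁻ τ, g (t - τ) * N τ := by
          rw [← lintegral_sub_left_eq_self (fun τ => g τ * N (t - τ)) t]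
          simp
      _ ≤ _ := by
          refine (hNb (fun τ => g (t - τ)) (hg.comp (by fun_prop))).trans (le_of_eq ?_)
          rw [Bform_reflect, mul_comm]

lemma lorentz_of_dual {a q : ℝ} (ha0 : 0 < a) (ha1 : a < 1) (haq : a = 2/q) {N : ℝ → ℝ≥0∞} (hN : Measurable N)
    {K : ℝ≥0∞} (hK : ∀ h : ℝ → ℝ≥0∞, Measurable h → ∫⁻ t, h t * N t ≤ K * Bform a h h ^ ((1:ℝ)/2))
    {I : Set ℝ} {g : ℝ → ℝ≥0∞} (hg : ∀ᵐ t, t ∈ I → g t ≤ N t) :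
    lorentz2Norm q I g ≤ ENNReal.ofReal q ^ ((1:ℝ)/2) * (2 * Cker a) ^ ((1:ℝ)/2) * K := by
  rw [lorentz2Norm_eq, ← haq, mul_assoc]
  refine mul_le_mul_right ?_ _
  have h1 : ∫⁻ c in Ioi (0:ℝ), ENNReal.ofReal c * volume {t ∈ I | ENNReal.ofReal c ≤ g t} ^ a ≤ 2 * Cker a * K ^ 2 := by
    refine le_trans (lintegral_mono fun c => ?_) (dual_lorentz ha0 ha1 hN hK)
    refine mul_le_mul_right (ENNReal.rpow_le_rpow (measure_mono_ae ?_) ha0.le) _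
    filter_upwards [hg] with t ht
    intro h
    exact le_trans h.2 (ht h.1)
  refine (ENNReal.rpow_le_rpow h1 (by norm_num)).trans (le_of_eq ?_)
  rw [ENNReal.mul_rpow_of_nonneg _ _ (by norm_num), ← ENNReal.rpow_two, ← ENNReal.rpow_mul]
  norm_num

end

noncomputable section
open MeasureTheory Real Filter Topology Set
open scoped ENNReal NNReal

/-- Lemma `Lorentz3`, Strichartz estimates in Lorentz spaces: for an
admissible pair `(q,r)` with `2 < q < ∞`, there is `C > 0`, independent of the interval
`I` (with `0 ∈ closure I`), such that
`‖e^{itΔ}φ‖_{L^{q,2}(ℝ,L^r)} ≤ C‖φ‖_{L²}` and the Duhamel term satisfies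
`‖∫₀^t e^{i(t-τ)Δ}f(τ)dτ‖_{L^{q,2}(I,L^r) ∩ L^∞(I,L²)} ≤ C‖f‖_{L^{q',2}(I,L^{r'})}`. -/
theorem lorentz_strichartz (d : ℕ) (hd : 1 ≤ d) (q r : ℝ) (hqr : IsAdmissible d q r)
    (hq : 2 < q) :
    ∃ C > (0:ℝ),
      (∀ φ : Rd d → ℂ,
        lorentz2Norm q Set.univ (fun t => LpN d r (sgroup d t φ)) ≤
          ENNReal.ofReal C * eLpNorm φ 2 volume) ∧
      (∀ I : Set ℝ, I.OrdConnected → (0:ℝ) ∈ closure I →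
        ∀ f : ℝ → Rd d → ℂ,
          lorentz2Norm q I
              (fun t => LpN d r (fun x => ∫ τ in (0:ℝ)..t, sgroup d (t - τ) (f τ) x)) ≤
            ENNReal.ofReal C *
              lorentz2Norm (q/(q-1)) I (fun t => LpN d (r/(r-1)) (f t)) ∧
          ∀ t ∈ I,
            LpN d 2 (fun x => ∫ τ in (0:ℝ)..t, sgroup d (t - τ) (f τ) x) ≤
              ENNReal.ofReal C *
                lorentz2Norm (q/(q-1)) I (fun t => LpN d (r/(r-1)) (f t))) := by
  have hq0 : 0 < q := by linarith
  obtain ⟨ha, -, hr2, -⟩ := hqr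
  obtain ⟨a, haq⟩ : ∃ a : ℝ, a = 2 / q := ⟨_, rfl⟩
  have had : a = d * (1/2 - 1/r) := haq.trans ha
  have ha0 : 0 < a := by rw [haq]; positivity
  have ha1 : a < 1 := by rw [haq, div_lt_one hq0]; exact hq
  have hr : 2 < r := by
    rcases hr2.lt_or_eq with h | h
    · exact h
    · exfalso; rw [had, ← h] at ha0; norm_num at ha0
  have hq1 : 0 < q - 1 := by linarith
  set A1 : ℝ≥0∞ := ENNReal.ofReal q ^ ((1:ℝ)/2) * (2 * Cker a) ^ ((1:ℝ)/2) with hA1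
  have hA1t : A1 ≠ ⊤ := ENNReal.mul_ne_top (ENNReal.rpow_ne_top_of_nonneg (by norm_num) (by simp))
    (ENNReal.rpow_ne_top_of_nonneg (by norm_num) (ENNReal.mul_ne_top (by simp) (Cker_ne_top a)))
  have hDt : Cdis r ≠ ⊤ := Cdis_ne_top hr
  have hD2 : Cdis r ^ ((1:ℝ)/2) ≠ ⊤ := ENNReal.rpow_ne_top_of_nonneg (by norm_num) hDt
  have hG2 : CG a ^ ((1:ℝ)/2) ≠ ⊤ := ENNReal.rpow_ne_top_of_nonneg (by norm_num) (CG_ne_top a)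
  set C1 : ℝ≥0∞ := A1 * Cdis r ^ ((1:ℝ)/2) with hC1
  set C2 : ℝ≥0∞ := A1 * (Cdis r * CG a ^ ((1:ℝ)/2)) with hC2
  set C3 : ℝ≥0∞ := Cdis r ^ ((1:ℝ)/2) * CG a ^ ((1:ℝ)/2) with hC3
  have hC1t : C1 ≠ ⊤ := ENNReal.mul_ne_top hA1t hD2
  have hC2t : C2 ≠ ⊤ := ENNReal.mul_ne_top hA1t (ENNReal.mul_ne_top hDt hG2)
  have hC3t : C3 ≠ ⊤ := ENNReal.mul_ne_top hD2 hG2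
  have hCt : C1 + C2 + C3 ≠ ⊤ := ENNReal.add_ne_top.2 ⟨ENNReal.add_ne_top.2 ⟨hC1t, hC2t⟩, hC3t⟩
  have hC : C1 + C2 + C3 ≤ ENNReal.ofReal ((C1 + C2 + C3).toReal + 1) := by
    rw [← ENNReal.ofReal_toReal hCt, ENNReal.toReal_ofReal ENNReal.toReal_nonneg]
    exact ENNReal.ofReal_le_ofReal (by linarith)
  have hCpos : 0 < (C1 + C2 + C3).toReal + 1 := by positivity
  have hC1' : C1 ≤ ENNReal.ofReal ((C1 + C2 + C3).toReal + 1) :=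
    (le_self_add.trans le_self_add).trans hC
  have hC2' : C2 ≤ ENNReal.ofReal ((C1 + C2 + C3).toReal + 1) :=
    (le_add_self.trans le_self_add).trans hC
  have hC3' : C3 ≤ ENNReal.ofReal ((C1 + C2 + C3).toReal + 1) := le_add_self.trans hC
  refine ⟨(C1 + C2 + C3).toReal + 1, hCpos, ?_, ?_⟩
  · intro φ
    by_cases hφt : eLpNorm φ 2 volume = ⊤
    · rw [hφt, ENNReal.mul_top (by simpa using hCpos)]; exact le_top
    have hL2 : LpN d 2 φ = eLpNorm φ 2 volume := by
      unfold LpN; norm_num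
    by_cases hφ : Integrable φ
    · have hφ2 : ∫⁻ x, ‖φ x‖ₑ ^ 2 < ⊤ := by
        rw [← hL2, LpN_two_sq] at hφt
        by_contra hn
        rw [not_lt, top_le_iff] at hn
        exact hφt (by rw [hn]; exact ENNReal.top_rpow_of_pos (by norm_num))
      obtain ⟨N, hN, hNe, hNb⟩ := core' hr had ha0.le hφ hφ2
      have hb := lorentz_of_dual (q := q) (I := Set.univ) (g := fun t => LpN d r (sgroup d t φ)) ha0 ha1 haq hN
        (K := Cdis r ^ ((1:ℝ)/2) * LpN d 2 φ) (by
          intro h hh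
          refine (hNb h hh).trans (le_of_eq ?_)
          rw [ENNReal.mul_rpow_of_nonneg _ _ (by norm_num)]; ring) (by
          filter_upwards [Measure.ae_ne volume (0:ℝ)] with t ht
          intro _
          exact (hNe t ht).le)
      refine hb.trans ?_
      rw [← mul_assoc, hL2]
      exact mul_le_mul_left hC1' _
    · have hb := lorentz_of_dual (q := q) (I := Set.univ) (g := fun t => LpN d r (sgroup d t φ)) ha0 ha1 haq
        (N := fun _ => 0) measurable_const (K := 0) (by
          intro h hh
          simp) (by
          filter_upwards [Measure.ae_ne volume (0:ℝ)] with t ht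
          intro _
          rw [sgroup_nonint ht hφ]
          simp [LpN])
      rw [mul_zero] at hb
      exact hb.trans zero_le
  · intro I hI h0 f
    obtain ⟨g, hg, hgf, hgm⟩ := majorant I (fun t => LpN d (r/(r-1)) (f t))
    set L : ℝ≥0∞ := lorentz2Norm (q/(q-1)) I (fun t => LpN d (r/(r-1)) (f t)) with hL
    have hBL : Bform a g g ^ ((1:ℝ)/2) ≤ CG a ^ ((1:ℝ)/2) * L := by
      refine (ENNReal.rpow_le_rpow (Bform_le ha0 ha1 hg hgm) (by norm_num)).trans ?_
      rw [ENNReal.mul_rpow_of_nonneg _ _ (by norm_num)]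
      refine mul_le_mul_right ?_ _
      rw [hL, lorentz2Norm_eq, show 2 / (q/(q-1)) = 2 - a by rw [haq]; field_simp]
      refine le_mul_of_one_le_left zero_le ?_
      refine ENNReal.one_le_rpow ?_ (by norm_num)
      rw [ENNReal.one_le_ofReal, one_le_div hq1]
      linarith
    have hest := fun t (ht : t ∈ I) => duhamel_est hr had ha0.le hI h0 hg hgf ht
    have hjm : Measurable fun p : ℝ × ℝ => fker a (p.1 - p.2) * g p.2 :=
      ((measurable_fker a).comp (by fun_prop)).mul (hg.comp measurable_snd)
    have hQm : Measurable fun t => ∫⁻ τ, fker a (t - τ) * g τ := hjm.lintegral_prod_right'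
    constructor
    · have hb := lorentz_of_dual (q := q) (I := I)
        (g := fun t => LpN d r (fun x => ∫ τ in (0:ℝ)..t, sgroup d (t - τ) (f τ) x)) ha0 ha1 haq
        (N := fun t => Cdis r * ∫⁻ τ, fker a (t - τ) * g τ) (hQm.const_mul _)
        (K := Cdis r * CG a ^ ((1:ℝ)/2) * L) (by
          intro h hh
          have e : ∫⁻ t, h t * (Cdis r * ∫⁻ τ, fker a (t - τ) * g τ) = Cdis r * Bform a h g := by
            unfold Bform
            have e2 : ∀ t, ∫⁻ s, h t * (fker a (t - s) * g s) = h t * ∫⁻ s, fker a (t - s) * g s := by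
              intro t
              have hm : Measurable fun s => fker a (t - s) * g s :=
                ((measurable_fker a).comp (by fun_prop)).mul hg
              rw [lintegral_const_mul _ hm]
            simp only [e2]
            rw [← lintegral_const_mul' _ _ hDt]
            refine lintegral_congr fun t => ?_
            ring
          rw [e, mul_assoc, mul_assoc]
          refine mul_le_mul_right ?_ _
          refine (Bform_cs ha0 hh hg).trans ?_
          rw [← mul_assoc, mul_comm]
          exact mul_le_mul_left hBL _) (Eventually.of_forall fun t ht => (hest t ht).1)
      refine hb.trans ?_
      rw [← mul_assoc]
      exact mul_le_mul_left hC2' _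
    · intro t ht
      refine (hest t ht).2.trans ?_
      rw [ENNReal.mul_rpow_of_nonneg _ _ (by norm_num)]
      refine (mul_le_mul_right hBL _).trans ?_
      rw [← mul_assoc]
      exact mul_le_mul_left hC3' _
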